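/- arXiv:2304.06609 — 2 statements merged into one kernel-verified Lean document; each statement's English description precedes it below -/
import Mathlib

section
/- Let R be an n-dimensional Cohen-Macaulay ring with canonical module ω_R, and let M be a sequentially Cohen-Macaulay R-module with sCM filtration 0 = M_0 ⊊ M_1 ⊊ … ⊊ M_r = M и d_i = dim(M_i/M_{i-1}). Then: (1) for all i = 1,…,r, Ext_R^{n-d_i}(M, ω_R) ≅ Ext_R^{n-d_i}(M_i/M_{i-1}, ω_R) is Cohen-Macaulay of dimension d_i; (2) Ext_R^{n-j}(M, ω_R) = 0 whenever j ∉ {d_1,…,d_r}; (3) Ext_R^{n-d_i}(Ext_R^{n-d_i}(M, ω_R), ω_R) ≅ M_i/M_{i-1} for all i = 1,…,r. -/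
open CategoryTheory

noncomputable section

/-- The (Krull) dimension of a module: the Krull dimension of its support.
The dimension of the zero module is `⊥` (thought of as `-1`). -/
noncomputable def mDim (R : Type) [CommRing R] (M : Type) [AddCommGroup M] [Module R M] :
    WithBot ℕ∞ :=
  Order.krullDim (Module.support R M)

/-- The `i`-th Ext module `Ext_R^i(A, B)` (as a type). -/
noncomputable abbrev extC (R : Type) [CommRing R] (i : ℕ) (A B : Type)
    [AddCommGroup A] [Module R A] [AddCommGroup B] [Module R B] : Type :=
  ↥(((Ext R (ModuleCat R) i).obj (Opposite.op (ModuleCat.of R A))).obj (ModuleCat.of R B))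

/-- The depth of a module `M` with respect to an ideal `I`:
the least `i` such that `Ext_R^i(R/I, M) ≠ 0` (and `⊤` if there is no such `i`,
in particular the depth of the zero module is `⊤ = +∞`). -/
noncomputable def mDepth (R : Type) [CommRing R] (I : Ideal R) (M : Type)
    [AddCommGroup M] [Module R M] : ℕ∞ :=
  sInf {i : ℕ∞ | ∃ j : ℕ, i = j ∧ Nontrivial (extC R j (R ⧸ I) M)}

/-- `M` is a Cohen-Macaulay module (with respect to the (maximal) ideal `I`) if it is
nonzero and its depth equals its dimension. -/
def IsCM (R : Type) [CommRing R] (I : Ideal R) (M : Type) [AddCommGroup M] [Module R M] :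
    Prop :=
  Nontrivial M ∧ (mDepth R I M : WithBot ℕ∞) = mDim R M

/-- The subquotient `N'/N` of a module (most meaningful when `N ≤ N'`). -/
abbrev subQuot (R : Type) [CommRing R] {M : Type} [AddCommGroup M] [Module R M]
    (N N' : Submodule R M) : Type :=
  N' ⧸ (Submodule.comap N'.subtype N)

/-- `F 0 = 0 ⊊ F 1 ⊊ ⋯ ⊊ F r = M` is a sCM filtration: each quotient `F (i+1) / F i`
is Cohen-Macaulay and the dimensions of the quotients are strictly increasing. -/
def IsSCMFil (R : Type) [CommRing R] (I : Ideal R) {M : Type} [AddCommGroup M] [Module R M]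
    (r : ℕ) (F : ℕ → Submodule R M) : Prop :=
  F 0 = ⊥ ∧ F r = ⊤ ∧ (∀ i < r, F i < F (i + 1)) ∧
    (∀ i < r, IsCM R I (subQuot R (F i) (F (i + 1)))) ∧
    (∀ i, i + 1 < r →
      mDim R (subQuot R (F i) (F (i + 1))) < mDim R (subQuot R (F (i + 1)) (F (i + 2))))

/-- `M` is sequentially Cohen-Macaulay if it admits a sCM filtration. -/
def IsSeqCM (R : Type) [CommRing R] (I : Ideal R) (M : Type) [AddCommGroup M] [Module R M] :
    Prop :=
  ∃ (r : ℕ) (F : ℕ → Submodule R M), IsSCMFil R I r F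

/-- `δ_c(M)`: the largest submodule of `M` of dimension at most `c`. -/
noncomputable def deltaSub (R : Type) [CommRing R] (M : Type) [AddCommGroup M] [Module R M]
    (c : ℕ) : Submodule R M :=
  sSup {N : Submodule R M | mDim R ↥N ≤ (c : WithBot ℕ∞)}

/-- `δ_{c-1}(M)`, with `δ_{-1}(M) = 0`. -/
noncomputable def deltaSubPred (R : Type) [CommRing R] (M : Type) [AddCommGroup M] [Module R M] :
    ℕ → Submodule R M
  | 0 => ⊥
  | (c + 1) => deltaSub R M c

/-- `H^0_I(M)`, the `I`-power-torsion submodule of `M`. -/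
noncomputable def tors (R : Type) [CommRing R] (I : Ideal R) (M : Type) [AddCommGroup M]
    [Module R M] : Submodule R M :=
  ⨆ t : ℕ, Submodule.torsionBySet R M ((I ^ t : Ideal R) : Set R)

end
noncomputable section

/-- A Noetherian local ring `R` is Cohen-Macaulay if it is Cohen-Macaulay as a module
over itself. -/
def IsCMLocalRing (R : Type) [CommRing R] [IsLocalRing R] : Prop :=
  IsCM R (IsLocalRing.maximalIdeal R) R

/-- `ω` is a canonical module of the Cohen-Macaulay Noetherian local ring `R` of Krull
dimension `n`: a finitely generated module such that `Ext_R^i(k, ω)` vanishes for `i ≠ n`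
and is isomorphic to the residue field `k = R/𝔪` for `i = n`. -/
def IsCanonicalModule (R : Type) [CommRing R] [IsLocalRing R]
    (ω : Type) [AddCommGroup ω] [Module R ω] : Prop :=
  Module.Finite R ω ∧
    ∀ i : ℕ,
      (((i : WithBot ℕ∞) = ringKrullDim R) →
        Nonempty (extC R i (R ⧸ IsLocalRing.maximalIdeal R) ω ≃ₗ[R]
          (R ⧸ IsLocalRing.maximalIdeal R))) ∧
      (((i : WithBot ℕ∞) ≠ ringKrullDim R) →
        Subsingleton (extC R i (R ⧸ IsLocalRing.maximalIdeal R) ω))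

end

namespace SCM

open CategoryTheory Abelian

/-- Ext modules in the sense of derived categories, unbundled. -/
noncomputable abbrev EX (R : Type) [CommRing R] (A B : Type) [AddCommGroup A] [Module R A]
    [AddCommGroup B] [Module R B] (i : ℕ) : Type :=
  CategoryTheory.Abelian.Ext.{0} (ModuleCat.of R A) (ModuleCat.of R B) i

section toolkit

variable {R : Type} [CommRing R]
variable {A B C W : Type} [AddCommGroup A] [Module R A] [AddCommGroup B] [Module R B]
  [AddCommGroup C] [Module R C] [AddCommGroup W] [Module R W]

/-- contravariant functoriality -/
noncomputable def pre (f : A →ₗ[R] B) (W : Type) [AddCommGroup W] [Module R W] (i : ℕ) :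
    EX R B W i →ₗ[R] EX R A W i :=
  (Ext.mk₀ (ModuleCat.ofHom f)).precompOfLinear R (ModuleCat.of R W) (zero_add i)

/-- covariant functoriality -/
noncomputable def post (f : A →ₗ[R] B) (W : Type) [AddCommGroup W] [Module R W] (i : ℕ) :
    EX R W A i →ₗ[R] EX R W B i :=
  (Ext.mk₀ (ModuleCat.ofHom f)).postcompOfLinear R (ModuleCat.of R W) (add_zero i)

lemma pre_apply (f : A →ₗ[R] B) (i : ℕ) (x : EX R B W i) :
    pre f W i x = (Ext.mk₀ (ModuleCat.ofHom f)).comp x (zero_add i) := rfl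

lemma post_apply (f : A →ₗ[R] B) (i : ℕ) (x : EX R W A i) :
    post f W i x = x.comp (Ext.mk₀ (ModuleCat.ofHom f)) (add_zero i) := rfl

lemma pre_smul (r : R) (i : ℕ) (x : EX R A W i) :
    pre (LinearMap.lsmul R A r) W i x = r • x := by
  rw [pre_apply]
  have : ModuleCat.ofHom (LinearMap.lsmul R A r) = r • 𝟙 (ModuleCat.of R A) := rfl
  rw [this, Ext.mk₀_smul, Ext.smul_comp, Ext.mk₀_id_comp]

lemma post_smul (r : R) (i : ℕ) (x : EX R W A i) :
    post (LinearMap.lsmul R A r) W i x = r • x := by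
  rw [post_apply]
  have : ModuleCat.ofHom (LinearMap.lsmul R A r) = r • 𝟙 (ModuleCat.of R A) := rfl
  rw [this, Ext.mk₀_smul, Ext.comp_smul, Ext.comp_mk₀_id]

lemma pre_comp (f : A →ₗ[R] B) (g : B →ₗ[R] C) (i : ℕ) (x : EX R C W i) :
    pre f W i (pre g W i x) = pre (g ∘ₗ f) W i x := by
  rw [pre_apply, pre_apply, pre_apply, Ext.mk₀_comp_mk₀_assoc]; rfl

lemma post_comp (f : A →ₗ[R] B) (g : B →ₗ[R] C) (i : ℕ) (x : EX R W A i) :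
    post g W i (post f W i x) = post (g ∘ₗ f) W i x := by
  rw [post_apply, post_apply, post_apply,
    Ext.comp_assoc_of_third_deg_zero, Ext.mk₀_comp_mk₀]; rfl

lemma pre_id (i : ℕ) (x : EX R A W i) : pre LinearMap.id W i x = x := by
  rw [pre_apply]; exact Ext.mk₀_id_comp x

lemma post_id (i : ℕ) (x : EX R W A i) : post LinearMap.id W i x = x := by
  rw [post_apply]; exact Ext.comp_mk₀_id x

/-- invariance in the first variable -/
noncomputable def preEquiv (e : A ≃ₗ[R] B) (W : Type) [AddCommGroup W] [Module R W] (i : ℕ) :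
    EX R B W i ≃ₗ[R] EX R A W i :=
  LinearEquiv.ofLinearMap (pre e.toLinearMap W i) (pre e.symm.toLinearMap W i)
    (by ext x; simp [pre_comp, pre_id]) (by ext x; simp [pre_comp, pre_id])

/-- invariance in the second variable -/
noncomputable def postEquiv (e : A ≃ₗ[R] B) (W : Type) [AddCommGroup W] [Module R W] (i : ℕ) :
    EX R W A i ≃ₗ[R] EX R W B i :=
  LinearEquiv.ofLinearMap (post e.toLinearMap W i) (post e.symm.toLinearMap W i)
    (by ext x; simp [post_comp, post_id]) (by ext x; simp [post_comp, post_id])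

/-- `Ext^0` is Hom. -/
noncomputable def ex0 (A W : Type) [AddCommGroup A] [Module R A] [AddCommGroup W] [Module R W] :
    EX R A W 0 ≃ₗ[R] (A →ₗ[R] W) :=
  Ext.linearEquiv₀.trans ModuleCat.homLinearEquiv

lemma ex0_symm_apply (f : A →ₗ[R] W) : (ex0 A W).symm f = Ext.mk₀ (ModuleCat.ofHom f) := rfl

lemma pre_ex0 (f : A →ₗ[R] B) (x : B →ₗ[R] W) :
    pre f W 0 ((ex0 B W).symm x) = (ex0 A W).symm (x ∘ₗ f) := by
  simp only [pre_apply, ex0_symm_apply, Ext.mk₀_comp_mk₀]; rfl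

lemma post_ex0 (f : A →ₗ[R] B) (x : W →ₗ[R] A) :
    post f W 0 ((ex0 W A).symm x) = (ex0 W B).symm (f ∘ₗ x) := by
  simp only [post_apply, ex0_symm_apply, Ext.mk₀_comp_mk₀]; rfl

lemma shortEx {f : A →ₗ[R] B} {g : B →ₗ[R] C} (hf : Function.Injective f)
    (hg : Function.Surjective g) (h : Function.Exact f g) :
    (ModuleCat.shortComplexOfCompEqZero f g h.linearMap_comp_eq_zero).ShortExact where
  exact := ModuleCat.shortComplex_exact _ h
  mono_f := (ModuleCat.mono_iff_injective _).2 hf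
  epi_g := (ModuleCat.epi_iff_surjective _).2 hg

/-- contravariant long exact sequence -/
lemma contra {f : A →ₗ[R] B} {g : B →ₗ[R] C} (hf : Function.Injective f)
    (hg : Function.Surjective g) (h : Function.Exact f g) (W : Type) [AddCommGroup W]
    [Module R W] (i : ℕ) :
    ∃ δ : EX R A W i →ₗ[R] EX R C W (i + 1),
      Function.Exact (pre g W i) (pre f W i) ∧ Function.Exact (pre f W i) δ ∧
      Function.Exact δ (pre g W (i + 1)) := by
  have hS := shortEx hf hg h
  refine ⟨hS.extClass.precompOfLinear R (ModuleCat.of R W) (add_comm 1 i), ?_, ?_, ?_⟩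
  · intro y
    constructor
    · intro hy
      exact Ext.contravariant_sequence_exact₂ hS _ y hy
    · rintro ⟨x, rfl⟩
      rw [pre_comp, h.linearMap_comp_eq_zero, pre_apply]
      exact (congrArg (fun t => Ext.comp t x (zero_add i)) (Ext.mk₀_zero _ _)).trans (Ext.zero_comp _ _ _ _ _)
  · intro y
    constructor
    · intro hy
      exact Ext.contravariant_sequence_exact₁ hS _ y (add_comm 1 i) hy
    · rintro ⟨x, rfl⟩
      exact hS.extClass_comp_assoc x (h := add_comm 1 i)
  · intro y
    constructor
    · intro hy
      exact Ext.contravariant_sequence_exact₃ hS _ y hy (add_comm 1 i)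
    · rintro ⟨x, rfl⟩
      exact hS.comp_extClass_assoc x (add_comm 1 i)

/-- covariant long exact sequence -/
lemma covar {f : A →ₗ[R] B} {g : B →ₗ[R] C} (hf : Function.Injective f)
    (hg : Function.Surjective g) (h : Function.Exact f g) (W : Type) [AddCommGroup W]
    [Module R W] (i : ℕ) :
    ∃ δ : EX R W C i →ₗ[R] EX R W A (i + 1),
      Function.Exact (post f W i) (post g W i) ∧ Function.Exact (post g W i) δ ∧
      Function.Exact δ (post f W (i + 1)) := by
  have hS := shortEx hf hg h
  refine ⟨hS.extClass.postcompOfLinear R (ModuleCat.of R W) rfl, ?_, ?_, ?_⟩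
  · intro y
    constructor
    · intro hy
      exact Ext.covariant_sequence_exact₂ _ hS y hy
    · rintro ⟨x, rfl⟩
      rw [post_comp, h.linearMap_comp_eq_zero, post_apply]
      exact (congrArg (fun t => Ext.comp x t (add_zero i)) (Ext.mk₀_zero _ _)).trans (Ext.comp_zero _ _ _ _ _)
  · intro y
    constructor
    · intro hy
      exact Ext.covariant_sequence_exact₃ _ hS y rfl hy
    · rintro ⟨x, rfl⟩
      change Ext.comp (Ext.comp x _ (add_zero i)) hS.extClass rfl = 0
      rw [Ext.comp_assoc_of_second_deg_zero]
      exact (congrArg (fun t => Ext.comp x t (rfl : i + 1 = i + 1)) hS.comp_extClass).trans (Ext.comp_zero _ _ _ _ _)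
  · intro y
    constructor
    · intro hy
      exact Ext.covariant_sequence_exact₁ _ hS y hy rfl
    · rintro ⟨x, rfl⟩
      change Ext.comp (Ext.comp x hS.extClass rfl) _ (add_zero (i+1)) = 0
      rw [Ext.comp_assoc_of_third_deg_zero]
      exact (congrArg (fun t => Ext.comp x t (rfl : i + 1 = i + 1)) hS.extClass_comp).trans (Ext.comp_zero _ _ _ _ _)

lemma pre_zero_injective {g : B →ₗ[R] C} (hg : Function.Surjective g) :
    Function.Injective (pre g W 0) := by
  have : Epi (ModuleCat.ofHom g) := (ModuleCat.epi_iff_surjective _).2 hg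
  exact Ext.precomp_mk₀_injective_of_epi (ModuleCat.of R W) (ModuleCat.ofHom g)

lemma ex_ann {r : R} (h : r ∈ Module.annihilator R A) (i : ℕ) (x : EX R A W i) : r • x = 0 := by
  rw [← pre_smul, Module.mem_annihilator_iff_lsmul_eq_zero.mp h, pre_apply]
  exact (congrArg (fun t => Ext.comp t x (zero_add i)) (Ext.mk₀_zero _ _)).trans (Ext.zero_comp _ _ _ _ _)

lemma ex_proj [Module.Projective R A] (i : ℕ) : Subsingleton (EX R A W (i + 1)) := by
  have : Projective (ModuleCat.of R A) := ModuleCat.projective_of_categoryTheory_projective _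
  exact Ext.subsingleton_of_projective _ _ _

lemma ex_sub_left [Subsingleton A] (i : ℕ) : Subsingleton (EX R A W i) := by
  refine ⟨fun x y => ?_⟩
  rw [← one_smul R x, ← one_smul R y, ex_ann, ex_ann] <;>
  exact Module.mem_annihilator.2 fun _ => Subsingleton.elim _ _

instance ex_fin [IsNoetherianRing R] [Module.Finite R A] [Module.Finite R W] (i : ℕ) :
    Module.Finite R (EX R A W i) := ModuleCat.finite_ext R _ _ i

end toolkit

end SCM

namespace SCM

open CategoryTheory Abelian

section compare

variable {R : Type} [CommRing R]

/-- maps out of a cokernel -/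
noncomputable def homCoker {A B C W : Type} [AddCommGroup A] [Module R A] [AddCommGroup B]
    [Module R B] [AddCommGroup C] [Module R C] [AddCommGroup W] [Module R W]
    (f : A →ₗ[R] B) (g : B →ₗ[R] C) (hg : Function.Surjective g) (h : Function.Exact f g) :
    (C →ₗ[R] W) ≃ₗ[R] LinearMap.ker (LinearMap.lcomp R W f) :=
  LinearEquiv.ofBijective
    ((LinearMap.lcomp R W g).codRestrict _ (fun c => by
      ext a
      simp [h.apply_apply_eq_zero]))
    ⟨fun c c' hc => by
      have := congrArg Subtype.val hc
      ext y
      obtain ⟨b, rfl⟩ := hg y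
      exact LinearMap.congr_fun this b,
    fun ⟨φ, hφ⟩ => by
      have hk : LinearMap.ker g ≤ LinearMap.ker φ := by
        intro b hb
        obtain ⟨a, rfl⟩ := (h b).1 hb
        exact LinearMap.congr_fun hφ a
      refine ⟨(LinearMap.ker g).liftQ φ hk ∘ₗ
        (g.quotKerEquivOfSurjective hg).symm.toLinearMap, Subtype.ext ?_⟩
      ext b
      have : (g.quotKerEquivOfSurjective hg).symm (g b) = (LinearMap.ker g).mkQ b := by
        rw [LinearEquiv.symm_apply_eq]; rfl
      change (LinearMap.ker g).liftQ φ hk ((g.quotKerEquivOfSurjective hg).symm (g b)) = φ b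
      rw [this]; rfl⟩

lemma res_zero (P : ℕ → Type) [∀ i, AddCommGroup (P i)] [∀ i, Module R (P i)]
    (d : ∀ i, P (i + 1) →ₗ[R] P i)
    {A W : Type} [AddCommGroup A] [Module R A] [AddCommGroup W] [Module R W]
    (ε : P 0 →ₗ[R] A) (hε : Function.Surjective ε) (h0 : Function.Exact (d 0) ε) :
    Nonempty (LinearMap.ker (LinearMap.lcomp R W (d 0)) ≃ₗ[R] EX R A W 0) :=
  ⟨(homCoker (d 0) ε hε h0).symm.trans (ex0 A W).symm⟩

lemma res_succ (i : ℕ) {W : Type} [AddCommGroup W] [Module R W] :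
    ∀ (P : ℕ → Type) [∀ i, AddCommGroup (P i)] [∀ i, Module R (P i)]
    [∀ i, Module.Projective R (P i)]
    (d : ∀ i, P (i + 1) →ₗ[R] P i) (_ : ∀ i, Function.Exact (d (i + 1)) (d i))
    {A : Type} [AddCommGroup A] [Module R A]
    (ε : P 0 →ₗ[R] A) (_ : Function.Surjective ε) (_ : Function.Exact (d 0) ε),
    ∃ π : LinearMap.ker (LinearMap.lcomp R W (d (i + 1))) →ₗ[R] EX R A W (i + 1),
      Function.Surjective π ∧ ∀ φ, π φ = 0 ↔ ∃ ψ : P i →ₗ[R] W, ψ ∘ₗ d i = φ.1 := by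
  induction i with
  | zero =>
    intro P _ _ _ d hd A _ _ ε hε h0
    let d' : P 1 →ₗ[R] LinearMap.ker ε := (d 0).codRestrict _ (fun x => h0.apply_apply_eq_zero x)
    have hd' : Function.Surjective d' := by
      rintro ⟨x, hx⟩
      obtain ⟨y, rfl⟩ := (h0 x).1 hx
      exact ⟨y, rfl⟩
    have he : Function.Exact (d 1) d' := by
      intro x
      rw [← (hd 0) x]
      exact Subtype.ext_iff
    obtain ⟨δ, h1, h2, h3⟩ := contra (LinearMap.ker ε).injective_subtype hε
      (LinearMap.exact_subtype_ker_map ε) W 0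
    refine ⟨δ ∘ₗ ((ex0 _ W).symm.toLinearMap ∘ₗ (homCoker (d 1) d' hd' he).symm.toLinearMap),
      ?_, ?_⟩
    · have := ex_proj (R := R) (A := P 0) (W := W) 0
      intro y
      obtain ⟨x, rfl⟩ := (h3 y).1 (Subsingleton.elim _ _)
      obtain ⟨z, rfl⟩ := (ex0 _ W).symm.surjective x
      obtain ⟨z, rfl⟩ := (homCoker (d 1) d' hd' he).symm.surjective z
      exact ⟨z, rfl⟩
    · intro φ
      obtain ⟨φ, rfl⟩ := (homCoker (d 1) d' hd' he).surjective φ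
      simp only [LinearMap.comp_apply, LinearEquiv.coe_coe, LinearEquiv.symm_apply_apply]
      rw [h2]
      constructor
      · rintro ⟨y, hy⟩
        obtain ⟨y, rfl⟩ := (ex0 _ W).symm.surjective y
        rw [pre_ex0] at hy
        refine ⟨y, ?_⟩
        rw [← (ex0 _ W).symm.injective hy]
        rfl
      · rintro ⟨ψ, hψ⟩
        refine ⟨(ex0 _ W).symm ψ, ?_⟩
        rw [pre_ex0]
        congr 1
        ext x
        obtain ⟨x, rfl⟩ := hd' x
        exact LinearMap.congr_fun hψ x
  | succ i ih =>
    intro P _ _ _ d hd A _ _ ε hε h0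
    let d' : P 1 →ₗ[R] LinearMap.ker ε := (d 0).codRestrict _ (fun x => h0.apply_apply_eq_zero x)
    have hd' : Function.Surjective d' := by
      rintro ⟨x, hx⟩
      obtain ⟨y, rfl⟩ := (h0 x).1 hx
      exact ⟨y, rfl⟩
    have he : Function.Exact (d 1) d' := by
      intro x
      rw [← (hd 0) x]
      exact Subtype.ext_iff
    obtain ⟨δ, h1, h2, h3⟩ := contra (LinearMap.ker ε).injective_subtype hε
      (LinearMap.exact_subtype_ker_map ε) W (i + 1)
    obtain ⟨π, hπ, hπ'⟩ := ih (fun j => P (j + 1)) (fun j => d (j + 1)) (fun j => hd (j + 1))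
      d' hd' he
    have s1 := ex_proj (R := R) (A := P 0) (W := W) i
    have s2 := ex_proj (R := R) (A := P 0) (W := W) (i + 1)
    refine ⟨δ ∘ₗ π, ?_, ?_⟩
    · intro y
      obtain ⟨x, rfl⟩ := (h3 y).1 (Subsingleton.elim _ _)
      obtain ⟨z, rfl⟩ := hπ x
      exact ⟨z, rfl⟩
    · intro φ
      rw [← hπ' φ, LinearMap.comp_apply, h2]
      constructor
      · rintro ⟨y, hy⟩
        rw [← hy, Subsingleton.elim y 0, map_zero]
      · intro h
        exact ⟨0, by rw [h, map_zero]⟩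

/-- homology of a cochain complex of modules, by cycles modulo boundaries -/
lemma homology_desc {S : ShortComplex (ModuleCat.{0} R)} :
    ∃ π : LinearMap.ker S.g.hom →ₗ[R] S.homology, Function.Surjective π ∧
      ∀ x, π x = 0 ↔ ∃ y, S.f.hom y = x.1 := by
  refine ⟨S.moduleCatHomologyIso.toLinearEquiv.symm.toLinearMap ∘ₗ
    (LinearMap.range S.moduleCatToCycles).mkQ, ?_, ?_⟩
  · exact (S.moduleCatHomologyIso.toLinearEquiv.symm.surjective).comp (Submodule.mkQ_surjective _)
  · intro x
    have : (S.moduleCatHomologyIso.toLinearEquiv.symm.toLinearMap ∘ₗ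
      (LinearMap.range S.moduleCatToCycles).mkQ) x = 0 ↔
      (LinearMap.range S.moduleCatToCycles).mkQ x = 0 :=
      S.moduleCatHomologyIso.toLinearEquiv.symm.map_eq_zero_iff
    rw [this, Submodule.mkQ_apply, Submodule.Quotient.mk_eq_zero]
    constructor
    · rintro ⟨y, rfl⟩
      exact ⟨y, rfl⟩
    · rintro ⟨y, hy⟩
      exact ⟨y, Subtype.ext hy⟩

lemma equiv_of_surj {A B C : Type} [AddCommGroup A] [Module R A] [AddCommGroup B]
    [Module R B] [AddCommGroup C] [Module R C] (f : A →ₗ[R] B) (g : A →ₗ[R] C)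
    (hf : Function.Surjective f) (hg : Function.Surjective g) (h : ∀ x, f x = 0 ↔ g x = 0) :
    Nonempty (B ≃ₗ[R] C) := by
  have hk : LinearMap.ker f = LinearMap.ker g := by ext x; exact h x
  exact ⟨(f.quotKerEquivOfSurjective hf).symm.trans
    ((Submodule.quotEquivOfEq _ _ hk).trans (g.quotKerEquivOfSurjective hg))⟩

lemma d_eq {X : ChainComplex (ModuleCat.{0} R) ℕ} {W : Type} [AddCommGroup W] [Module R W]
    (i j : ℕ) (φ : X.X i →ₗ[R] W) :
    ((X.linearYonedaObj R (ModuleCat.of R W)).d i j).hom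
      (ModuleCat.ofHom φ : X.X i ⟶ ModuleCat.of R W) =
      (ModuleCat.ofHom (φ ∘ₗ (X.d j i).hom) : X.X j ⟶ ModuleCat.of R W) := by
  rw [ChainComplex.linearYonedaObj_d]
  rfl

/-- change of presentation of cocycles -/
lemma cocyc {X : ChainComplex (ModuleCat.{0} R) ℕ} {W : Type} [AddCommGroup W] [Module R W]
    (i j : ℕ) :
    ∃ T : LinearMap.ker (LinearMap.lcomp R W (X.d j i).hom) →ₗ[R]
      LinearMap.ker ((X.linearYonedaObj R (ModuleCat.of R W)).d i j).hom,
      Function.Surjective T ∧ ∀ φ, (T φ).1 = (ModuleCat.ofHom φ.1 : X.X i ⟶ ModuleCat.of R W) := by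
  refine ⟨LinearMap.codRestrict _ ((ModuleCat.homLinearEquiv (S := R) (M := X.X i)
    (N := ModuleCat.of R W)).symm.toLinearMap ∘ₗ Submodule.subtype _) ?_, ?_, ?_⟩
  · rintro ⟨φ, hφ⟩
    have h := d_eq (X := X) (W := W) i j φ
    have h' : φ ∘ₗ (X.d j i).hom = 0 := hφ
    rw [h'] at h
    exact h
  · rintro ⟨x, hx⟩
    let y : X.X i ⟶ ModuleCat.of R W := x
    refine ⟨⟨y.hom, ?_⟩, Subtype.ext rfl⟩
    have h := d_eq (X := X) (W := W) i j y.hom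
    have h1 : (ModuleCat.ofHom (y.hom ∘ₗ (X.d j i).hom) : X.X j ⟶ ModuleCat.of R W) = 0 :=
      h.symm.trans hx
    exact congrArg ModuleCat.Hom.hom h1
  · intro φ
    rfl

lemma compare (i : ℕ) (A W : Type) [AddCommGroup A] [Module R A] [AddCommGroup W] [Module R W] :
    Nonempty (extC R i A W ≃ₗ[R] EX R A W i) := by
  let P : ProjectiveResolution (ModuleCat.of R A) := projectiveResolution _
  let Z : ModuleCat R := ModuleCat.of R W
  let ε : P.complex.X 0 →ₗ[R] A := (P.π.f 0).hom
  have hε : Function.Surjective ε := (ModuleCat.epi_iff_surjective (P.π.f 0)).1 inferInstance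
  have h0 : Function.Exact (P.complex.d 1 0).hom ε :=
    (ShortComplex.ShortExact.moduleCat_exact_iff_function_exact _).1 P.exact₀
  have hd : ∀ j, Function.Exact (P.complex.d (j + 2) (j + 1)).hom (P.complex.d (j + 1) j).hom :=
    fun j => (ShortComplex.ShortExact.moduleCat_exact_iff_function_exact _).1 (P.exact_succ j)
  have hp : ∀ j, Module.Projective R (P.complex.X j) := fun j =>
    (IsProjective.iff_projective _).2 (P.projective j)
  cases i with
  | zero =>
    obtain ⟨e⟩ := res_zero (W := W) (fun j => P.complex.X j) (fun j => (P.complex.d (j + 1) j).hom)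
      ε hε h0
    obtain ⟨π, hπ, hπ'⟩ := homology_desc (S := (P.complex.linearYonedaObj R Z).sc' 0 0 1)
    obtain ⟨T, hT, hT'⟩ := cocyc (X := P.complex) (W := W) 0 1
    have e1 := ((P.isoExt (R := R) 0 Z) ≪≫
      HomologicalComplex.homologyIsoSc' _ 0 0 1 (by simp) (by simp)).toLinearEquiv
    obtain ⟨e2⟩ := equiv_of_surj (π ∘ₗ T) e.toLinearMap (hπ.comp hT) e.surjective (by
      intro φ
      refine (hπ' (T φ)).trans ?_
      have hz : ((P.complex.linearYonedaObj R Z).sc' 0 0 1).f = 0 :=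
        (P.complex.linearYonedaObj R Z).shape 0 0 (show ¬ (0 + 1 = 0) by omega)
      refine Iff.trans ?_ e.map_eq_zero_iff.symm
      constructor
      · rintro ⟨y, hy⟩
        have hy1 : (T φ).1 = 0 := by
          rw [← hy, hz]; rfl
        rw [hT'] at hy1
        apply Subtype.ext
        exact congrArg ModuleCat.Hom.hom hy1
      · rintro rfl
        refine ⟨0, ?_⟩
        rw [map_zero, map_zero]; rfl)
    exact ⟨e1.trans e2⟩
  | succ i =>
    obtain ⟨ρ, hρ, hρ'⟩ := res_succ (W := W) i (fun j => P.complex.X j)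
      (fun j => (P.complex.d (j + 1) j).hom) hd ε hε h0
    obtain ⟨π, hπ, hπ'⟩ := homology_desc
      (S := (P.complex.linearYonedaObj R Z).sc' i (i + 1) (i + 2))
    obtain ⟨T, hT, hT'⟩ := cocyc (X := P.complex) (W := W) (i + 1) (i + 2)
    have e1 := ((P.isoExt (R := R) (i + 1) Z) ≪≫
      HomologicalComplex.homologyIsoSc' _ i (i + 1) (i + 2) (by simp) (by simp)).toLinearEquiv
    obtain ⟨e2⟩ := equiv_of_surj (π ∘ₗ T) ρ (hπ.comp hT) hρ (by
      intro φ
      refine (hπ' (T φ)).trans (Iff.trans ?_ (hρ' φ).symm)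
      constructor
      · rintro ⟨y, hy⟩
        let y' : P.complex.X i ⟶ Z := y
        refine ⟨y'.hom, ?_⟩
        have h := d_eq (X := P.complex) (W := W) i (i + 1) y'.hom
        exact congrArg ModuleCat.Hom.hom (h.symm.trans (hy.trans (hT' φ)))
      · rintro ⟨ψ, hψ⟩
        refine ⟨(ModuleCat.ofHom ψ : P.complex.X i ⟶ Z), ?_⟩
        have h := d_eq (X := P.complex) (W := W) i (i + 1) ψ
        rw [hψ] at h
        exact h.trans (hT' φ).symm)
    exact ⟨e1.trans e2⟩

end compare

end SCM

namespace SCM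

open IsLocalRing
open scoped Pointwise

set_option linter.unusedSectionVars false

section local_algebra

variable {R : Type} [CommRing R] [IsNoetherianRing R] [IsLocalRing R]

lemma nak {E : Type} [AddCommGroup E] [Module R E] [Module.Finite R E] {x : R}
    (hx : x ∈ maximalIdeal R) (h : ∀ e : E, ∃ e', x • e' = e) : Subsingleton E := by
  have : (⊤ : Submodule R E) = ⊥ := by
    refine Submodule.eq_bot_of_le_smul_of_le_jacobson_bot (maximalIdeal R) ⊤ Module.Finite.fg_top
      ?_ (maximalIdeal_le_jacobson ⊥)
    intro e _
    obtain ⟨e', rfl⟩ := h e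
    exact Submodule.smul_mem_smul hx trivial
  exact (Submodule.subsingleton_iff R).1 (subsingleton_of_bot_eq_top this.symm)

lemma quotEquiv {E F : Type} [AddCommGroup E] [Module R E] [AddCommGroup F] [Module R F] {z : R}
    (δ : E →ₗ[R] F) (hδ : Function.Surjective δ) (h : ∀ y, δ y = 0 ↔ ∃ x, z • x = y) :
    Nonempty (QuotSMulTop z E ≃ₗ[R] F) :=
  equiv_of_surj (Submodule.mkQ _) δ (Submodule.mkQ_surjective _) hδ (fun x => by
    rw [h]; exact LinearMap.exact_lsmul_mkQ_smul_top E z x)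

variable {A W : Type} [AddCommGroup A] [Module R A] [AddCommGroup W] [Module R W]

/-- quotient map -/
abbrev qm (z : R) (A : Type) [AddCommGroup A] [Module R A] : A →ₗ[R] QuotSMulTop z A :=
  (z • (⊤ : Submodule R A)).mkQ

lemma contraz {z : R} (hz : IsSMulRegular A z) (W : Type) [AddCommGroup W] [Module R W] (i : ℕ) :
    ∃ δ : EX R A W i →ₗ[R] EX R (QuotSMulTop z A) W (i + 1),
      (∀ y, z • y = 0 ↔ ∃ x, pre (qm z A) W i x = y) ∧ (∀ y, δ y = 0 ↔ ∃ x, z • x = y) ∧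
      (∀ y, pre (qm z A) W (i + 1) y = 0 ↔ ∃ x, δ x = y) := by
  obtain ⟨δ, h1, h2, h3⟩ := contra (f := LinearMap.lsmul R A z) hz (Submodule.mkQ_surjective _)
    (LinearMap.exact_lsmul_mkQ_smul_top A z) W i
  refine ⟨δ, fun y => ?_, fun y => ?_, h3⟩
  · rw [← pre_smul]; exact h1 y
  · simp only [← pre_smul]; exact h2 y

lemma covarz {z : R} (hz : IsSMulRegular A z) (W : Type) [AddCommGroup W] [Module R W] (i : ℕ) :
    ∃ δ : EX R W (QuotSMulTop z A) i →ₗ[R] EX R W A (i + 1),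
      (∀ y, post (qm z A) W i y = 0 ↔ ∃ x, z • x = y) ∧
      (∀ y, δ y = 0 ↔ ∃ x, post (qm z A) W i x = y) ∧
      (∀ y, z • y = 0 ↔ ∃ x, δ x = y) := by
  obtain ⟨δ, h1, h2, h3⟩ := covar (f := LinearMap.lsmul R A z) hz (Submodule.mkQ_surjective _)
    (LinearMap.exact_lsmul_mkQ_smul_top A z) W i
  refine ⟨δ, fun y => ?_, h2, fun y => ?_⟩
  · simp only [← post_smul]; exact h1 y
  · rw [← post_smul]; exact h3 y

lemma V1 [Module.Finite R A] [Module.Finite R W] {z : R} (hm : z ∈ maximalIdeal R)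
    (hz : IsSMulRegular A z) (i : ℕ)
    (h : Subsingleton (EX R (QuotSMulTop z A) W (i + 1))) : Subsingleton (EX R A W i) := by
  obtain ⟨δ, h1, h2, h3⟩ := contraz hz W i
  exact nak hm fun y => (h2 y).1 (Subsingleton.elim _ _)

lemma V3 {z : R} (hz : IsSMulRegular A z) (i : ℕ) (h : Subsingleton (EX R W A i))
    (h' : Subsingleton (EX R W A (i + 1))) : Subsingleton (EX R W (QuotSMulTop z A) i) := by
  obtain ⟨δ, h1, h2, h3⟩ := covarz hz W i
  refine subsingleton_of_forall_eq 0 fun y => ?_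
  obtain ⟨x, rfl⟩ := (h2 y).1 (Subsingleton.elim _ _)
  rw [Subsingleton.elim x 0, map_zero]

/-- residue field -/
abbrev kk (R : Type) [CommRing R] [IsLocalRing R] : Type := R ⧸ maximalIdeal R

/-- canonical module, in terms of `EX` -/
structure Can (n : ℕ) (ω : Type) [AddCommGroup ω] [Module R ω] : Prop where
  fin : Module.Finite R ω
  van : ∀ i, i ≠ n → Subsingleton (EX R (kk R) ω i)
  equ : Nonempty (EX R (kk R) ω n ≃ₗ[R] kk R)

lemma wb1 {x : WithBot ℕ∞} (h : x + 1 ≤ ((0 : ℕ) : WithBot ℕ∞)) : x = ⊥ := by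
  induction x with
  | bot => rfl
  | coe a =>
    induction a with
    | top => exact absurd h (by decide)
    | coe a => norm_cast at h

lemma wb2 {x : WithBot ℕ∞} {d : ℕ} (h : x + 1 ≤ ((d + 1 : ℕ) : WithBot ℕ∞)) :
    x ≤ (d : WithBot ℕ∞) := by
  induction x with
  | bot => exact bot_le
  | coe a =>
    induction a with
    | top =>
      have h2 : ((⊤ : ℕ∞) + 1) ≤ ((d + 1 : ℕ) : ℕ∞) := by exact_mod_cast h
      rw [top_add, top_le_iff] at h2
      exact absurd h2 (ENat.natCast_ne_top _)
    | coe a => norm_cast at h ⊢; omega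

/-- Vanishing by dimension. -/
lemma van_dim {n : ℕ} {ω : Type} [AddCommGroup ω] [Module R ω] (hω : Can (R := R) n ω) (d : ℕ) :
    ∀ (N : Type) [AddCommGroup N] [Module R N] [Module.Finite R N],
      Module.supportDim R N ≤ (d : WithBot ℕ∞) → ∀ j, (n < j ∨ j + d < n) →
      Subsingleton (EX R N ω j) := by
  have hfin := hω.fin
  induction d with
  | zero =>
    intro N _ _ hN
    induction hN using IsNoetherianRing.induction_on_isQuotientEquivQuotientPrime R with
    | subsingleton N => intro _ j _; exact ex_sub_left j
    | quotient N p e =>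
      intro hd j hj
      by_cases hp : p.1 = maximalIdeal R
      · have := hω.van j (by omega)
        rw [hp] at e
        exact (preEquiv e ω j).symm.subsingleton
      · obtain ⟨x, hx, hxp⟩ := SetLike.exists_of_lt
          (lt_of_le_of_ne (le_maximalIdeal p.2.ne_top) hp)
        have hreg : IsSMulRegular (R ⧸ p.1) x :=
          (isSMulRegular_quotient_iff_mem_of_smul_mem _ _).2 fun y hy =>
            (p.2.mem_or_mem hy).resolve_left hxp
        have hd2 := Module.supportDim_quotSMulTop_succ_eq_supportDim hreg hx
        rw [Module.supportDim_eq_of_equiv e, ← hd2] at hd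
        have := (Module.supportDim_eq_bot_iff_subsingleton _ _).1 (wb1 hd)
        have := V1 (W := ω) hx hreg j (ex_sub_left _)
        exact (preEquiv e ω j).symm.subsingleton
    | exact N₁ N₂ N₃ f g hf hg h h1 h3 =>
      intro hd j hj
      have a1 := h1 ((Module.supportDim_le_of_injective f hf).trans hd) j hj
      have a2 := h3 ((Module.supportDim_le_of_surjective g hg).trans hd) j hj
      obtain ⟨δ, e1, e2, e3⟩ := contra hf hg h ω j
      refine subsingleton_of_forall_eq 0 fun y => ?_
      obtain ⟨x, rfl⟩ := (e1 y).1 (Subsingleton.elim _ _)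
      rw [Subsingleton.elim x 0, map_zero]
  | succ d ih =>
    intro N _ _ hN
    induction hN using IsNoetherianRing.induction_on_isQuotientEquivQuotientPrime R with
    | subsingleton N => intro _ j _; exact ex_sub_left j
    | quotient N p e =>
      intro hd j hj
      by_cases hp : p.1 = maximalIdeal R
      · have := hω.van j (by omega)
        rw [hp] at e
        exact (preEquiv e ω j).symm.subsingleton
      · obtain ⟨x, hx, hxp⟩ := SetLike.exists_of_lt
          (lt_of_le_of_ne (le_maximalIdeal p.2.ne_top) hp)
        have hreg : IsSMulRegular (R ⧸ p.1) x :=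
          (isSMulRegular_quotient_iff_mem_of_smul_mem _ _).2 fun y hy =>
            (p.2.mem_or_mem hy).resolve_left hxp
        have hd2 := Module.supportDim_quotSMulTop_succ_eq_supportDim hreg hx
        rw [Module.supportDim_eq_of_equiv e, ← hd2] at hd
        have := V1 (W := ω) hx hreg j (ih _ (wb2 hd) (j + 1) (by omega))
        exact (preEquiv e ω j).symm.subsingleton
    | exact N₁ N₂ N₃ f g hf hg h h1 h3 =>
      intro hd j hj
      have a1 := h1 ((Module.supportDim_le_of_injective f hf).trans hd) j hj
      have a2 := h3 ((Module.supportDim_le_of_surjective g hg).trans hd) j hj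
      obtain ⟨δ, e1, e2, e3⟩ := contra hf hg h ω j
      refine subsingleton_of_forall_eq 0 fun y => ?_
      obtain ⟨x, rfl⟩ := (e1 y).1 (Subsingleton.elim _ _)
      rw [Subsingleton.elim x 0, map_zero]

/-- zero or Cohen-Macaulay of dimension `d` -/
structure Pd (R : Type) [CommRing R] [IsLocalRing R] (d : ℕ) (N : Type) [AddCommGroup N]
    [Module R N] : Prop where
  fin : Module.Finite R N
  dim : Module.supportDim R N ≤ (d : WithBot ℕ∞)
  dep : ∀ i < d, Subsingleton (EX R (kk R) N i)

lemma Pd.congr {d : ℕ} {N N' : Type} [AddCommGroup N] [Module R N] [AddCommGroup N'] [Module R N']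
    (h : Pd R d N) (e : N ≃ₗ[R] N') : Pd R d N' where
  fin := by have := h.fin; exact Module.Finite.equiv e
  dim := by rw [← Module.supportDim_eq_of_equiv e]; exact h.dim
  dep i hi := by have := h.dep i hi; exact (postEquiv e (kk R) i).symm.subsingleton

lemma ann_kk : Module.annihilator R (kk R) = maximalIdeal R := Ideal.annihilator_quotient

lemma exists_reg [Module.Finite R A] [Module.Finite R W] (hA : Subsingleton (EX R (kk R) A 0))
    (hW : Subsingleton (EX R (kk R) W 0)) :
    ∃ z ∈ maximalIdeal R, IsSMulRegular A z ∧ IsSMulRegular W z := by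
  have a1 : Subsingleton (kk R →ₗ[R] A) := (ex0 (kk R) A).symm.subsingleton
  have a2 : Subsingleton (kk R →ₗ[R] W) := (ex0 (kk R) W).symm.subsingleton
  have : Subsingleton (kk R →ₗ[R] A × W) := (LinearMap.prodEquiv R).symm.subsingleton
  obtain ⟨z, hz, hr⟩ := IsSMulRegular.subsingleton_linearMap_iff.1 this
  rw [ann_kk] at hz
  refine ⟨z, hz, fun a b hab => ?_, fun a b hab => ?_⟩
  · have : z • (a, (0 : W)) = z • (b, (0 : W)) := Prod.ext hab rfl
    exact congrArg Prod.fst (hr this)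
  · have : z • ((0 : A), a) = z • ((0 : A), b) := Prod.ext rfl hab
    exact congrArg Prod.snd (hr this)

lemma Pd.exists_reg {d : ℕ} (h : Pd R (d + 1) A) : ∃ z ∈ maximalIdeal R, IsSMulRegular A z := by
  have := h.fin
  obtain ⟨z, hz, h1, -⟩ := SCM.exists_reg (h.dep 0 (by omega)) (h.dep 0 (by omega))
  exact ⟨z, hz, h1⟩

lemma Pd.quot {d : ℕ} (h : Pd R (d + 1) A) {z : R} (hz : z ∈ maximalIdeal R)
    (hr : IsSMulRegular A z) : Pd R d (QuotSMulTop z A) where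
  fin := by have := h.fin; infer_instance
  dim := by
    have := h.fin
    have h1 := h.dim
    rw [← Module.supportDim_quotSMulTop_succ_eq_supportDim hr hz] at h1
    exact wb2 h1
  dep i hi := V3 hr i (h.dep i (by omega)) (h.dep (i + 1) (by omega))

lemma Pd.of_quot [Module.Finite R A] {d : ℕ} {z : R} (hz : z ∈ maximalIdeal R)
    (hr : IsSMulRegular A z) (h : Pd R d (QuotSMulTop z A)) : Pd R (d + 1) A where
  fin := inferInstance
  dim := by
    rw [← Module.supportDim_quotSMulTop_succ_eq_supportDim hr hz]
    push_cast
    gcongr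
    exact h.dim
  dep i hi := by
    cases i with
    | zero =>
      have : Subsingleton (kk R →ₗ[R] A) :=
        IsSMulRegular.subsingleton_linearMap_iff.2 ⟨z, by rw [ann_kk]; exact hz, hr⟩
      exact (ex0 (kk R) A).subsingleton
    | succ i =>
      have := h.dep i (by omega)
      obtain ⟨δ, h1, h2, h3⟩ := covarz hr (kk R) i
      refine subsingleton_of_forall_eq 0 fun y => ?_
      obtain ⟨x, rfl⟩ := (h3 y).1 (ex_ann (by rw [ann_kk]; exact hz) _ _)
      rw [Subsingleton.elim x 0, map_zero]

lemma Pd.van {n : ℕ} {ω : Type} [AddCommGroup ω] [Module R ω] (hω : Can (R := R) n ω) (d : ℕ) :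
    ∀ {N : Type} [AddCommGroup N] [Module R N], Pd R d N → ∀ j, j + d ≠ n →
      Subsingleton (EX R N ω j) := by
  have hfin := hω.fin
  induction d with
  | zero =>
    intro N _ _ h j hj
    have := h.fin
    exact van_dim hω 0 N h.dim j (by omega)
  | succ d ih =>
    intro N _ _ h j hj
    have := h.fin
    obtain ⟨z, hz, hr⟩ := h.exists_reg
    exact V1 hz hr j (ih (h.quot hz hr) (j + 1) (by omega))

lemma Pd.dual_step {n : ℕ} {ω : Type} [AddCommGroup ω] [Module R ω] (hω : Can (R := R) n ω)
    {d c : ℕ} (hc : c + (d + 1) = n) (h : Pd R (d + 1) A) {z : R} (hz : z ∈ maximalIdeal R)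
    (hr : IsSMulRegular A z) :
    IsSMulRegular (EX R A ω c) z ∧
      Nonempty (QuotSMulTop z (EX R A ω c) ≃ₗ[R] EX R (QuotSMulTop z A) ω (c + 1)) := by
  obtain ⟨δ, h1, h2, h3⟩ := contraz hr ω c
  have a1 := (h.quot hz hr).van hω d c (by omega)
  have a2 := h.van hω _ (c + 1) (by omega)
  constructor
  · refine isSMulRegular_iff_right_eq_zero_of_smul.2 fun y hy => ?_
    obtain ⟨x, rfl⟩ := (h1 y).1 hy
    rw [Subsingleton.elim x 0, map_zero]
  · exact quotEquiv δ (fun y => (h3 y).1 (Subsingleton.elim _ _)) h2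

lemma dim_le_of_ann [Module.Finite R A] {E : Type} [AddCommGroup E] [Module R E]
    [Module.Finite R E]
    (h : Module.annihilator R A ≤ Module.annihilator R E) :
    Module.supportDim R E ≤ Module.supportDim R A := by
  rw [Module.supportDim_eq_ringKrullDim_quotient_annihilator,
    Module.supportDim_eq_ringKrullDim_quotient_annihilator]
  exact ringKrullDim_le_of_surjective _ (Ideal.Quotient.factor_surjective h)

lemma Pd.dual {n : ℕ} {ω : Type} [AddCommGroup ω] [Module R ω] (hω : Can (R := R) n ω) (d : ℕ) :
    ∀ {N : Type} [AddCommGroup N] [Module R N], Pd R d N → ∀ c, c + d = n →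
      Pd R d (EX R N ω c) := by
  have hfin := hω.fin
  induction d with
  | zero =>
    intro N _ _ h c hc
    have := h.fin
    refine ⟨inferInstance, (dim_le_of_ann (A := N) ?_).trans h.dim, fun i hi => by omega⟩
    intro r hr
    exact Module.mem_annihilator.2 fun x => ex_ann hr _ _
  | succ d ih =>
    intro N _ _ h c hc
    have := h.fin
    obtain ⟨z, hz, hr⟩ := h.exists_reg
    obtain ⟨h1, ⟨e⟩⟩ := h.dual_step hω hc hz hr
    exact Pd.of_quot hz h1 ((ih (h.quot hz hr) (c + 1) (by omega)).congr e.symm)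

lemma quot_nontrivial [Module.Finite R A] [Nontrivial A] {z : R} (hz : z ∈ maximalIdeal R) :
    Nontrivial (QuotSMulTop z A) := by
  by_contra h
  rw [not_nontrivial_iff_subsingleton] at h
  have : Subsingleton A := nak hz fun a =>
    (LinearMap.exact_lsmul_mkQ_smul_top A z a).1 (Subsingleton.elim _ _)
  exact not_subsingleton A this

lemma Pd.eq (d : ℕ) : ∀ {N : Type} [AddCommGroup N] [Module R N], Pd R d N → Nontrivial N →
    Module.supportDim R N = (d : WithBot ℕ∞) ∧ Nontrivial (EX R (kk R) N d) := by
  induction d with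
  | zero =>
    intro N _ _ h _
    have := h.fin
    constructor
    · refine le_antisymm h.dim ?_
      have h1 := Module.supportDim_ne_bot_of_nontrivial R N
      revert h1
      generalize Module.supportDim R N = x
      intro h1
      induction x with
      | bot => exact absurd rfl h1
      | coe a => exact_mod_cast (zero_le : 0 ≤ a)
    · by_contra hn
      rw [not_nontrivial_iff_subsingleton] at hn
      obtain ⟨z, hz, hr, -⟩ := SCM.exists_reg hn hn
      have h1 := h.dim
      rw [← Module.supportDim_quotSMulTop_succ_eq_supportDim hr hz] at h1
      have := (Module.supportDim_eq_bot_iff_subsingleton _ _).1 (wb1 h1)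
      have h2 := quot_nontrivial (A := N) hz
      exact not_subsingleton _ this
  | succ d ih =>
    intro N _ _ h _
    have := h.fin
    obtain ⟨z, hz, hr⟩ := h.exists_reg
    obtain ⟨h1, h2⟩ := ih (h.quot hz hr) (quot_nontrivial hz)
    constructor
    · rw [← Module.supportDim_quotSMulTop_succ_eq_supportDim hr hz, h1]; rfl
    · by_contra hn
      rw [not_nontrivial_iff_subsingleton] at hn
      exact not_subsingleton _ (V3 hr d (h.dep d (by omega)) hn)

lemma Pd.of_isCM {N : Type} [AddCommGroup N] [Module R N] [Module.Finite R N]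
    (h : IsCM R (maximalIdeal R) N) {d : ℕ} (hd : mDim R N = (d : WithBot ℕ∞)) : Pd R d N where
  fin := inferInstance
  dim := hd.le
  dep i hi := by
    by_contra hn
    rw [not_subsingleton_iff_nontrivial] at hn
    have h1 := h.2
    rw [hd] at h1
    have h2 : mDepth R (maximalIdeal R) N = (d : ℕ∞) := by exact_mod_cast h1
    have h3 : mDepth R (maximalIdeal R) N ≤ (i : ℕ∞) := by
      refine sInf_le ⟨i, rfl, ?_⟩
      obtain ⟨e⟩ := SCM.compare (R := R) i (kk R) N
      exact e.toEquiv.nontrivial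
    rw [h2] at h3
    norm_cast at h3
    omega

lemma Pd.isCM {N : Type} [AddCommGroup N] [Module R N] {d : ℕ} (h : Pd R d N) [Nontrivial N] :
    IsCM R (maximalIdeal R) N ∧ mDim R N = (d : WithBot ℕ∞) := by
  obtain ⟨h1, h2⟩ := Pd.eq d h inferInstance
  have h1' : mDim R N = (d : WithBot ℕ∞) := h1
  refine ⟨⟨inferInstance, ?_⟩, h1'⟩
  rw [h1']
  have : mDepth R (maximalIdeal R) N = (d : ℕ∞) := by
    apply le_antisymm
    · refine sInf_le ⟨d, rfl, ?_⟩
      obtain ⟨e⟩ := SCM.compare (R := R) d (kk R) N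
      exact e.toEquiv.nontrivial
    · refine le_sInf ?_
      rintro _ ⟨j, rfl, hj⟩
      by_contra hlt
      push Not at hlt
      have hlt' : j < d := by exact_mod_cast hlt
      have := h.dep j hlt'
      obtain ⟨e⟩ := SCM.compare (R := R) j (kk R) N
      exact not_subsingleton _ e.toEquiv.subsingleton
  rw [this]; rfl

end local_algebra

end SCM

namespace SCM

open IsLocalRing
open scoped Pointwise

set_option linter.unusedSectionVars false

section biduality

variable {R : Type} [CommRing R] [IsNoetherianRing R] [IsLocalRing R]

/-- `W` is obtained from `ω` by `j` successive quotients by regular elements of `I`. -/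
inductive Red (I : Ideal R) (ω : Type) [AddCommGroup ω] [Module R ω] :
    ℕ → (W : Type) → [AddCommGroup W] → [Module R W] → Prop
  | base : Red I ω 0 ω
  | step (j : ℕ) (V : Type) [AddCommGroup V] [Module R V] (x : R) (hx : x ∈ I)
      (hr : IsSMulRegular V x) (hV : Red I ω j V) : Red I ω (j + 1) (QuotSMulTop x V)

variable {ω : Type} [AddCommGroup ω] [Module R ω]

lemma Red.mono {I J : Ideal R} (hIJ : I ≤ J) {j : ℕ} {W : Type} [AddCommGroup W] [Module R W]
    (h : Red I ω j W) : Red J ω j W := by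
  induction h with
  | base => exact Red.base
  | step j V x hx hr hV ih => exact Red.step j V x (hIJ hx) hr ih

lemma Red.fin [Module.Finite R ω] {I : Ideal R} {j : ℕ} {W : Type} [AddCommGroup W] [Module R W]
    (h : Red I ω j W) : Module.Finite R W := by
  induction h with
  | base => infer_instance
  | step j V x hx hr hV ih => infer_instance

lemma Red.shift {I : Ideal R} {N : Type} [AddCommGroup N] [Module R N]
    (hI : I ≤ Module.annihilator R N) {j : ℕ} {W : Type} [AddCommGroup W] [Module R W]
    (h : Red I ω j W) : ∀ e, (∀ l < j + e, Subsingleton (EX R N ω l)) →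
      (∀ l < e, Subsingleton (EX R N W l)) ∧ Nonempty (EX R N W e ≃ₗ[R] EX R N ω (j + e)) := by
  induction h with
  | base =>
    intro e he
    rw [zero_add] at he ⊢
    exact ⟨he, ⟨LinearEquiv.refl _ _⟩⟩
  | step j V x hx hr hV ih =>
    intro e he
    obtain ⟨h1, ⟨h2⟩⟩ := ih (e + 1) (fun l hl => he l (by omega))
    constructor
    · intro l hl
      exact V3 hr l (h1 l (by omega)) (h1 (l + 1) (by omega))
    · obtain ⟨δ, a1, a2, a3⟩ := covarz hr N e
      have := h1 e (by omega)
      have e1 : EX R N (QuotSMulTop x V) e ≃ₗ[R] EX R N V (e + 1) := by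
        refine LinearEquiv.ofBijective δ ⟨?_, ?_⟩
        · rw [injective_iff_map_eq_zero]
          intro y hy
          obtain ⟨u, rfl⟩ := (a2 y).1 hy
          rw [Subsingleton.elim u 0, map_zero]
        · intro y
          exact (a3 y).1 (ex_ann (hI hx) _ _)
      rw [show j + 1 + e = j + (e + 1) by omega]
      exact ⟨e1.trans h2⟩

/-- special case: Hom -/
lemma Red.hom {I : Ideal R} {N : Type} [AddCommGroup N] [Module R N]
    (hI : I ≤ Module.annihilator R N) {j : ℕ} {W : Type} [AddCommGroup W] [Module R W]
    (h : Red I ω j W) (hv : ∀ l < j, Subsingleton (EX R N ω l)) :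
    Nonempty ((N →ₗ[R] W) ≃ₗ[R] EX R N ω j) := by
  obtain ⟨-, ⟨e⟩⟩ := h.shift hI 0 hv
  exact ⟨(ex0 N W).symm.trans e⟩

lemma Red.exists {n : ℕ} (hω : Can (R := R) n ω) {d c : ℕ} {N : Type} [AddCommGroup N]
    [Module R N] (hN : Pd R d N) (hc : c + d = n) (j : ℕ) (hj : j ≤ c) :
    ∃ V : ModuleCat.{0} R, Red (Module.annihilator R N) ω j V := by
  have := hω.fin
  have := hN.fin
  induction j with
  | zero => exact ⟨ModuleCat.of R ω, Red.base⟩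
  | succ j ih =>
    obtain ⟨V, hV⟩ := ih (by omega)
    have := hV.fin
    obtain ⟨e⟩ := hV.hom le_rfl (fun l hl => hN.van hω d l (by omega))
    have := hN.van hω d j (by omega)
    have : Subsingleton (N →ₗ[R] V) := e.subsingleton
    obtain ⟨x, hx, hr⟩ := IsSMulRegular.subsingleton_linearMap_iff.1 this
    exact ⟨ModuleCat.of R (QuotSMulTop x V), Red.step j V x hx hr hV⟩

lemma Red.reg {I : Ideal R} {N : Type} [AddCommGroup N] [Module R N]
    (hI : I ≤ Module.annihilator R N) {z : R} (hz : ∀ l, IsSMulRegular (EX R N ω l) z)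
    {j : ℕ} {W : Type} [AddCommGroup W] [Module R W]
    (h : Red I ω j W) : ∀ l, IsSMulRegular (EX R N W l) z := by
  induction h with
  | base => exact hz
  | step j V x hx hr hV ih =>
    intro l
    obtain ⟨δ, a1, a2, a3⟩ := covarz hr N l
    refine isSMulRegular_iff_right_eq_zero_of_smul.2 fun y hy => ?_
    have h1 : δ y = 0 := (isSMulRegular_iff_right_eq_zero_of_smul.1 (ih (l + 1))) _ (by
      rw [← map_smul, hy, map_zero])
    obtain ⟨u, rfl⟩ := (a2 y).1 h1
    rw [← map_smul] at hy
    obtain ⟨v, hv⟩ := (a1 _).1 hy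
    rw [ex_ann (hI hx)] at hv
    rw [(isSMulRegular_iff_right_eq_zero_of_smul.1 (ih l)) _ hv.symm, map_zero]

lemma Red.depth {n : ℕ} (hω : Can (R := R) n ω) {I : Ideal R} (hI : I ≤ maximalIdeal R) {j : ℕ}
    (hj : j < n) {W : Type} [AddCommGroup W] [Module R W] (h : Red I ω j W) :
    Subsingleton (EX R (kk R) W 0) := by
  obtain ⟨-, ⟨e⟩⟩ := h.shift (N := kk R) (by rw [ann_kk]; exact hI) 0
    (fun l hl => hω.van l (by omega))
  have := hω.van (j + 0) (by omega)
  exact e.subsingleton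

/-- evaluation -/
abbrev ev (N W : Type) [AddCommGroup N] [Module R N] [AddCommGroup W] [Module R W] :
    N →ₗ[R] (N →ₗ[R] W) →ₗ[R] W := LinearMap.applyₗ

/-- lengths -/
lemma len {n : ℕ} (hω : Can (R := R) n ω) (N : Type) [AddCommGroup N] [Module R N]
    [hN : Module.Finite R N] : Module.supportDim R N ≤ ((0 : ℕ) : WithBot ℕ∞) →
      Module.length R (EX R N ω n) = Module.length R N ∧ Module.length R N ≠ ⊤ := by
  induction hN using IsNoetherianRing.induction_on_isQuotientEquivQuotientPrime R with
  | subsingleton N =>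
    intro _
    have := ex_sub_left (R := R) (A := N) (W := ω) n
    rw [Module.length_eq_zero, Module.length_eq_zero]
    exact ⟨rfl, by simp⟩
  | quotient N p e =>
    intro hd
    have hp : p.1 = maximalIdeal R := by
      by_contra hp
      obtain ⟨x, hx, hxp⟩ := SetLike.exists_of_lt
        (lt_of_le_of_ne (le_maximalIdeal p.2.ne_top) hp)
      have hreg : IsSMulRegular (R ⧸ p.1) x :=
        (isSMulRegular_quotient_iff_mem_of_smul_mem _ _).2 fun y hy =>
          (p.2.mem_or_mem hy).resolve_left hxp
      have hd2 := Module.supportDim_quotSMulTop_succ_eq_supportDim hreg hx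
      rw [Module.supportDim_eq_of_equiv e, ← hd2] at hd
      have h1 := (Module.supportDim_eq_bot_iff_subsingleton _ _).1 (wb1 hd)
      have := Ideal.Quotient.nontrivial_iff.2 p.2.ne_top
      have h2 := quot_nontrivial (A := R ⧸ p.1) hx
      exact not_subsingleton _ h1
    rw [hp] at e
    obtain ⟨f⟩ := hω.equ
    have hs : IsSimpleModule R (kk R) := isSimpleModule_iff_isCoatom.2
      (Ideal.isMaximal_def.1 (maximalIdeal.isMaximal R))
    rw [e.length_eq, ← ((preEquiv e ω n).symm.trans f.symm.symm).length_eq.symm]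
    refine ⟨rfl, ?_⟩
    rw [Module.length_eq_one]
    simp
  | exact N₁ N₂ N₃ f g hf hg h h1 h3 =>
    intro hd
    have d1 := (Module.supportDim_le_of_injective f hf).trans hd
    have d3 := (Module.supportDim_le_of_surjective g hg).trans hd
    obtain ⟨p1, q1⟩ := h1 d1
    obtain ⟨p3, q3⟩ := h3 d3
    have l2 := Module.length_eq_add_of_exact f g hf hg h
    obtain ⟨δ, e1, e2, e3⟩ := contra hf hg h ω n
    have inj : Function.Injective (pre g ω n) := by
      cases n with
      | zero => exact pre_zero_injective hg
      | succ m =>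
        obtain ⟨δ', e1', e2', e3'⟩ := contra hf hg h ω m
        rw [injective_iff_map_eq_zero]
        intro y hy
        obtain ⟨x, rfl⟩ := (e3' y).1 hy
        have := van_dim hω 0 N₁ d1 m (by omega)
        rw [Subsingleton.elim x 0, map_zero]
    have sur : Function.Surjective (pre f ω n) := by
      intro y
      have := van_dim hω 0 N₃ d3 (n + 1) (by omega)
      exact (e2 y).1 (Subsingleton.elim _ _)
    have l1 := Module.length_eq_add_of_exact _ _ inj sur e1
    rw [l1, l2, p1, p3, add_comm]
    exact ⟨rfl, by simp [q1, q3]⟩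

lemma ann_le_of_surj {N N' : Type} [AddCommGroup N] [Module R N] [AddCommGroup N'] [Module R N']
    (f : N →ₗ[R] N') (hf : Function.Surjective f) :
    Module.annihilator R N ≤ Module.annihilator R N' := by
  intro r hr
  refine Module.mem_annihilator.2 fun y => ?_
  obtain ⟨x, rfl⟩ := hf y
  rw [← map_smul, Module.mem_annihilator.1 hr, map_zero]

lemma ann_le_hom {N W : Type} [AddCommGroup N] [Module R N] [AddCommGroup W] [Module R W] :
    Module.annihilator R N ≤ Module.annihilator R (N →ₗ[R] W) := by
  intro r hr
  refine Module.mem_annihilator.2 fun y => ?_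
  ext x
  rw [LinearMap.smul_apply, ← map_smul, Module.mem_annihilator.1 hr, map_zero]; rfl

lemma bid_zero {n : ℕ} (hω : Can (R := R) n ω) {N : Type} [AddCommGroup N] [Module R N]
    (hN : Pd R 0 N) {I : Ideal R} (hI : I ≤ Module.annihilator R N) {W : Type} [AddCommGroup W]
    [Module R W] (h : Red I ω n W) : Function.Bijective (ev (R := R) N W) := by
  have := hω.fin
  have := hN.fin
  have := h.fin
  have key : ∀ (N' : Type) [AddCommGroup N'] [Module R N'] [Module.Finite R N'],
      I ≤ Module.annihilator R N' → Module.supportDim R N' ≤ ((0 : ℕ) : WithBot ℕ∞) →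
      Module.length R (N' →ₗ[R] W) = Module.length R N' ∧ Module.length R N' ≠ ⊤ := by
    intro N' _ _ _ h1 h2
    obtain ⟨e⟩ := h.hom h1 (fun l hl => van_dim hω 0 N' h2 l (by omega))
    rw [e.length_eq]
    exact len hω N' h2
  obtain ⟨a1, a2⟩ := key N hI hN.dim
  have inj : LinearMap.ker (ev (R := R) N W) = ⊥ := by
    let K := LinearMap.ker (ev (R := R) N W)
    obtain ⟨b1, b2⟩ := key (N ⧸ K) (hI.trans (ann_le_of_surj K.mkQ K.mkQ_surjective))
      ((Module.supportDim_le_of_surjective K.mkQ K.mkQ_surjective).trans hN.dim)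
    have e : ((N ⧸ K) →ₗ[R] W) ≃ₗ[R] (N →ₗ[R] W) := by
      refine LinearEquiv.ofBijective (LinearMap.lcomp R W K.mkQ) ⟨?_, ?_⟩
      · intro φ ψ hφ
        exact Submodule.linearMap_qext _ hφ
      · intro φ
        have hk : K ≤ LinearMap.ker φ := fun x hx =>
          LinearMap.congr_fun (LinearMap.mem_ker.1 hx) φ
        exact ⟨K.liftQ φ hk, K.liftQ_mkQ φ hk⟩
    have l1 := Module.length_eq_add_of_exact K.subtype K.mkQ K.injective_subtype K.mkQ_surjective
      (LinearMap.exact_subtype_mkQ K)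
    rw [← b1, e.length_eq, a1] at l1
    have l2 : Module.length R K = 0 := by
      have : 0 + Module.length R N = Module.length R K + Module.length R N := by
        rw [zero_add]; exact l1
      exact (WithTop.add_right_cancel a2 this).symm
    exact (Submodule.subsingleton_iff_eq_bot).1 (Module.length_eq_zero_iff.1 l2)
  refine ⟨LinearMap.ker_eq_bot.1 inj, ?_⟩
  have dH : Module.supportDim R (N →ₗ[R] W) ≤ ((0 : ℕ) : WithBot ℕ∞) :=
    (dim_le_of_ann ann_le_hom).trans hN.dim
  obtain ⟨c1, c2⟩ := key (N →ₗ[R] W) (hI.trans ann_le_hom) dH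
  let C := LinearMap.range (ev (R := R) N W)
  have l1 := Module.length_eq_add_of_exact (ev (R := R) N W) C.mkQ (LinearMap.ker_eq_bot.1 inj)
    C.mkQ_surjective (LinearMap.exact_map_mkQ_range _)
  rw [c1, a1] at l1
  have l2 : Module.length R (((N →ₗ[R] W) →ₗ[R] W) ⧸ C) = 0 := by
    have : Module.length R N + 0 = Module.length R N +
      Module.length R (((N →ₗ[R] W) →ₗ[R] W) ⧸ C) := by
        rw [add_zero]; exact l1
    exact (WithTop.add_left_cancel a2 this).symm
  have h3 := Module.length_eq_zero_iff.1 l2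
  rw [Submodule.Quotient.subsingleton_iff] at h3
  exact LinearMap.range_eq_top.1 h3

lemma div_of_qm {N W : Type} [AddCommGroup N] [Module R N] [AddCommGroup W] [Module R W] {z : R}
    (hz : IsSMulRegular W z) (f : N →ₗ[R] W) (h : ∀ x, qm z W (f x) = 0) :
    ∃ g : N →ₗ[R] W, z • g = f := by
  obtain ⟨δ, h1, h2, h3⟩ := covarz hz N 0
  obtain ⟨x, hx⟩ := (h1 ((ex0 N W).symm f)).1 (by
    rw [post_ex0]
    have : qm z W ∘ₗ f = 0 := LinearMap.ext h
    rw [this, map_zero])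
  exact ⟨ex0 N W x, by rw [← map_smul, hx, LinearEquiv.apply_symm_apply]⟩

lemma bid {n : ℕ} (hω : Can (R := R) n ω) (d : ℕ) : ∀ {N : Type} [AddCommGroup N] [Module R N]
    (_ : Pd R d N) {I : Ideal R} (_ : I ≤ maximalIdeal R) (_ : I ≤ Module.annihilator R N)
    {W : Type} [AddCommGroup W] [Module R W] {c : ℕ} (_ : c + d = n) (_ : Red I ω c W),
    Function.Bijective (ev (R := R) N W) := by
  have := hω.fin
  induction d with
  | zero =>
    intro N _ _ hN I _ hI W _ _ c hc h
    obtain rfl : c = n := hc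
    exact bid_zero hω hN hI h
  | succ d ih =>
    intro N _ _ hN I hIm hI W _ _ c hc h
    have := hN.fin
    have := h.fin
    obtain ⟨z, hz, rN, rW⟩ := exists_reg (hN.dep 0 (by omega)) (h.depth hω hIm (by omega))
    have hI' : I ⊔ Ideal.span {z} ≤ Module.annihilator R (QuotSMulTop z N) := by
      refine sup_le (hI.trans (ann_le_of_surj (qm z N) (Submodule.mkQ_surjective _))) ?_
      rw [Ideal.span_singleton_le_iff_mem]
      refine Module.mem_annihilator.2 fun y => ?_
      obtain ⟨x, rfl⟩ := Submodule.mkQ_surjective _ y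
      exact (LinearMap.exact_lsmul_mkQ_smul_top N z _).2 ⟨x, rfl⟩
    have hIm' : I ⊔ Ideal.span {z} ≤ maximalIdeal R :=
      sup_le hIm ((Ideal.span_singleton_le_iff_mem _).2 hz)
    have h' : Red (I ⊔ Ideal.span {z}) ω (c + 1) (QuotSMulTop z W) :=
      Red.step c W z (Ideal.mem_sup_right (Ideal.mem_span_singleton_self z)) rW
        (h.mono le_sup_left)
    obtain ⟨inj', sur'⟩ := ih (hN.quot hz rN) hIm' hI' (by omega) h'
    have hreg : ∀ l, IsSMulRegular (EX R N ω l) z := by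
      intro l
      by_cases hl : l = c
      · subst hl
        exact (hN.dual_step hω hc hz rN).1
      · have := hN.van hω _ l (by omega)
        intro a b _
        exact Subsingleton.elim _ _
    have lift : ∀ φ' : N →ₗ[R] QuotSMulTop z W, ∃ φ : N →ₗ[R] W, qm z W ∘ₗ φ = φ' := by
      intro φ'
      obtain ⟨δ, a1, a2, a3⟩ := covarz rW N 0
      obtain ⟨x, hx⟩ := (a2 ((ex0 N _).symm φ')).1
        ((isSMulRegular_iff_right_eq_zero_of_smul.1 (h.reg hI hreg 1)) _ ((a3 _).2 ⟨_, rfl⟩))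
      obtain ⟨φ, rfl⟩ := (ex0 N W).symm.surjective x
      rw [post_ex0] at hx
      exact ⟨φ, (ex0 N _).symm.injective hx⟩
    let T : (N →ₗ[R] W) →ₗ[R] (QuotSMulTop z N →ₗ[R] QuotSMulTop z W) := QuotSMulTop.map z
    have hT : ∀ φ x, T φ (qm z N x) = qm z W (φ x) := fun φ x => rfl
    have sT : Function.Surjective T := by
      intro φ'
      obtain ⟨φ, hφ⟩ := lift (φ' ∘ₗ qm z N)
      refine ⟨φ, Submodule.linearMap_qext _ ?_⟩
      ext x
      exact LinearMap.congr_fun hφ x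
    constructor
    · have hK : ∀ x ∈ LinearMap.ker (ev (R := R) N W), ∃ y ∈ LinearMap.ker (ev (R := R) N W),
          z • y = x := by
        intro x hx
        have h0 : qm z N x = 0 := by
          apply inj'
          rw [map_zero]
          ext φ'
          obtain ⟨φ, rfl⟩ := sT φ'
          have h1 : φ x = 0 := LinearMap.congr_fun (LinearMap.mem_ker.1 hx) φ
          change T φ (qm z N x) = 0
          rw [hT, h1, map_zero]
        obtain ⟨y, rfl⟩ := (LinearMap.exact_lsmul_mkQ_smul_top N z x).1 h0
        refine ⟨y, ?_, rfl⟩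
        rw [LinearMap.mem_ker]
        ext φ
        have h1 : φ (z • y) = 0 := LinearMap.congr_fun (LinearMap.mem_ker.1 hx) φ
        rw [map_smul] at h1
        exact isSMulRegular_iff_right_eq_zero_of_smul.1 rW _ h1
      have : Subsingleton (LinearMap.ker (ev (R := R) N W)) := nak hz (by
        rintro ⟨x, hx⟩
        obtain ⟨y, hy, rfl⟩ := hK x hx
        exact ⟨⟨y, hy⟩, rfl⟩)
      exact LinearMap.ker_eq_bot.1 (Submodule.subsingleton_iff_eq_bot.1 this)
    · have hS : ∀ Φ : (N →ₗ[R] W) →ₗ[R] W, ∃ (x : N) (Ψ : (N →ₗ[R] W) →ₗ[R] W),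
          z • Ψ = Φ - ev N W x := by
        intro Φ
        have hk : LinearMap.ker T ≤ LinearMap.ker (qm z W ∘ₗ Φ) := by
          intro φ hφ
          obtain ⟨ψ, rfl⟩ := div_of_qm rW φ (fun x => by
            rw [← hT, LinearMap.mem_ker.1 hφ]; rfl)
          rw [LinearMap.mem_ker, LinearMap.comp_apply, map_smul]
          exact (LinearMap.exact_lsmul_mkQ_smul_top W z _).2 ⟨_, rfl⟩
        let Φ' : (QuotSMulTop z N →ₗ[R] QuotSMulTop z W) →ₗ[R] QuotSMulTop z W :=
          (LinearMap.ker T).liftQ (qm z W ∘ₗ Φ) hk ∘ₗ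
            (T.quotKerEquivOfSurjective sT).symm.toLinearMap
        have hΦ' : ∀ φ, Φ' (T φ) = qm z W (Φ φ) := by
          intro φ
          have : (T.quotKerEquivOfSurjective sT).symm (T φ) = (LinearMap.ker T).mkQ φ := by
            rw [LinearEquiv.symm_apply_eq]; rfl
          change (LinearMap.ker T).liftQ (qm z W ∘ₗ Φ) hk
            ((T.quotKerEquivOfSurjective sT).symm (T φ)) = _
          rw [this]; rfl
        obtain ⟨x', hx'⟩ := sur' Φ'
        obtain ⟨x, rfl⟩ := Submodule.mkQ_surjective _ x'
        obtain ⟨Ψ, hΨ⟩ := div_of_qm rW (Φ - ev N W x) (fun φ => by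
          rw [LinearMap.sub_apply, map_sub, ← hΦ', ← hx', sub_eq_zero]
          rfl)
        exact ⟨x, Ψ, hΨ⟩
      have : Subsingleton (((N →ₗ[R] W) →ₗ[R] W) ⧸ LinearMap.range (ev (R := R) N W)) :=
        nak hz (by
          intro Φ
          obtain ⟨Φ, rfl⟩ := Submodule.mkQ_surjective _ Φ
          obtain ⟨x, Ψ, h⟩ := hS Φ
          refine ⟨Submodule.mkQ _ Ψ, ?_⟩
          rw [← map_smul, h, map_sub, sub_eq_self]
          exact (Submodule.Quotient.mk_eq_zero _).2 ⟨x, rfl⟩)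
      rw [Submodule.Quotient.subsingleton_iff] at this
      exact LinearMap.range_eq_top.1 this

theorem bidual {n : ℕ} (hω : Can (R := R) n ω) {d c : ℕ} {N : Type} [AddCommGroup N] [Module R N]
    [Nontrivial N] (hN : Pd R d N) (hc : c + d = n) :
    Nonempty (EX R (EX R N ω c) ω c ≃ₗ[R] N) := by
  obtain ⟨W, hW⟩ := Red.exists hω hN hc c le_rfl
  have hIm : Module.annihilator R N ≤ maximalIdeal R := by
    refine le_maximalIdeal ?_
    rw [Ne, Module.annihilator_eq_top_iff]
    exact not_subsingleton N
  have hE := hN.dual hω d c hc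
  obtain ⟨e1⟩ := hW.hom le_rfl (fun l hl => hN.van hω d l (by omega))
  obtain ⟨e2⟩ := hW.hom (N := EX R N ω c)
    (fun r hr => Module.mem_annihilator.2 fun x => ex_ann hr _ _)
    (fun l hl => hE.van hω d l (by omega))
  have e3 := LinearEquiv.ofBijective _ (bid hω d hN hIm le_rfl hc hW)
  exact ⟨e2.symm.trans ((LinearEquiv.congrLeft W R e1.symm).trans e3.symm)⟩

end biduality

end SCM

namespace SCM

open IsLocalRing

section filtration

set_option linter.unusedSectionVars false

variable {R : Type} [CommRing R] [IsNoetherianRing R] [IsLocalRing R]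
variable {ω : Type} [AddCommGroup ω] [Module R ω]

lemma sub_mid {A B C W : Type} [AddCommGroup A] [Module R A] [AddCommGroup B] [Module R B]
    [AddCommGroup C] [Module R C] [AddCommGroup W] [Module R W]
    {f : A →ₗ[R] B} {g : B →ₗ[R] C} (hf : Function.Injective f) (hg : Function.Surjective g)
    (h : Function.Exact f g) (i : ℕ) (hA : Subsingleton (EX R A W i))
    (hC : Subsingleton (EX R C W i)) : Subsingleton (EX R B W i) := by
  obtain ⟨δ, h1, h2, h3⟩ := contra hf hg h W i
  refine subsingleton_of_forall_eq 0 fun x => ?_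
  obtain ⟨y, rfl⟩ := (h1 x).1 (Subsingleton.elim _ _)
  rw [Subsingleton.elim y 0, map_zero]

lemma iso_left {A B C W : Type} [AddCommGroup A] [Module R A] [AddCommGroup B] [Module R B]
    [AddCommGroup C] [Module R C] [AddCommGroup W] [Module R W]
    {f : A →ₗ[R] B} {g : B →ₗ[R] C} (hf : Function.Injective f) (hg : Function.Surjective g)
    (h : Function.Exact f g) (i : ℕ) (hC : Subsingleton (EX R C W i))
    (hC' : Subsingleton (EX R C W (i + 1))) : Nonempty (EX R B W i ≃ₗ[R] EX R A W i) := by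
  obtain ⟨δ, h1, h2, h3⟩ := contra hf hg h W i
  refine ⟨LinearEquiv.ofBijective (pre f W i) ⟨?_, ?_⟩⟩
  · refine (injective_iff_map_eq_zero _).2 fun x hx => ?_
    obtain ⟨y, rfl⟩ := (h1 x).1 hx
    rw [Subsingleton.elim y 0, map_zero]
  · intro y
    exact (h2 y).1 (Subsingleton.elim _ _)

lemma iso_right {A B C W : Type} [AddCommGroup A] [Module R A] [AddCommGroup B] [Module R B]
    [AddCommGroup C] [Module R C] [AddCommGroup W] [Module R W]
    {f : A →ₗ[R] B} {g : B →ₗ[R] C} (hf : Function.Injective f) (hg : Function.Surjective g)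
    (h : Function.Exact f g) (i : ℕ) (hA : Subsingleton (EX R A W i))
    (hA' : ∀ j, j + 1 = i → Subsingleton (EX R A W j)) :
    Nonempty (EX R B W i ≃ₗ[R] EX R C W i) := by
  refine ⟨(LinearEquiv.ofBijective (pre g W i) ⟨?_, ?_⟩).symm⟩
  · rcases i with _ | j
    · exact pre_zero_injective hg
    · obtain ⟨δ, h1, h2, h3⟩ := contra hf hg h W j
      have := hA' j rfl
      refine (injective_iff_map_eq_zero _).2 fun x hx => ?_
      obtain ⟨y, rfl⟩ := (h3 x).1 hx
      rw [Subsingleton.elim y 0, map_zero]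
  · obtain ⟨δ, h1, h2, h3⟩ := contra hf hg h W i
    intro y
    exact (h1 y).1 (Subsingleton.elim _ _)

theorem filt {n : ℕ} (hω : Can (R := R) n ω) {M : Type} [AddCommGroup M] [Module R M]
    (r : ℕ) (F : ℕ → Submodule R M) (h0 : F 0 = ⊥) (hlt : ∀ i < r, F i ≤ F (i + 1))
    (d : ℕ → ℕ) (hd : ∀ i < r, ∀ l < i, d l < d i)
    (hP : ∀ i < r, Pd R (d i) (subQuot R (F i) (F (i + 1)))) :
    ∀ i ≤ r, (∀ j, (∀ l < i, j + d l ≠ n) → Subsingleton (EX R (F i) ω j)) ∧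
      ∀ l < i, ∀ c, c + d l = n →
        Nonempty (EX R (F i) ω c ≃ₗ[R] EX R (subQuot R (F l) (F (l + 1))) ω c) := by
  intro i
  induction i with
  | zero =>
    intro _
    refine ⟨fun j _ => ?_, fun l hl => absurd hl (Nat.not_lt_zero l)⟩
    have : Subsingleton (F 0) := Submodule.subsingleton_iff_eq_bot.2 h0
    exact ex_sub_left j
  | succ i ih =>
    intro hi
    obtain ⟨iv, ie⟩ := ih (by omega)
    have hir : i < r := by omega
    have hf : Function.Injective (Submodule.inclusion (hlt i hir)) :=
      Submodule.inclusion_injective _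
    have hg := Submodule.mkQ_surjective (Submodule.comap (F (i + 1)).subtype (F i))
    have hx : Function.Exact (Submodule.inclusion (hlt i hir))
        (Submodule.mkQ (Submodule.comap (F (i + 1)).subtype (F i))) := by
      intro x
      rw [Submodule.mkQ_apply, Submodule.Quotient.mk_eq_zero]
      constructor
      · intro hx
        exact ⟨⟨x, hx⟩, rfl⟩
      · rintro ⟨y, rfl⟩
        exact y.2
    have vQ := fun j hj => (hP i hir).van hω (d i) j hj
    refine ⟨fun j hj => ?_, fun l hl c hc => ?_⟩
    · exact sub_mid hf hg hx j (iv j fun l hl => hj l (by omega)) (vQ j (hj i (by omega)))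
    · rcases Nat.lt_succ_iff_lt_or_eq.1 hl with hl' | rfl
      · have := hd i hir l hl'
        obtain ⟨e1⟩ := iso_left hf hg hx c (vQ c (by omega)) (vQ (c + 1) (by omega))
        obtain ⟨e2⟩ := ie l hl' c hc
        exact ⟨e1.trans e2⟩
      · refine iso_right hf hg hx c (iv c fun k hk => ?_) fun j hj => iv j fun k hk => ?_
        · have := hd l hir k hk
          omega
        · have := hd l hir k hk
          omega

end filtration

end SCM

namespace SCM

open IsLocalRing

lemma can_of {R : Type} [CommRing R] [IsLocalRing R] {n : ℕ}
    (hn : ringKrullDim R = (n : WithBot ℕ∞)) {ω : Type} [AddCommGroup ω] [Module R ω]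
    (hω : IsCanonicalModule R ω) : Can (R := R) n ω := by
  obtain ⟨hfin, h⟩ := hω
  refine ⟨hfin, fun i hi => ?_, ?_⟩
  · obtain ⟨e⟩ := compare (R := R) i (kk R) ω
    have := (h i).2 (by rw [hn]; exact_mod_cast hi)
    exact e.symm.toEquiv.subsingleton
  · obtain ⟨e⟩ := compare (R := R) n (kk R) ω
    obtain ⟨e2⟩ := (h n).1 (by rw [hn])
    exact ⟨e.symm.trans e2⟩

lemma exists_dim {R : Type} [CommRing R] {n : ℕ}
    (hn : ringKrullDim R = (n : WithBot ℕ∞)) (N : Type) [AddCommGroup N] [Module R N]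
    [Nontrivial N] : ∃ d : ℕ, d ≤ n ∧ mDim R N = (d : WithBot ℕ∞) := by
  have h1 : Module.supportDim R N ≤ (n : WithBot ℕ∞) := by
    rw [← hn]; exact Module.supportDim_le_ringKrullDim R N
  have h2 : Module.supportDim R N ≠ ⊥ := Module.supportDim_ne_bot_of_nontrivial R N
  change ∃ d : ℕ, d ≤ n ∧ Module.supportDim R N = (d : WithBot ℕ∞)
  generalize Module.supportDim R N = x at h1 h2
  induction x with
  | bot => exact absurd rfl h2
  | coe x =>
    have h3 : x ≤ (n : ℕ∞) := by exact_mod_cast h1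
    induction x with
    | top => simp at h3
    | coe x => exact ⟨x, by exact_mod_cast h3, rfl⟩

end SCM

open IsLocalRing in
/-- Let `R` be an `n`-dimensional Cohen-Macaulay Noetherian local ring with
canonical module `ω`, and let `M` be sequentially Cohen-Macaulay with sCM filtration
`0 = M₀ ⊊ M₁ ⊊ ⋯ ⊊ M_r = M` and `d_i = dim (M_i/M_{i-1})`.  Then:
(1) `Ext^{n-d_i}(M, ω) ≅ Ext^{n-d_i}(M_i/M_{i-1}, ω)` is Cohen-Macaulay of dimension `d_i`;
(2) `Ext^{n-j}(M, ω) = 0` for `0 ≤ j ≤ n` with `j ∉ {d_1, …, d_r}`;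
(3) `Ext^{n-d_i}(Ext^{n-d_i}(M, ω), ω) ≅ M_i/M_{i-1}`. -/
theorem stmt10 (R : Type) [CommRing R] [IsNoetherianRing R] [IsLocalRing R]
    (hCMring : IsCMLocalRing R) (n : ℕ) (hn : ringKrullDim R = (n : WithBot ℕ∞))
    (ω : Type) [AddCommGroup ω] [Module R ω] (hω : IsCanonicalModule R ω)
    (M : Type) [AddCommGroup M] [Module R M] [Module.Finite R M]
    (r : ℕ) (F : ℕ → Submodule R M) (hF : IsSCMFil R (maximalIdeal R) r F) :
    (∀ i < r, ∀ di : ℕ, mDim R (subQuot R (F i) (F (i + 1))) = (di : WithBot ℕ∞) →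
      Nonempty (extC R (n - di) M ω ≃ₗ[R]
        extC R (n - di) (subQuot R (F i) (F (i + 1))) ω) ∧
      IsCM R (maximalIdeal R) (extC R (n - di) M ω) ∧
      mDim R (extC R (n - di) M ω) = (di : WithBot ℕ∞)) ∧
    (∀ j ≤ n, (∀ i < r, mDim R (subQuot R (F i) (F (i + 1))) ≠ (j : WithBot ℕ∞)) →
      Subsingleton (extC R (n - j) M ω)) ∧
    (∀ i < r, ∀ di : ℕ, mDim R (subQuot R (F i) (F (i + 1))) = (di : WithBot ℕ∞) →
      Nonempty (extC R (n - di) (extC R (n - di) M ω) ω ≃ₗ[R]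
        subQuot R (F i) (F (i + 1)))) := by
  have hcan : SCM.Can (R := R) n ω := SCM.can_of hn hω
  obtain ⟨h0, hr, hlt, hcm, hinc⟩ := hF
  have hNT : ∀ i < r, Nontrivial (subQuot R (F i) (F (i + 1))) := fun i hi => (hcm i hi).1
  have hex : ∀ i, ∃ d : ℕ, i < r →
      d ≤ n ∧ mDim R (subQuot R (F i) (F (i + 1))) = (d : WithBot ℕ∞) := by
    intro i
    by_cases hi : i < r
    · have := hNT i hi
      obtain ⟨d, hd⟩ := SCM.exists_dim hn (subQuot R (F i) (F (i + 1)))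
      exact ⟨d, fun _ => hd⟩
    · exact ⟨0, fun h => absurd h hi⟩
  choose d hd using hex
  have hmono : ∀ i < r, ∀ l < i, d l < d i := by
    intro i
    induction i with
    | zero => intro _ l hl; exact absurd hl (Nat.not_lt_zero l)
    | succ i ih =>
      intro hi l hl
      have h1 := hinc i hi
      rw [(hd i (by omega)).2, (hd (i + 1) hi).2] at h1
      have h2 : d i < d (i + 1) := by exact_mod_cast h1
      rcases Nat.lt_succ_iff_lt_or_eq.1 hl with hl1 | rfl
      · exact (ih (by omega) l hl1).trans h2
      · exact h2
  have hP : ∀ i < r, SCM.Pd R (d i) (subQuot R (F i) (F (i + 1))) := fun i hi =>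
    SCM.Pd.of_isCM (hcm i hi) (hd i hi).2
  obtain ⟨fv, fe⟩ := SCM.filt hcan r F h0 (fun i hi => (hlt i hi).le) d hmono
    hP r le_rfl
  have eM : F r ≃ₗ[R] M := (LinearEquiv.ofEq _ _ hr).trans Submodule.topEquiv
  have key : ∀ i < r, ∀ di : ℕ, mDim R (subQuot R (F i) (F (i + 1))) = (di : WithBot ℕ∞) →
      di = d i := by
    intro i hi di h
    rw [(hd i hi).2] at h
    exact_mod_cast h.symm
  have iso : ∀ i < r, Nonempty (extC R (n - d i) M ω ≃ₗ[R]
      SCM.EX R (subQuot R (F i) (F (i + 1))) ω (n - d i)) := by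
    intro i hi
    have hle := (hd i hi).1
    obtain ⟨e1⟩ := SCM.compare (R := R) (n - d i) M ω
    obtain ⟨e2⟩ := fe i hi (n - d i) (by omega)
    exact ⟨(e1.trans (SCM.preEquiv eM ω (n - d i))).trans e2⟩
  have bid : ∀ i < r, Nonempty (SCM.EX R (SCM.EX R (subQuot R (F i) (F (i + 1))) ω (n - d i)) ω
      (n - d i) ≃ₗ[R] subQuot R (F i) (F (i + 1))) := by
    intro i hi
    have hle := (hd i hi).1
    have := hNT i hi
    exact SCM.bidual hcan (hP i hi) (by omega)
  refine ⟨fun i hi di hdi => ?_, fun j hj hne => ?_, fun i hi di hdi => ?_⟩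
  · obtain rfl := key i hi di hdi
    have hle := (hd i hi).1
    obtain ⟨e⟩ := iso i hi
    obtain ⟨e2⟩ := SCM.compare (R := R) (n - d i) (subQuot R (F i) (F (i + 1))) ω
    obtain ⟨b⟩ := bid i hi
    refine ⟨⟨e.trans e2.symm⟩, ?_⟩
    have hp : SCM.Pd R (d i) (extC R (n - d i) M ω) :=
      SCM.Pd.congr ((hP i hi).dual hcan (d i) (n - d i) (by omega)) e.symm
    have hnt : Nontrivial (extC R (n - d i) M ω) := by
      by_contra hcon
      rw [not_nontrivial_iff_subsingleton] at hcon
      have s1 : Subsingleton (SCM.EX R (subQuot R (F i) (F (i + 1))) ω (n - d i)) :=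
        e.symm.toEquiv.subsingleton
      have s2 : Subsingleton (SCM.EX R (SCM.EX R (subQuot R (F i) (F (i + 1))) ω (n - d i)) ω
        (n - d i)) := SCM.ex_sub_left _
      have s3 : Subsingleton (subQuot R (F i) (F (i + 1))) := b.symm.toEquiv.subsingleton
      exact not_nontrivial_iff_subsingleton.2 s3 (hNT i hi)
    exact hp.isCM
  · obtain ⟨e1⟩ := SCM.compare (R := R) (n - j) M ω
    have s := fv (n - j) (fun l hl h => by
      refine hne l hl ?_
      rw [(hd l hl).2]
      have : d l = j := by omega
      rw [this])
    exact (e1.trans (SCM.preEquiv eM ω (n - j))).toEquiv.subsingleton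
  · obtain rfl := key i hi di hdi
    obtain ⟨e⟩ := iso i hi
    obtain ⟨b⟩ := bid i hi
    obtain ⟨e1⟩ := SCM.compare (R := R) (n - d i) (extC R (n - d i) M ω) ω
    exact ⟨(e1.trans (SCM.preEquiv e.symm ω (n - d i))).trans b⟩
end

section
/- Let R be an n-dimensional Cohen-Macaulay ring with canonical module ω_R, and let M be a finitely generated R-module with t = depth(M). Assume that Ext_R^{n-t}(M, ω_R) is Cohen-Macaulay of dimension t. Then there is a natural monomorphism α : Ext_R^{n-t}(Ext_R^{n-t}(M, ω_R), ω_R) → M such that the induced map Ext^{n-t}(α) : Ext_R^{n-t}(M, ω_R) → Ext_R^{n-t}(Ext_R^{n-t}(Ext_R^{n-t}(M, ω_R), ω_R), ω_R) is an isomorphism. -/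
open CategoryTheory

/-- `Ext_R^i(A, B)` as an object of `ModuleCat R`. -/
noncomputable def extObj (R : Type) [CommRing R] (i : ℕ) (A B : ModuleCat R) : ModuleCat R :=
  ((Ext R (ModuleCat R) i).obj (Opposite.op A)).obj B

noncomputable section

namespace CMD

open Abelian

variable (R : Type) [CommRing R]

abbrev EX (i : ℕ) (X Y : Type) [AddCommGroup X] [Module R X] [AddCommGroup Y] [Module R Y] : Type :=
  Abelian.Ext (ModuleCat.of R X) (ModuleCat.of R Y) i

variable {R}
variable {X X' X'' Y Y' : Type} [AddCommGroup X] [Module R X] [AddCommGroup X'] [Module R X']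
  [AddCommGroup X''] [Module R X''] [AddCommGroup Y] [Module R Y] [AddCommGroup Y'] [Module R Y']

/-- contravariant functoriality -/
def pre (Y : Type) [AddCommGroup Y] [Module R Y] (i : ℕ) (f : X →ₗ[R] X') :
    EX R i X' Y →ₗ[R] EX R i X Y :=
  Ext.precompOfLinear (Ext.mk₀ (ModuleCat.ofHom f)) R (ModuleCat.of R Y) (zero_add i)

/-- covariant functoriality -/
def post (X : Type) [AddCommGroup X] [Module R X] (i : ℕ) (f : Y →ₗ[R] Y') :
    EX R i X Y →ₗ[R] EX R i X Y' :=
  Ext.postcompOfLinear (Ext.mk₀ (ModuleCat.ofHom f)) R (ModuleCat.of R X) (add_zero i)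

lemma pre_apply (i : ℕ) (f : X →ₗ[R] X') (z : EX R i X' Y) :
    pre Y i f z = (Ext.mk₀ (ModuleCat.ofHom f)).comp z (zero_add i) := rfl

lemma post_apply (i : ℕ) (f : Y →ₗ[R] Y') (z : EX R i X Y) :
    post X i f z = z.comp (Ext.mk₀ (ModuleCat.ofHom f)) (add_zero i) := rfl

lemma pre_comp (i : ℕ) (f : X →ₗ[R] X') (g : X' →ₗ[R] X'') :
    pre Y i (g ∘ₗ f) = pre Y i f ∘ₗ pre Y i g := by
  ext z
  rw [LinearMap.comp_apply, pre_apply, pre_apply, pre_apply, ModuleCat.ofHom_comp,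
    Ext.mk₀_comp_mk₀_assoc]

lemma pre_id (i : ℕ) : pre Y i (LinearMap.id : X →ₗ[R] X) = LinearMap.id := by
  ext z
  simp [pre_apply, ModuleCat.ofHom_id]

lemma pre_zero (i : ℕ) : pre Y i (0 : X →ₗ[R] X') = 0 := by
  ext z
  rw [pre_apply]
  change (Ext.mk₀ (0 : ModuleCat.of R X ⟶ ModuleCat.of R X')).comp z _ = 0
  simp

lemma pre_smul (i : ℕ) (r : R) (f : X →ₗ[R] X') : pre Y i (r • f) = r • pre Y i f := by
  ext z
  rw [pre_apply]
  change (Ext.mk₀ (r • ModuleCat.ofHom f)).comp z _ = r • pre Y i f z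
  rw [Ext.mk₀_smul, Ext.smul_comp]; rfl

lemma post_smul (i : ℕ) (r : R) (f : Y →ₗ[R] Y') : post X i (r • f) = r • post X i f := by
  ext z
  rw [post_apply]
  change z.comp (Ext.mk₀ (r • ModuleCat.ofHom f)) _ = r • post X i f z
  rw [Ext.mk₀_smul, Ext.comp_smul]; rfl

lemma post_id (i : ℕ) : post X i (LinearMap.id : Y →ₗ[R] Y) = LinearMap.id := by
  ext z
  simp [post_apply, ModuleCat.ofHom_id]

lemma pre_add (i : ℕ) (f g : X →ₗ[R] X') : pre Y i (f + g) = pre Y i f + pre Y i g := by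
  ext z
  rw [pre_apply]
  change (Ext.mk₀ (ModuleCat.ofHom f + ModuleCat.ofHom g)).comp z _ = _
  rw [Ext.mk₀_add, Ext.add_comp]; rfl

lemma post_comp {Y'' : Type} [AddCommGroup Y''] [Module R Y''] (i : ℕ) (f : Y →ₗ[R] Y')
    (g : Y' →ₗ[R] Y'') :
    post X i (g ∘ₗ f) = post X i g ∘ₗ post X i f := by
  ext z
  simp [post_apply, ModuleCat.ofHom_comp, ← Ext.mk₀_comp_mk₀]

def preEquiv (Y : Type) [AddCommGroup Y] [Module R Y] (i : ℕ) (e : X ≃ₗ[R] X') :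
    EX R i X' Y ≃ₗ[R] EX R i X Y :=
  LinearEquiv.ofLinearMap (pre Y i e.toLinearMap) (pre Y i e.symm.toLinearMap)
    (by rw [← pre_comp]; simp [pre_id]) (by rw [← pre_comp]; simp [pre_id])

def postEquiv (X : Type) [AddCommGroup X] [Module R X] (i : ℕ) (e : Y ≃ₗ[R] Y') :
    EX R i X Y ≃ₗ[R] EX R i X Y' :=
  LinearEquiv.ofLinearMap (post X i e.toLinearMap) (post X i e.symm.toLinearMap)
    (by rw [← post_comp]; simp [post_id]) (by rw [← post_comp]; simp [post_id])

/-- degree zero -/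
def ext0 (X Y : Type) [AddCommGroup X] [Module R X] [AddCommGroup Y] [Module R Y] :
    EX R 0 X Y ≃ₗ[R] (X →ₗ[R] Y) :=
  (Ext.linearEquiv₀ (R := R)).trans (ModuleCat.homLinearEquiv (S := R))

lemma ext0_symm_apply (f : X →ₗ[R] Y) : (ext0 X Y).symm f = Ext.mk₀ (ModuleCat.ofHom f) := rfl

lemma pre0 (f : X →ₗ[R] X') (g : X' →ₗ[R] Y) :
    pre Y 0 f ((ext0 X' Y).symm g) = (ext0 X Y).symm (g ∘ₗ f) := by
  simp [ext0_symm_apply, pre_apply, ModuleCat.ofHom_comp]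

lemma ext0_pre (f : X →ₗ[R] X') (z : EX R 0 X' Y) :
    ext0 X Y (pre Y 0 f z) = ext0 X' Y z ∘ₗ f := by
  obtain ⟨g, rfl⟩ := (ext0 X' Y).symm.surjective z
  rw [pre0]; simp

lemma post0 (f : Y →ₗ[R] Y') (g : X →ₗ[R] Y) :
    post X 0 f ((ext0 X Y).symm g) = (ext0 X Y').symm (f ∘ₗ g) := by
  simp [ext0_symm_apply, post_apply, ModuleCat.ofHom_comp]

/-- short exact sequences of modules -/
structure SES (f : X →ₗ[R] X') (g : X' →ₗ[R] X'') : Prop where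
  inj : Function.Injective f
  ex : Function.Exact f g
  surj : Function.Surjective g

namespace SES

variable {f : X →ₗ[R] X'} {g : X' →ₗ[R] X''}

def sc (h : SES f g) : ShortComplex (ModuleCat R) :=
  ShortComplex.mk (ModuleCat.ofHom f) (ModuleCat.ofHom g)
    (by rw [← ModuleCat.ofHom_comp, h.ex.linearMap_comp_eq_zero]; rfl)

lemma shortExact (h : SES f g) : h.sc.ShortExact where
  exact := (ShortComplex.ShortExact.moduleCat_exact_iff_function_exact _).mpr h.ex
  mono_f := (ModuleCat.mono_iff_injective _).mpr h.inj
  epi_g := (ModuleCat.epi_iff_surjective _).mpr h.surj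

/-- connecting map -/
def conn (h : SES f g) (Y : Type) [AddCommGroup Y] [Module R Y] (i : ℕ) :
    EX R i X Y →ₗ[R] EX R (i + 1) X'' Y :=
  Ext.precompOfLinear h.shortExact.extClass R (ModuleCat.of R Y) (add_comm 1 i)

lemma exact2 (h : SES f g) (i : ℕ) : Function.Exact (pre Y i g) (pre Y i f) := by
  intro z
  constructor
  · intro hz
    obtain ⟨w, hw⟩ := Ext.contravariant_sequence_exact₂ h.shortExact (ModuleCat.of R Y) z hz
    exact ⟨w, hw⟩
  · rintro ⟨w, rfl⟩
    rw [← LinearMap.comp_apply, ← pre_comp, h.ex.linearMap_comp_eq_zero, pre_zero]; rfl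

lemma exact1 (h : SES f g) (i : ℕ) : Function.Exact (pre Y i f) (h.conn Y i) := by
  intro z
  constructor
  · intro hz
    obtain ⟨w, hw⟩ := Ext.contravariant_sequence_exact₁ h.shortExact (ModuleCat.of R Y) z
      (add_comm 1 i) hz
    exact ⟨w, hw⟩
  · rintro ⟨w, rfl⟩
    exact h.shortExact.extClass_comp_assoc w (h := add_comm 1 i)

lemma exact3 (h : SES f g) (i : ℕ) : Function.Exact (h.conn Y i) (pre Y (i + 1) g) := by
  intro z
  constructor
  · intro hz
    obtain ⟨w, hw⟩ := Ext.contravariant_sequence_exact₃ h.shortExact (ModuleCat.of R Y) z hz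
      (add_comm 1 i)
    exact ⟨w, hw⟩
  · rintro ⟨w, rfl⟩
    exact h.shortExact.comp_extClass_assoc w (add_comm 1 i)

lemma pre0_inj (h : SES f g) : Function.Injective (pre Y 0 g) := by
  intro a b hab
  apply (ext0 X'' Y).injective
  have := congrArg (ext0 X' Y) hab
  rw [ext0_pre, ext0_pre] at this
  ext x
  obtain ⟨x, rfl⟩ := h.surj x
  exact LinearMap.congr_fun this x

/-- covariant connecting map -/
def conn' (h : SES f g) (Z : Type) [AddCommGroup Z] [Module R Z] (i : ℕ) :
    EX R i Z X'' →ₗ[R] EX R (i + 1) Z X :=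
  Ext.postcompOfLinear h.shortExact.extClass R (ModuleCat.of R Z) rfl

lemma exact2' (h : SES f g) (i : ℕ) : Function.Exact (post Y i f) (post Y i g) := by
  intro z
  constructor
  · intro hz
    obtain ⟨w, hw⟩ := Ext.covariant_sequence_exact₂ (ModuleCat.of R Y) h.shortExact z hz
    exact ⟨w, hw⟩
  · rintro ⟨w, rfl⟩
    rw [← LinearMap.comp_apply, ← post_comp, h.ex.linearMap_comp_eq_zero]
    rw [show (0 : X →ₗ[R] X'') = (0 : R) • 0 by simp, post_smul]; simp

lemma exact3' (h : SES f g) (i : ℕ) (z : EX R i Y X'') (hz : h.conn' Y i z = 0) :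
    ∃ w, post Y i g w = z := by
  obtain ⟨w, hw⟩ := Ext.covariant_sequence_exact₃ (ModuleCat.of R Y) h.shortExact z rfl hz
  exact ⟨w, hw⟩

variable {Z Z' Z'' : Type} [AddCommGroup Z] [Module R Z] [AddCommGroup Z'] [Module R Z']
  [AddCommGroup Z''] [Module R Z''] {f' : Z →ₗ[R] Z'} {g' : Z' →ₗ[R] Z''}

lemma conn_natural (h : SES f g) (h' : SES f' g') (a : X →ₗ[R] Z) (b : X' →ₗ[R] Z')
    (c : X'' →ₗ[R] Z'') (hab : b ∘ₗ f = f' ∘ₗ a) (hbc : c ∘ₗ g = g' ∘ₗ b) (i : ℕ)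
    (z : EX R i Z Y) :
    h.conn Y i (pre Y i a z) = pre Y (i + 1) c (h'.conn Y i z) := by
  let φ : h.sc ⟶ h'.sc :=
    { τ₁ := ModuleCat.ofHom a
      τ₂ := ModuleCat.ofHom b
      τ₃ := ModuleCat.ofHom c
      comm₁₂ := by
        change ModuleCat.ofHom a ≫ ModuleCat.ofHom f' = ModuleCat.ofHom f ≫ ModuleCat.ofHom b
        rw [← ModuleCat.ofHom_comp, ← ModuleCat.ofHom_comp, hab]
      comm₂₃ := by
        change ModuleCat.ofHom b ≫ ModuleCat.ofHom g' = ModuleCat.ofHom g ≫ ModuleCat.ofHom c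
        rw [← ModuleCat.ofHom_comp, ← ModuleCat.ofHom_comp, hbc] }
  have key := h.shortExact.extClass_naturality h'.shortExact φ
  change h.shortExact.extClass.comp ((Ext.mk₀ (ModuleCat.ofHom a)).comp z (zero_add i)) (add_comm 1 i)
    = (Ext.mk₀ (ModuleCat.ofHom c)).comp (h'.shortExact.extClass.comp z (add_comm 1 i)) (zero_add _)
  refine (Ext.comp_assoc h.shortExact.extClass (Ext.mk₀ (ModuleCat.ofHom a)) z
    (add_zero 1) (zero_add i) (by omega)).symm.trans (Eq.trans ?_
    (Ext.comp_assoc (Ext.mk₀ (ModuleCat.ofHom c)) h'.shortExact.extClass z (zero_add 1)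
      (add_comm 1 i) (by omega)))
  exact congrArg (fun w => Ext.comp w z (add_comm 1 i)) key

end SES

lemma sub_of_projective [Module.Projective R X] (i : ℕ) : Subsingleton (EX R (i + 1) X Y) := by
  have : Projective (ModuleCat.of R X) := (IsProjective.iff_projective X).mp inferInstance
  exact Ext.subsingleton_of_projective _ _ _

instance finite_EX [IsNoetherianRing R] [Module.Finite R X] [Module.Finite R Y] (i : ℕ) :
    Module.Finite R (EX R i X Y) :=
  ModuleCat.finite_ext R (ModuleCat.of R X) (ModuleCat.of R Y) i

end CMD
end

noncomputable section

namespace CMD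
namespace Cmp

open Abelian

variable {R : Type} [CommRing R] {X Y : ModuleCat.{0} R} (P : ProjectiveResolution X)

abbrev Kc (Y : ModuleCat.{0} R) : CochainComplex (ModuleCat R) ℕ := P.complex.linearYonedaObj R Y

lemma extMk_smul {n : ℕ} (r : R) (f : P.complex.X n ⟶ Y) (m : ℕ) (hm : n + 1 = m)
    (hf : P.complex.d m n ≫ f = 0) :
    P.extMk (r • f) m hm (by simp [hf]) = r • P.extMk f m hm hf := by
  have h1 := P.extMk_comp_mk₀ f m hm hf (r • 𝟙 Y)
  rw [Ext.mk₀_smul, Ext.comp_smul, Ext.comp_mk₀_id] at h1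
  rw [h1]
  simp

lemma extMk_zero_inj (f : P.complex.X 0 ⟶ Y) (m : ℕ) (hm : 0 + 1 = m)
    (hf : P.complex.d m 0 ≫ f = 0) (h : P.extMk f m hm hf = 0) : f = 0 := by
  rw [← P.extEquivCohomologyClass.apply_eq_iff_eq,
    ProjectiveResolution.extEquivCohomologyClass_extMk,
    ProjectiveResolution.extEquivCohomologyClass_zero,
    CochainComplex.HomComplex.CohomologyClass.mk_eq_zero_iff,
    CochainComplex.HomComplex.Cocycle.toSingleMk_mem_coboundaries_iff _ _ _ _ _ 1 (by simp)] at h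
  obtain ⟨g, hg⟩ := h
  have hz : Limits.IsZero (P.cochainComplex.X 1) := P.cochainComplex.isZero_of_isStrictlyLE 0 1
  rw [hz.eq_of_src g 0] at hg
  rw [← cancel_epi (P.cochainComplexXIso (-(0 : ℕ)) 0 rfl).hom]
  simpa using hg.symm

def ic (n : ℕ) (z : (Kc P Y).cycles n) : P.complex.X n ⟶ Y := ((Kc P Y).iCycles n).hom z

lemma ic_add (n : ℕ) (z w : (Kc P Y).cycles n) : ic P n (z + w) = ic P n z + ic P n w :=
  map_add ((Kc P Y).iCycles n).hom z w

lemma ic_smul (n : ℕ) (r : R) (z : (Kc P Y).cycles n) : ic P n (r • z) = r • ic P n z :=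
  map_smul ((Kc P Y).iCycles n).hom r z

lemma ic_d (n : ℕ) (z : (Kc P Y).cycles n) :
    P.complex.d (n + 1) n ≫ ic P n z = 0 := by
  have := congrArg (fun f => f.hom z) ((Kc P Y).iCycles_d n (n + 1))
  exact this

lemma ic_inj (n : ℕ) : Function.Injective (ic P (Y := Y) n) :=
  (ModuleCat.mono_iff_injective ((Kc P Y).iCycles n)).mp inferInstance

lemma ic_surj (n : ℕ) (f : P.complex.X n ⟶ Y) (hf : P.complex.d (n + 1) n ≫ f = 0) :
    ∃ z, ic P n z = f := by
  have hk := (Kc P Y).cyclesIsKernel n (n + 1) (by simp)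
  have hex := ShortComplex.exact_of_f_is_kernel (ShortComplex.mk _ _ ((Kc P Y).iCycles_d n (n + 1))) hk
  rw [ShortComplex.ShortExact.moduleCat_exact_iff_function_exact] at hex
  exact (hex f).mp hf

def cyc (n : ℕ) : (Kc P Y).cycles n →ₗ[R] Abelian.Ext X Y n where
  toFun z := P.extMk (ic P n z) (n + 1) rfl (ic_d P n z)
  map_add' a b := by
    simp only [ic_add, ProjectiveResolution.add_extMk]
  map_smul' r a := by
    rw [RingHom.id_apply, ← extMk_smul]
    simp only [ic_smul]

lemma cyc_surj (n : ℕ) : Function.Surjective (cyc P (Y := Y) n) := by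
  intro a
  obtain ⟨f, hf, rfl⟩ := P.extMk_surjective a (n + 1) rfl
  obtain ⟨z, rfl⟩ := ic_surj P n f hf
  exact ⟨z, rfl⟩

lemma ker_homologyπ (n : ℕ) :
    LinearMap.ker ((Kc P Y).homologyπ n).hom = LinearMap.ker (cyc P (Y := Y) n) := by
  have hk := (Kc P Y).homologyIsCokernel ((ComplexShape.up ℕ).prev n) n rfl
  have hex := ShortComplex.exact_of_g_is_cokernel (ShortComplex.mk _ _
    ((Kc P Y).toCycles_comp_homologyπ ((ComplexShape.up ℕ).prev n) n)) hk
  rw [ShortComplex.ShortExact.moduleCat_exact_iff_function_exact] at hex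
  ext z
  rw [LinearMap.mem_ker, LinearMap.mem_ker]
  refine (hex z).trans ?_
  change _ ↔ P.extMk (ic P n z) (n + 1) rfl (ic_d P n z) = 0
  have key : ∀ w, ic P n (((Kc P Y).toCycles ((ComplexShape.up ℕ).prev n) n).hom w) =
      ((Kc P Y).d ((ComplexShape.up ℕ).prev n) n).hom w := fun w =>
    congrArg (fun f => f.hom w) ((Kc P Y).toCycles_i ((ComplexShape.up ℕ).prev n) n)
  rcases n with _ | n
  · constructor
    · rintro ⟨w, rfl⟩
      have : ic P 0 (((Kc P Y).toCycles ((ComplexShape.up ℕ).prev 0) 0).hom w) = 0 := by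
        rw [key, (Kc P Y).shape _ _ (by simp)]; rfl
      have h2 : ∀ (f : P.complex.X 0 ⟶ Y) (hf : P.complex.d (0 + 1) 0 ≫ f = 0), f = 0 →
          P.extMk f (0 + 1) rfl hf = 0 := by
        rintro _ _ rfl
        simp
      exact h2 _ _ this
    · intro h
      have := extMk_zero_inj P _ _ _ _ h
      refine ⟨0, ?_⟩
      apply ic_inj P
      rw [this, map_zero]
      exact map_zero ((Kc P Y).iCycles 0).hom
  · rw [P.extMk_eq_zero_iff _ _ _ _ n rfl]
    have e : (ComplexShape.up ℕ).prev (n + 1) = n := by simp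
    rw [e] at key
    rw [e]
    constructor
    · rintro ⟨w, rfl⟩
      exact ⟨w, (key w).symm⟩
    · rintro ⟨g, hg⟩
      refine ⟨g, ic_inj P _ ?_⟩
      exact (key g).trans hg

lemma homologyπ_surj (n : ℕ) : Function.Surjective ((Kc P Y).homologyπ n).hom :=
  (ModuleCat.epi_iff_surjective _).mp inferInstance

def hIso (n : ℕ) : (Kc P Y).homology n ≃ₗ[R] Abelian.Ext X Y n :=
  (LinearMap.quotKerEquivOfSurjective _ (homologyπ_surj P n)).symm ≪≫ₗ
    Submodule.quotEquivOfEq _ _ (ker_homologyπ P n) ≪≫ₗ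
    LinearMap.quotKerEquivOfSurjective _ (cyc_surj P n)

lemma hIso_π (n : ℕ) (z : (Kc P Y).cycles n) :
    hIso P n (((Kc P Y).homologyπ n).hom z) = cyc P n z := by
  have : (LinearMap.quotKerEquivOfSurjective _ (homologyπ_surj P (Y := Y) n)).symm
      (((Kc P Y).homologyπ n).hom z) = Submodule.Quotient.mk z := by
    rw [LinearEquiv.symm_apply_eq]; rfl
  simp only [hIso, LinearEquiv.trans_apply, this]
  rfl

variable {X' : ModuleCat.{0} R} (P' : ProjectiveResolution X')

def Kmap {g : X' ⟶ X} (φ : ProjectiveResolution.Hom P' P g) (Y : ModuleCat.{0} R) : Kc P Y ⟶ Kc P' Y :=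
  (HomologicalComplex.unopFunctor _ _).map
    ((((linearYoneda R (ModuleCat R)).obj Y).rightOp.mapHomologicalComplex _).map φ.hom).op

lemma Kmap_f {g : X' ⟶ X} (φ : ProjectiveResolution.Hom P' P g) (n : ℕ) (f : P.complex.X n ⟶ Y) :
    ((Kmap P P' φ Y).f n).hom f = φ.hom.f n ≫ f := rfl

lemma hIso_nat {g : X' ⟶ X} (φ : ProjectiveResolution.Hom P' P g) (n : ℕ)
    (z : (Kc P Y).homology n) :
    hIso P' n ((HomologicalComplex.homologyMap (Kmap P P' φ Y) n).hom z) =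
      (Ext.mk₀ g).comp (hIso P n z) (zero_add n) := by
  obtain ⟨w, rfl⟩ := homologyπ_surj P n z
  have h1 : (HomologicalComplex.homologyMap (Kmap P P' φ Y) n).hom (((Kc P Y).homologyπ n).hom w)
      = ((Kc P' Y).homologyπ n).hom ((HomologicalComplex.cyclesMap (Kmap P P' φ Y) n).hom w) :=
    congrArg (fun f => f.hom w) (HomologicalComplex.homologyπ_naturality (Kmap P P' φ Y) n)
  rw [h1, hIso_π, hIso_π]
  simp only [cyc, LinearMap.coe_mk, AddHom.coe_mk]
  rw [ProjectiveResolution.mk₀_comp_extMk _ _ _ _ φ]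
  congr 1
  exact congrArg (fun f => f.hom w) (HomologicalComplex.cyclesMap_i (Kmap P P' φ Y) n)

lemma isoExt_nat {g : X' ⟶ X} (φ : ProjectiveResolution.Hom P' P g) (n : ℕ) :
    ((_root_.Ext R (ModuleCat R) n).map g.op).app Y ≫ (P'.isoExt n Y).hom =
      (P.isoExt n Y).hom ≫ HomologicalComplex.homologyMap (Kmap P P' φ Y) n := by
  have h1 := P'.isoLeftDerivedObj_inv_naturality g P φ.hom (by simpa using φ.hom_f_zero_comp_π_f_zero)
    ((linearYoneda R (ModuleCat R)).obj Y).rightOp n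
  have h3 : ((Kc P' Y).homologyOp n).inv ≫
      (HomologicalComplex.homologyMap ((HomologicalComplex.opFunctor _ _).map
        (Kmap P P' φ Y).op) n) = (HomologicalComplex.homologyMap (Kmap P P' φ Y) n).op ≫
        ((Kc P Y).homologyOp n).inv :=
    (ShortComplex.homologyOpIso_inv_naturality
      ((HomologicalComplex.shortComplexFunctor _ _ n).map (Kmap P P' φ Y))).symm
  have h4 : ((Kc P' Y).homologyOp n).inv ≫
      ((P'.isoLeftDerivedObj ((linearYoneda R (ModuleCat R)).obj Y).rightOp n).inv ≫
      (((linearYoneda R (ModuleCat R)).obj Y).rightOp.leftDerived n).map g) =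
      (HomologicalComplex.homologyMap (Kmap P P' φ Y) n).op ≫ ((Kc P Y).homologyOp n).inv ≫
        (P.isoLeftDerivedObj ((linearYoneda R (ModuleCat R)).obj Y).rightOp n).inv := by
    refine (congrArg (fun f => ((Kc P' Y).homologyOp n).inv ≫ f) h1).trans ?_
    refine (Category.assoc _ _ _).symm.trans ?_
    refine Eq.trans ?_ (Category.assoc _ _ _)
    exact congrArg (fun f => f ≫ (P.isoLeftDerivedObj ((linearYoneda R (ModuleCat R)).obj Y).rightOp n).inv) h3
  have h5 := congrArg Quiver.Hom.unop h4
  exact (Category.assoc _ _ _).trans h5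

end Cmp

variable {R : Type} [CommRing R]

/-- comparison of the two models of Ext -/
def cmp (i : ℕ) (X Y : ModuleCat.{0} R) :
    (((_root_.Ext R (ModuleCat R) i).obj (Opposite.op X)).obj Y) ≃ₗ[R] EX R i X Y :=
  ((projectiveResolution X).isoExt i Y).toLinearEquiv ≪≫ₗ Cmp.hIso (projectiveResolution X) i

lemma cmp_nat (i : ℕ) {X X' : ModuleCat.{0} R} (Y : ModuleCat.{0} R) (g : X' ⟶ X)
    (z : (((_root_.Ext R (ModuleCat R) i).obj (Opposite.op X)).obj Y)) :
    cmp i X' Y ((((_root_.Ext R (ModuleCat R) i).map g.op).app Y).hom z) =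
      pre Y i g.hom (cmp i X Y z) := by
  let φ : ProjectiveResolution.Hom (projectiveResolution X') (projectiveResolution X) g :=
    { hom := ProjectiveResolution.lift g _ _
      hom_f_zero_comp_π_f_zero := by
        have := ProjectiveResolution.lift_commutes_zero g (projectiveResolution X')
          (projectiveResolution X)
        simpa using this }
  have h := Cmp.isoExt_nat (Y := Y) _ _ φ i
  have h' := congrArg (fun f => f.hom z) h
  refine (congrArg (Cmp.hIso (projectiveResolution X') i) h').trans ?_
  exact Cmp.hIso_nat _ _ φ i _

end CMD
end

noncomputable section

namespace CMD

open IsLocalRing Pointwise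

set_option linter.unusedSectionVars false

section basics
variable {R : Type} [CommRing R]
variable {X X' X'' Y Y' : Type} [AddCommGroup X] [Module R X] [AddCommGroup X'] [Module R X']
  [AddCommGroup X''] [Module R X''] [AddCommGroup Y] [Module R Y] [AddCommGroup Y'] [Module R Y']

lemma SES.sub_mid {f : X →ₗ[R] X'} {g : X' →ₗ[R] X''} (h : SES f g) (i : ℕ)
    (h1 : Subsingleton (EX R i X Y)) (h3 : Subsingleton (EX R i X'' Y)) :
    Subsingleton (EX R i X' Y) := by
  refine subsingleton_of_forall_eq 0 fun z => ?_
  obtain ⟨w, rfl⟩ := (h.exact2 i z).mp (Subsingleton.elim _ _)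
  rw [Subsingleton.elim w 0, map_zero]

lemma SES.sub_right {f : X →ₗ[R] X'} {g : X' →ₗ[R] X''} (h : SES f g) (i : ℕ)
    (h1 : Subsingleton (EX R i X Y)) (h3 : Subsingleton (EX R (i + 1) X' Y)) :
    Subsingleton (EX R (i + 1) X'' Y) := by
  refine subsingleton_of_forall_eq 0 fun z => ?_
  obtain ⟨w, rfl⟩ := (h.exact3 i z).mp (Subsingleton.elim _ _)
  rw [Subsingleton.elim w 0, map_zero]

lemma SES.sub_left {f : X →ₗ[R] X'} {g : X' →ₗ[R] X''} (h : SES f g) (i : ℕ)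
    (h1 : Subsingleton (EX R i X' Y)) (h3 : Subsingleton (EX R (i + 1) X'' Y)) :
    Subsingleton (EX R i X Y) := by
  refine subsingleton_of_forall_eq 0 fun z => ?_
  obtain ⟨w, rfl⟩ := (h.exact1 i z).mp (Subsingleton.elim _ _)
  rw [Subsingleton.elim w 0, map_zero]

lemma SES.pre_surj {f : X →ₗ[R] X'} {g : X' →ₗ[R] X''} (h : SES f g) (i : ℕ)
    (h3 : Subsingleton (EX R (i + 1) X'' Y)) : Function.Surjective (pre Y i f) := fun z =>
  (h.exact1 i z).mp (Subsingleton.elim _ _)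

lemma SES.conn_surj {f : X →ₗ[R] X'} {g : X' →ₗ[R] X''} (h : SES f g) (i : ℕ)
    (h3 : Subsingleton (EX R (i + 1) X' Y)) : Function.Surjective (h.conn Y i) := fun z =>
  (h.exact3 i z).mp (Subsingleton.elim _ _)

lemma SES.conn_inj {f : X →ₗ[R] X'} {g : X' →ₗ[R] X''} (h : SES f g) (i : ℕ)
    (h3 : Subsingleton (EX R i X' Y)) : Function.Injective (h.conn Y i) := by
  rw [injective_iff_map_eq_zero]
  intro z hz
  obtain ⟨w, rfl⟩ := (h.exact1 i z).mp hz
  rw [Subsingleton.elim w 0, map_zero]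

lemma SES.pre_inj {f : X →ₗ[R] X'} {g : X' →ₗ[R] X''} (h : SES f g) (i : ℕ)
    (h3 : Subsingleton (EX R i X Y)) : Function.Injective (pre Y (i + 1) g) := by
  rw [injective_iff_map_eq_zero]
  intro z hz
  obtain ⟨w, rfl⟩ := (h.exact3 i z).mp hz
  rw [Subsingleton.elim w 0, map_zero]

lemma sub_EX_left [Subsingleton X] (i : ℕ) : Subsingleton (EX R i X Y) := by
  refine subsingleton_of_forall_eq 0 fun z => ?_
  have : pre Y i (LinearMap.id : X →ₗ[R] X) z = pre Y i (0 : X →ₗ[R] X) z := by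
    congr 2; exact Subsingleton.elim _ _
  rwa [pre_id, pre_zero] at this

lemma SES.quotSMul (y : R) (hy : IsSMulRegular X y) :
    SES (y • (LinearMap.id : X →ₗ[R] X)) (Submodule.mkQ (y • (⊤ : Submodule R X)) : X →ₗ[R] QuotSMulTop y X) where
  inj := fun a b hab => hy hab
  ex := by
    intro x
    rw [Submodule.mkQ_apply, Submodule.Quotient.mk_eq_zero, Submodule.mem_smul_pointwise_iff_exists]
    simp
  surj := Submodule.mkQ_surjective _

lemma SES.ker (g : X' →ₗ[R] X'') (hg : Function.Surjective g) :
    SES (LinearMap.ker g).subtype g where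
  inj := Subtype.val_injective
  ex := by intro x; simp
  surj := hg

lemma SES.mkQ (N : Submodule R X) : SES N.subtype N.mkQ where
  inj := Subtype.val_injective
  ex := by intro x; simp
  surj := Submodule.mkQ_surjective _

lemma pre_smul_id (y : R) (i : ℕ) (z : EX R i X Y) :
    pre Y i (y • (LinearMap.id : X →ₗ[R] X)) z = y • z := by
  rw [pre_smul, pre_id]; rfl

lemma post_smul_id (y : R) (i : ℕ) (z : EX R i X Y) :
    post X i (y • (LinearMap.id : Y →ₗ[R] Y)) z = y • z := by
  rw [post_smul, post_id]; rfl

end basics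

variable {R : Type} [CommRing R] [IsNoetherianRing R] [IsLocalRing R]

lemma nakayama_sub {N : Type} [AddCommGroup N] [Module R N] [Module.Finite R N] (y : R)
    (hy : y ∈ maximalIdeal R) (h : ∀ z : N, ∃ w : N, y • w = z) : Subsingleton N := by
  have : (⊤ : Submodule R N) ≤ (maximalIdeal R) • ⊤ := by
    intro z _
    obtain ⟨w, rfl⟩ := h z
    exact Submodule.smul_mem_smul hy trivial
  have := Submodule.eq_bot_of_le_smul_of_le_jacobson_bot (maximalIdeal R) ⊤
    Module.Finite.fg_top this (maximalIdeal_le_jacobson _)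
  exact (Submodule.subsingleton_iff R).mp (subsingleton_of_bot_eq_top this.symm)

section
variable {X Y : Type} [AddCommGroup X] [Module R X] [Module.Finite R X] [AddCommGroup Y]
  [Module R Y] [Module.Finite R Y]

lemma sub_of_regular (y : R) (hy : y ∈ maximalIdeal R) {W : Type} [AddCommGroup W] [Module R W]
    {g : X →ₗ[R] W} (h : SES (y • (LinearMap.id : X →ₗ[R] X)) g) (i : ℕ)
    (hs : Subsingleton (EX R (i + 1) W Y)) : Subsingleton (EX R i X Y) := by
  refine nakayama_sub y hy fun z => ?_
  obtain ⟨w, hw⟩ := h.pre_surj i hs z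
  exact ⟨w, by rw [← hw, pre_smul_id]⟩

end

lemma exists_regular {X : Type} [AddCommGroup X] [Module R X] [Module.Finite R X]
    (h : ∀ f : (R ⧸ maximalIdeal R) →ₗ[R] X, ¬ Function.Injective f) :
    ∃ y ∈ maximalIdeal R, IsSMulRegular X y := by
  by_contra! hc
  have hsub : (maximalIdeal R : Set R) ⊆ ⋃ p ∈ associatedPrimes R X, (p : Set R) := by
    intro y hy
    rw [biUnion_associatedPrimes_eq_compl_regular]
    exact hc y hy
  have fin := associatedPrimes.finite R X
  obtain ⟨p, hp, hle⟩ := (Ideal.subset_union_prime_finite fin (f := id) 0 0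
    fun _ h _ _ => h.isPrime).1 hsub
  have hpm : p = maximalIdeal R :=
    ((maximalIdeal.isMaximal R).eq_of_le hp.isPrime.ne_top hle).symm
  subst hpm
  obtain ⟨f, hf⟩ := (isAssociatedPrime_iff_exists_injective_linearMap _ _).mp hp |>.2
  exact h f hf

/-- working form of the canonical module hypothesis -/
structure Can (R : Type) [CommRing R] [IsLocalRing R] (ω : Type) [AddCommGroup ω] [Module R ω]
    (n : ℕ) : Prop where
  fin : Module.Finite R ω
  top : Nonempty (EX R n (R ⧸ maximalIdeal R) ω ≃ₗ[R] (R ⧸ maximalIdeal R))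
  van : ∀ i, i ≠ n → Subsingleton (EX R i (R ⧸ maximalIdeal R) ω)
  dim : ringKrullDim R = (n : WithBot ℕ∞)

variable {ω : Type} [AddCommGroup ω] [Module R ω] {n : ℕ}

lemma withBot_succ_le {a : WithBot ℕ∞} {d : ℕ} (h : a + 1 ≤ ((d + 1 : ℕ) : WithBot ℕ∞)) :
    a ≤ (d : WithBot ℕ∞) := by
  induction a using WithBot.recBotCoe with
  | bot => exact bot_le
  | coe a =>
    have h' : ((a + 1 : ℕ∞) : WithBot ℕ∞) ≤ (((d + 1 : ℕ) : ℕ∞) : WithBot ℕ∞) := h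
    rw [WithBot.coe_le_coe] at h'
    have : ((a : ℕ∞) : WithBot ℕ∞) ≤ ((d : ℕ∞) : WithBot ℕ∞) := by
      rw [WithBot.coe_le_coe]
      push_cast at h'
      exact (ENat.add_le_add_iff_right (by simp)).mp h'
    exact this

lemma dim_quot {X : Type} [AddCommGroup X] [Module R X] [Module.Finite R X] {y : R}
    (hy : y ∈ maximalIdeal R) (hr : IsSMulRegular X y) {d : ℕ}
    (h : Module.supportDim R X ≤ ((d + 1 : ℕ) : WithBot ℕ∞)) :
    Module.supportDim R (QuotSMulTop y X) ≤ (d : WithBot ℕ∞) := by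
  rw [← Module.supportDim_quotSMulTop_succ_eq_supportDim hr hy] at h
  exact withBot_succ_le h

lemma dim_zero_not {X : Type} [AddCommGroup X] [Module R X] [Module.Finite R X] {y : R}
    (hy : y ∈ maximalIdeal R) (hr : IsSMulRegular X y) 
    (h : Module.supportDim R X ≤ ((0 : ℕ) : WithBot ℕ∞)) : Subsingleton X := by
  rw [← Module.supportDim_quotSMulTop_succ_eq_supportDim hr hy] at h
  have : Subsingleton (QuotSMulTop y X) := by
    rw [← Module.supportDim_eq_bot_iff_subsingleton (R := R)]
    generalize Module.supportDim R (QuotSMulTop y X) = a at h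
    induction a using WithBot.recBotCoe with
    | bot => rfl
    | coe a =>
      have h' : ((a + 1 : ℕ∞) : WithBot ℕ∞) ≤ (((0 : ℕ) : ℕ∞) : WithBot ℕ∞) := h
      rw [WithBot.coe_le_coe] at h'
      simp at h'
  refine nakayama_sub y hy fun z => ?_
  have h0 : (Submodule.Quotient.mk z : QuotSMulTop y X) = 0 := Subsingleton.elim _ _
  rw [Submodule.Quotient.mk_eq_zero, Submodule.mem_smul_pointwise_iff_exists] at h0
  obtain ⟨w, -, hw⟩ := h0
  exact ⟨w, hw⟩

lemma reg_prime (p : Ideal R) (hp : p.IsPrime) {N : Type} [AddCommGroup N] [Module R N]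
    (f : N ≃ₗ[R] R ⧸ p) (x : R) (hx : x ∉ p) : IsSMulRegular N x := by
  rw [LinearEquiv.isSMulRegular_congr f, isSMulRegular_iff_right_eq_zero_of_smul]
  intro a ha
  obtain ⟨a, rfl⟩ := Ideal.Quotient.mk_surjective a
  have : Ideal.Quotient.mk p (x * a) = 0 := ha
  rw [Ideal.Quotient.eq_zero_iff_mem] at this ⊢
  exact (hp.mem_or_mem this).resolve_left hx

lemma devissage (hω : Can R ω n) (I : ℕ → ℕ → Prop) (hI : ∀ d i, I d i → i ≠ n)
    (hI' : ∀ d i, I (d + 1) i → I d (i + 1)) (d : ℕ) (L : Type) [AddCommGroup L] [Module R L]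
    [hL : Module.Finite R L] (hdim : Module.supportDim R L ≤ (d : WithBot ℕ∞)) (i : ℕ)
    (hi : I d i) : Subsingleton (EX R i L ω) := by
  have := hω.fin
  induction d generalizing L i with
  | zero =>
    revert hdim
    induction hL using IsNoetherianRing.induction_on_isQuotientEquivQuotientPrime R with
    | subsingleton N => intro _; exact sub_EX_left i
    | quotient N p f =>
      intro hdim
      by_cases hp : p.1 = maximalIdeal R
      · have := hω.van i (hI _ _ hi)
        rw [← hp] at this
        exact (preEquiv ω i f).symm.injective.subsingleton
      · exfalso
        obtain ⟨x, hx, hxp⟩ : ∃ x ∈ maximalIdeal R, x ∉ p.1 := by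
          by_contra! hc
          exact hp ((maximalIdeal.isMaximal R).eq_of_le p.2.ne_top hc).symm
        have hreg : IsSMulRegular N x := by
          exact reg_prime p.1 p.2 f x hxp
        have := dim_zero_not hx hreg hdim
        have h1 : (1 : R ⧸ p.1) = 0 := f.symm.injective (Subsingleton.elim _ _)
        have := p.2
        exact one_ne_zero h1
    | exact N₁ N₂ N₃ f g hf hg hfg h₁ h₃ =>
      intro hdim
      have hs : SES f g := ⟨hf, hfg, hg⟩
      exact hs.sub_mid i (h₁ ((Module.supportDim_le_of_injective f hf).trans hdim))
        (h₃ ((Module.supportDim_le_of_surjective g hg).trans hdim))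
  | succ d ih =>
    revert hdim
    induction hL using IsNoetherianRing.induction_on_isQuotientEquivQuotientPrime R with
    | subsingleton N => intro _; exact sub_EX_left i
    | quotient N p f =>
      intro hdim
      by_cases hp : p.1 = maximalIdeal R
      · have := hω.van i (hI _ _ hi)
        rw [← hp] at this
        exact (preEquiv ω i f).symm.injective.subsingleton
      · obtain ⟨x, hx, hxp⟩ : ∃ x ∈ maximalIdeal R, x ∉ p.1 := by
          by_contra! hc
          exact hp ((maximalIdeal.isMaximal R).eq_of_le p.2.ne_top hc).symm
        have hreg : IsSMulRegular N x := by
          exact reg_prime p.1 p.2 f x hxp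
        refine sub_of_regular x hx (SES.quotSMul x hreg) i ?_
        exact ih _ (dim_quot hx hreg hdim) _ (hI' _ _ hi)
    | exact N₁ N₂ N₃ f g hf hg hfg h₁ h₃ =>
      intro hdim
      have hs : SES f g := ⟨hf, hfg, hg⟩
      exact hs.sub_mid i (h₁ ((Module.supportDim_le_of_injective f hf).trans hdim))
        (h₃ ((Module.supportDim_le_of_surjective g hg).trans hdim))

/-- vanishing above n -/
lemma van_gt (hω : Can R ω n) {L : Type} [AddCommGroup L] [Module R L]
    [Module.Finite R L] (i : ℕ) (hi : n < i) : Subsingleton (EX R i L ω) :=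
  devissage hω (fun _ i => n < i) (fun _ _ h => h.ne') (fun _ _ h => Nat.lt_succ_of_lt h) n L
    (hω.dim ▸ Module.supportDim_le_ringKrullDim R L) i hi

/-- vanishing below the codimension -/
lemma van_lt (hω : Can R ω n) {L : Type} [AddCommGroup L] [Module R L]
    [Module.Finite R L] {d : ℕ} (hd : Module.supportDim R L ≤ (d : WithBot ℕ∞)) (i : ℕ)
    (hi : i + d < n) : Subsingleton (EX R i L ω) :=
  devissage hω (fun d i => i + d < n) (fun _ _ h => by omega) (fun _ _ h => by omega) d L hd i hi

lemma exists_reg_of_van (hω : Can R ω n) {X : Type} [AddCommGroup X] [Module R X]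
    [Module.Finite R X] (h : Subsingleton (EX R n X ω)) :
    ∃ y ∈ maximalIdeal R, IsSMulRegular X y := by
  apply exists_regular
  intro f hf
  have hs : SES f (LinearMap.range f).mkQ := ⟨hf, by intro x; simp, Submodule.mkQ_surjective _⟩
  have h1 := hs.pre_surj (Y := ω) n (van_gt hω _ (Nat.lt_succ_self n))
  have h2 : Subsingleton (EX R n (R ⧸ maximalIdeal R) ω) := h1.subsingleton
  obtain ⟨e⟩ := hω.top
  have h3 : Subsingleton (R ⧸ maximalIdeal R) := e.symm.injective.subsingleton
  exact not_subsingleton _ h3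

/-- depth gives vanishing -/
lemma van_depth (hω : Can R ω n) (t : ℕ) {X : Type} [AddCommGroup X] [Module R X]
    [Module.Finite R X] (h : ∀ j < t, Subsingleton (EX R j (R ⧸ maximalIdeal R) X)) (i : ℕ)
    (hi : n < i + t) : Subsingleton (EX R i X ω) := by
  have := hω.fin
  induction t generalizing X i with
  | zero => exact van_gt hω i hi
  | succ t ih =>
    obtain ⟨y, hy, hr⟩ : ∃ y ∈ maximalIdeal R, IsSMulRegular X y := by
      apply exists_regular
      intro f hf
      have h0 := h 0 (Nat.succ_pos t)
      have : f = 0 := (ext0 _ X).symm.injective (Subsingleton.elim _ _)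
      rw [this] at hf
      have : (1 : R ⧸ maximalIdeal R) = 0 := hf rfl
      exact one_ne_zero this
    have hs := SES.quotSMul y hr
    refine sub_of_regular y hy hs i (ih (fun j hj => ?_) (i + 1) (by omega))
    have h1 := h j (by omega)
    have h2 := h (j + 1) (by omega)
    refine subsingleton_of_forall_eq 0 fun z => ?_
    obtain ⟨w, rfl⟩ := hs.exact3' j z (Subsingleton.elim _ _)
    rw [Subsingleton.elim w 0, map_zero]

/-- modules with Ext into ω concentrated in degree c (codim c Cohen-Macaulay) -/
structure KK (R : Type) [CommRing R] (ω : Type) [AddCommGroup ω] [Module R ω] (c d : ℕ)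
    (X : Type) [AddCommGroup X] [Module R X] : Prop where
  fin : Module.Finite R X
  dim : Module.supportDim R X ≤ (d : WithBot ℕ∞)
  van : ∀ i, i ≠ c → Subsingleton (EX R i X ω)

lemma KK.mk' (hω : Can R ω n) {c d : ℕ} (hcd : c + d = n) {X : Type} [AddCommGroup X] [Module R X]
    [Module.Finite R X] (hdim : Module.supportDim R X ≤ (d : WithBot ℕ∞))
    (h : ∀ i, c < i → Subsingleton (EX R i X ω)) : KK R ω c d X where
  fin := inferInstance
  dim := hdim
  van i hi := by
    rcases lt_or_gt_of_ne hi with h' | h'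
    · exact van_lt hω hdim i (by omega)
    · exact h i h'

lemma KK.of_equiv {c d : ℕ} {X X' : Type} [AddCommGroup X] [Module R X] [AddCommGroup X']
    [Module R X'] (h : KK R ω c d X) (e : X ≃ₗ[R] X') : KK R ω c d X' where
  fin := have := h.fin; Module.Finite.equiv e
  dim := (Module.supportDim_eq_of_equiv e) ▸ h.dim
  van i hi := by
    have := h.van i hi
    exact (preEquiv ω i e).injective.subsingleton

lemma KK.exists_reg (hω : Can R ω n) {c d : ℕ} (hcd : c + (d + 1) = n) {X : Type} [AddCommGroup X]
    [Module R X] (h : KK R ω c (d + 1) X) : ∃ y ∈ maximalIdeal R, IsSMulRegular X y := by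
  have := h.fin
  exact exists_reg_of_van hω (h.van n (by omega))

lemma KK.quot (hω : Can R ω n) {c d : ℕ} (hcd : c + (d + 1) = n) {X : Type} [AddCommGroup X]
    [Module R X] (h : KK R ω c (d + 1) X) {y : R} (hy : y ∈ maximalIdeal R)
    (hr : IsSMulRegular X y) : KK R ω (c + 1) d (QuotSMulTop y X) := by
  have := h.fin
  refine KK.mk' hω (by omega) (dim_quot hy hr h.dim) fun i hi => ?_
  obtain ⟨i, rfl⟩ : ∃ j, i = j + 1 := ⟨i - 1, by omega⟩
  exact (SES.quotSMul y hr).sub_right i (h.van _ (by omega)) (h.van _ (by omega))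

lemma KK.ses (hω : Can R ω n) {c d : ℕ} (hcd : c + (d + 1) = n) {X : Type} [AddCommGroup X]
    [Module R X] (h : KK R ω c (d + 1) X) {y : R} (hy : y ∈ maximalIdeal R)
    (hr : IsSMulRegular X y) :
    SES (y • (LinearMap.id : EX R c X ω →ₗ[R] EX R c X ω)) ((SES.quotSMul y hr).conn ω c) where
  inj := by
    have hq := (h.quot hω hcd hy hr).van c (by omega)
    rw [injective_iff_map_eq_zero]
    intro z hz
    have : pre ω c (y • (LinearMap.id : X →ₗ[R] X)) z = 0 := by rw [pre_smul_id]; exact hz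
    obtain ⟨w, rfl⟩ := ((SES.quotSMul y hr).exact2 c z).mp this
    rw [Subsingleton.elim w 0, map_zero]
  ex := by
    intro z
    rw [(SES.quotSMul y hr).exact1 c z]
    constructor
    · rintro ⟨w, rfl⟩
      exact ⟨w, (pre_smul_id y c w).symm⟩
    · rintro ⟨w, rfl⟩
      exact ⟨w, pre_smul_id y c w⟩
  surj := (SES.quotSMul y hr).conn_surj c (h.van _ (by omega))

lemma dim_EX (hω : Can R ω n) {X : Type} [AddCommGroup X] [Module R X] [Module.Finite R X] (c : ℕ) :
    Module.supportDim R (EX R c X ω) ≤ Module.supportDim R X := by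
  have := hω.fin
  have hle : Module.annihilator R X ≤ Module.annihilator R (EX R c X ω) := by
    intro r hr
    rw [Module.mem_annihilator] at hr ⊢
    intro z
    rw [← pre_smul_id, show r • (LinearMap.id : X →ₗ[R] X) = 0 by ext x; exact hr x, pre_zero]
    rfl
  have hs : Module.support R (EX R c X ω) ⊆ Module.support R X := by
    rw [Module.support_eq_zeroLocus, Module.support_eq_zeroLocus]
    exact PrimeSpectrum.zeroLocus_anti_mono hle
  exact Order.krullDim_le_of_strictMono (fun a => ⟨a.1, hs a.2⟩) (fun {_ _} lt => lt)

/-- duality preserves the class -/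
lemma KK.dual (hω : Can R ω n) {c d : ℕ} (hcd : c + d = n) {X : Type} [AddCommGroup X]
    [Module R X] (h : KK R ω c d X) : KK R ω c d (EX R c X ω) := by
  have := hω.fin
  induction d generalizing c X with
  | zero =>
    have := h.fin
    exact KK.mk' hω hcd ((dim_EX hω c).trans h.dim) fun i hi => van_gt hω i (by omega)
  | succ d ih =>
    have := h.fin
    obtain ⟨y, hy, hr⟩ := h.exists_reg hω hcd
    have h1 := ih (by omega) (h.quot hω hcd hy hr)
    exact KK.mk' hω hcd ((dim_EX hω c).trans h.dim) fun i hi =>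
      sub_of_regular y hy (h.ses hω hcd hy hr) i (h1.van _ (by omega))

end CMD
end

noncomputable section

namespace CMD

open IsLocalRing Pointwise

set_option linter.unusedSectionVars false

section basics
variable {R : Type} [CommRing R]
variable {X X' X'' Y Y' : Type} [AddCommGroup X] [Module R X] [AddCommGroup X'] [Module R X']
  [AddCommGroup X''] [Module R X''] [AddCommGroup Y] [Module R Y] [AddCommGroup Y'] [Module R Y']

/-- cyclic modules -/
def Cyc (R : Type) [CommRing R] (X : Type) [AddCommGroup X] [Module R X] : Prop :=
  ∃ g : X, ∀ z : X, ∃ r : R, r • g = z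

lemma Cyc.of_surj (h : Cyc R X) (f : X →ₗ[R] X') (hf : Function.Surjective f) : Cyc R X' := by
  obtain ⟨g, hg⟩ := h
  refine ⟨f g, fun z => ?_⟩
  obtain ⟨x, rfl⟩ := hf z
  obtain ⟨r, rfl⟩ := hg x
  exact ⟨r, by simp⟩

lemma pre_sum {ι : Type} (s : Finset ι) (i : ℕ) (f : ι → (X →ₗ[R] X')) :
    pre Y i (∑ j ∈ s, f j) = ∑ j ∈ s, pre Y i (f j) := by
  classical
  induction s using Finset.induction_on with
  | empty => simp [pre_zero]
  | insert a s ha ih => rw [Finset.sum_insert ha, Finset.sum_insert ha, pre_add, ih]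

lemma sub_EX_right [Subsingleton Y] (i : ℕ) : Subsingleton (EX R i X Y) := by
  refine subsingleton_of_forall_eq 0 fun z => ?_
  have : post X i (LinearMap.id : Y →ₗ[R] Y) z = post X i ((0 : R) • (LinearMap.id : Y →ₗ[R] Y)) z := by
    congr 2; exact Subsingleton.elim _ _
  rwa [post_id, post_smul, zero_smul] at this

/-- extension of maps -/
lemma SES.extend {f : X →ₗ[R] X'} {g : X' →ₗ[R] X''} (h : SES f g)
    (h3 : Subsingleton (EX R 1 X'' Y)) (φ : X →ₗ[R] Y) : ∃ ψ : X' →ₗ[R] Y, ψ ∘ₗ f = φ := by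
  obtain ⟨w, hw⟩ := h.pre_surj 0 h3 ((ext0 X Y).symm φ)
  refine ⟨ext0 X' Y w, ?_⟩
  rw [← ext0_pre, hw, LinearEquiv.apply_symm_apply]

/-- dual maps -/
def dm (Y : Type) [AddCommGroup Y] [Module R Y] (f : X →ₗ[R] X') :
    (X' →ₗ[R] Y) →ₗ[R] (X →ₗ[R] Y) := LinearMap.lcomp R Y f

@[simp] lemma dm_apply (f : X →ₗ[R] X') (φ : X' →ₗ[R] Y) : dm Y f φ = φ ∘ₗ f := rfl

lemma SES.dual {f : X →ₗ[R] X'} {g : X' →ₗ[R] X''} (h : SES f g)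
    (h3 : Subsingleton (EX R 1 X'' Y)) : SES (dm Y g) (dm Y f) where
  inj := by
    intro a b hab
    ext x
    obtain ⟨x, rfl⟩ := h.surj x
    exact LinearMap.congr_fun hab x
  ex := by
    intro z
    constructor
    · intro hz
      obtain ⟨w, hw⟩ := (h.exact2 (Y := Y) 0 ((ext0 X' Y).symm z)).mp (by
        rw [pre0, show z ∘ₗ f = 0 from hz, map_zero])
      refine ⟨ext0 _ _ w, ?_⟩
      rw [dm_apply, ← ext0_pre, hw, LinearEquiv.apply_symm_apply]
    · rintro ⟨w, rfl⟩
      simp only [dm_apply]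
      rw [LinearMap.comp_assoc, h.ex.linearMap_comp_eq_zero, LinearMap.comp_zero]
  surj := fun φ => h.extend h3 φ

/-- evaluation -/
def ev (Y : Type) [AddCommGroup Y] [Module R Y] (X : Type) [AddCommGroup X] [Module R X] :
    X →ₗ[R] ((X →ₗ[R] Y) →ₗ[R] Y) := LinearMap.flip LinearMap.id

@[simp] lemma ev_apply (x : X) (f : X →ₗ[R] Y) : ev Y X x f = f x := rfl

end basics

variable {R : Type} [CommRing R] [IsNoetherianRing R] [IsLocalRing R]

lemma dim_le_of_ann {X Y : Type} [AddCommGroup X] [Module R X] [Module.Finite R X]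
    [AddCommGroup Y] [Module R Y] [Module.Finite R Y]
    (hle : Module.annihilator R X ≤ Module.annihilator R Y) :
    Module.supportDim R Y ≤ Module.supportDim R X := by
  have hs : Module.support R Y ⊆ Module.support R X := by
    rw [Module.support_eq_zeroLocus, Module.support_eq_zeroLocus]
    exact PrimeSpectrum.zeroLocus_anti_mono hle
  exact Order.krullDim_le_of_strictMono (fun a => ⟨a.1, hs a.2⟩) (fun {_ _} lt => lt)

lemma nakayama_cyc {N : Type} [AddCommGroup N] [Module R N] [Module.Finite R N] (g : N)
    (h : ∀ z : N, ∃ r : R, z - r • g ∈ maximalIdeal R • (⊤ : Submodule R N)) : Cyc R N := by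
  refine ⟨g, fun z => ?_⟩
  have hle : (⊤ : Submodule R N) ≤ Submodule.span R {g} ⊔ maximalIdeal R • (⊤ : Submodule R N) := by
    intro z _
    obtain ⟨r, hr⟩ := h z
    rw [show z = r • g + (z - r • g) by abel]
    exact Submodule.add_mem_sup (Submodule.smul_mem _ _ (Submodule.mem_span_singleton_self g)) hr
  have := Submodule.le_of_le_smul_of_le_jacobson_bot (Module.Finite.fg_top)
    (maximalIdeal_le_jacobson _) hle
  exact Submodule.mem_span_singleton.mp (this (Submodule.mem_top (x := z)))

variable {ω : Type} [AddCommGroup ω] [Module R ω] {n : ℕ}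

section dim0
variable {X X' : Type} [AddCommGroup X] [Module R X] [AddCommGroup X'] [Module R X']
  [Module.Finite R X] [Module.Finite R X']

lemma pre_inj_of_surj (hω : Can R ω n) (f : X →ₗ[R] X') (hf : Function.Surjective f)
    (hd : Module.supportDim R X ≤ ((0 : ℕ) : WithBot ℕ∞)) : Function.Injective (pre ω n f) := by
  have hs := SES.ker f hf
  rcases n with _ | n
  · exact hs.pre0_inj
  · exact hs.pre_inj n (van_lt hω ((Module.supportDim_le_of_injective _ hs.inj).trans hd) n
      (by omega))

lemma pre_surj_of_inj (hω : Can R ω n) (f : X →ₗ[R] X') (hf : Function.Injective f) :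
    Function.Surjective (pre ω n f) := by
  have hs : SES f (LinearMap.range f).mkQ := ⟨hf, by intro x; simp, Submodule.mkQ_surjective _⟩
  exact hs.pre_surj n (van_gt hω _ (Nat.lt_succ_self n))

lemma cyc_zero (hω : Can R ω n) (hX : Cyc R X)
    (hd : Module.supportDim R X ≤ ((0 : ℕ) : WithBot ℕ∞)) : Cyc R (EX R n (EX R n X ω) ω) := by
  classical
  have := hω.fin
  set m := maximalIdeal R with hm
  let F := EX R n (EX R n X ω) ω
  let S : Submodule R X := m • ⊤
  have hs := SES.mkQ S
  -- dual exact sequence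
  have hD : SES (pre ω n S.mkQ) (pre ω n S.subtype) :=
    ⟨pre_inj_of_surj hω _ hs.surj hd, hs.exact2 n, pre_surj_of_inj hω _ hs.inj⟩
  -- residue field
  have hk : Cyc R (EX R n (EX R n (X ⧸ S) ω) ω) := by
    obtain ⟨e⟩ := hω.top
    have h1 : Cyc R (EX R n (EX R n (R ⧸ m) ω) ω) := by
      have e2 : (R ⧸ m) ≃ₗ[R] EX R n (EX R n (R ⧸ m) ω) ω := e.symm ≪≫ₗ preEquiv ω n e
      have : Cyc R (R ⧸ m) := ⟨1, fun z => by
        obtain ⟨r, rfl⟩ := Ideal.Quotient.mk_surjective z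
        exact ⟨r, by rw [← Ideal.Quotient.algebraMap_eq, Algebra.algebraMap_eq_smul_one]⟩⟩
      exact this.of_surj e2.toLinearMap e2.surjective
    obtain ⟨g, hg⟩ := hX
    let q : (R ⧸ m) →ₗ[R] (X ⧸ S) := Submodule.liftQ m (LinearMap.toSpanSingleton R _ (S.mkQ g)) (by
      intro r hr
      rw [LinearMap.mem_ker, LinearMap.toSpanSingleton_apply, ← map_smul, Submodule.mkQ_apply,
        Submodule.Quotient.mk_eq_zero]
      exact Submodule.smul_mem_smul hr trivial)
    have hq : Function.Surjective q := by
      intro z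
      obtain ⟨x, rfl⟩ := S.mkQ_surjective z
      obtain ⟨r, rfl⟩ := hg x
      exact ⟨Submodule.Quotient.mk r, map_smul S.mkQ r g ▸ rfl⟩
    refine h1.of_surj (pre ω n (pre ω n q)) (pre_surj_of_inj hω _ ?_)
    refine pre_inj_of_surj hω _ hq ?_
    letI : Field (R ⧸ m) := Ideal.Quotient.field m
    rw [Module.supportDim_quotient_eq_ringKrullDim]
    exact (ringKrullDim_eq_zero_of_field (R ⧸ m)).le
  -- the image of F(mX)
  have hker : ∀ z : F, pre ω n (pre ω n S.mkQ) z = 0 → z ∈ m • (⊤ : Submodule R F) := by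
    intro z hz
    obtain ⟨w, rfl⟩ := (hD.exact2 n z).mp hz
    obtain ⟨s, hspan⟩ := IsNoetherian.noetherian m
    let φ0 : (s → X) →ₗ[R] X := ∑ i : s, (i : R) • LinearMap.proj i
    have hφ0 : ∀ v, φ0 v ∈ S := by
      intro v
      simp only [φ0, LinearMap.sum_apply, LinearMap.smul_apply, LinearMap.proj_apply]
      refine Submodule.sum_mem _ fun i _ => Submodule.smul_mem_smul ?_ trivial
      rw [← hspan]; exact Submodule.subset_span i.2
    let φ : (s → X) →ₗ[R] S := LinearMap.codRestrict S φ0 hφ0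
    have hφ : Function.Surjective φ := by
      rintro ⟨x, hx⟩
      suffices h : S ≤ LinearMap.range φ0 by
        obtain ⟨v, hv⟩ := h hx
        exact ⟨v, Subtype.ext hv⟩
      have h1 : ∀ r ∈ m, ∀ x : X, r • x ∈ LinearMap.range φ0 := by
        intro r hr x
        rw [← hspan] at hr
        induction hr using Submodule.span_induction with
        | mem r hr =>
          refine ⟨Pi.single ⟨r, hr⟩ x, ?_⟩
          simp only [φ0, LinearMap.sum_apply, LinearMap.smul_apply, LinearMap.proj_apply]
          rw [Finset.sum_eq_single ⟨r, hr⟩]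
          · simp
          · intro b _ hb
            rw [Pi.single_eq_of_ne hb, smul_zero]
          · simp
        | zero => simp
        | add a b _ _ ha hb => rw [add_smul]; exact add_mem ha hb
        | smul a b _ hb => rw [smul_assoc]; exact Submodule.smul_mem _ _ hb
      exact Submodule.smul_le.mpr fun r hr x _ => h1 r hr x
    have hds : Module.supportDim R (s → X) ≤ ((0 : ℕ) : WithBot ℕ∞) := by
      refine le_trans (dim_le_of_ann ?_) hd
      intro r hr
      rw [Module.mem_annihilator] at hr ⊢
      intro v
      ext i
      exact hr (v i)
    obtain ⟨u, rfl⟩ := pre_surj_of_inj hω _ (pre_inj_of_surj hω φ hφ hds) w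
    have hu : u = ∑ i : s, pre ω n (pre ω n (LinearMap.single R (fun _ : s => X) i))
        (pre ω n (pre ω n (LinearMap.proj (R := R) (φ := fun _ : s => X) i)) u) := by
      have hid : (LinearMap.id : (s → X) →ₗ[R] (s → X)) = ∑ i : s,
          (LinearMap.single R (fun _ : s => X) i) ∘ₗ (LinearMap.proj (R := R) (φ := fun _ : s => X) i) := by
        ext j x k
        simp [Pi.single_apply]
      have h2 : pre ω n (pre ω n (LinearMap.id : (s → X) →ₗ[R] (s → X))) u = u := by
        rw [pre_id, pre_id]; rfl
      rw [hid, pre_sum, pre_sum, LinearMap.sum_apply] at h2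
      refine h2.symm.trans (Finset.sum_congr rfl fun i _ => ?_)
      simp only [pre_comp, LinearMap.comp_apply]
    rw [hu]
    simp only [map_sum]
    refine Submodule.sum_mem _ fun i _ => ?_
    generalize (pre ω n (pre ω n (LinearMap.proj (R := R) (φ := fun _ : s => X) i)) u) = v
    have : pre ω n (pre ω n S.subtype) (pre ω n (pre ω n φ) (pre ω n (pre ω n (LinearMap.single R (fun _ : s => X) i)) v)) = (i : R) • v := by
      have h3 : S.subtype ∘ₗ φ ∘ₗ (LinearMap.single R (fun _ : s => X) i) = (i : R) • LinearMap.id := by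
        ext x
        simp only [φ, φ0, LinearMap.comp_apply, LinearMap.sum_apply, LinearMap.smul_apply,
          LinearMap.proj_apply, Submodule.subtype_apply, LinearMap.codRestrict_apply]
        rw [Finset.sum_eq_single i]
        · simp
        · intro b _ hb
          simp [Pi.single_eq_of_ne hb]
        · simp
      simp only [← LinearMap.comp_apply, ← pre_comp]
      rw [h3, pre_smul, pre_id, pre_smul, pre_id]; rfl
    rw [this]
    refine Submodule.smul_mem_smul ?_ trivial
    rw [← hspan]; exact Submodule.subset_span i.2
  obtain ⟨g, hg⟩ := hk
  obtain ⟨g, rfl⟩ := pre_surj_of_inj hω _ hD.inj g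
  refine nakayama_cyc g fun z => ?_
  obtain ⟨r, hr⟩ := hg (pre ω n (pre ω n S.mkQ) z)
  exact ⟨r, hker _ (by rw [map_sub, map_smul, hr, sub_self])⟩

end dim0

end CMD
end

noncomputable section

namespace CMD

open IsLocalRing Pointwise

set_option linter.unusedSectionVars false

variable {R : Type} [CommRing R] [IsNoetherianRing R] [IsLocalRing R]
variable {ω : Type} [AddCommGroup ω] [Module R ω] {n : ℕ}

lemma cyc (hω : Can R ω n) {c d : ℕ} (hcd : c + d = n) {X : Type} [AddCommGroup X]
    [Module R X] (hX : Cyc R X) (h : KK R ω c d X) : Cyc R (EX R c (EX R c X ω) ω) := by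
  have := hω.fin
  induction d generalizing c X with
  | zero =>
    obtain rfl : c = n := by omega
    have := h.fin
    exact cyc_zero hω hX h.dim
  | succ d ih =>
    have := h.fin
    obtain ⟨y, hy, hr⟩ := h.exists_reg hω hcd
    have hq := h.quot hω hcd hy hr
    have s1 := h.ses hω hcd hy hr
    obtain ⟨g, hg⟩ := ih (by omega) (hX.of_surj _ (SES.quotSMul y hr).surj) hq
    have hsurj := s1.conn_surj (Y := ω) c ((h.dual hω hcd).van _ (by omega))
    obtain ⟨g, rfl⟩ := hsurj g
    refine nakayama_cyc g fun z => ?_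
    obtain ⟨r, hr'⟩ := hg (s1.conn ω c z)
    refine ⟨r, ?_⟩
    obtain ⟨w, hw⟩ := (s1.exact1 c (z - r • g)).mp (by rw [map_sub, map_smul, hr', sub_self])
    rw [← hw, pre_smul_id]
    exact Submodule.smul_mem_smul hy trivial

/-- all Ext modules zero implies zero -/
lemma all_zero (hω : Can R ω n) (d : ℕ) {L : Type} [AddCommGroup L] [Module R L]
    [hL : Module.Finite R L] (hd : Module.supportDim R L ≤ (d : WithBot ℕ∞))
    (h : ∀ i, Subsingleton (EX R i L ω)) : Subsingleton L := by
  have := hω.fin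
  induction d generalizing L with
  | zero =>
    obtain ⟨y, hy, hr⟩ := exists_reg_of_van hω (h n)
    exact dim_zero_not hy hr hd
  | succ d ih =>
    obtain ⟨y, hy, hr⟩ := exists_reg_of_van hω (h n)
    have hq : Subsingleton (QuotSMulTop y L) := by
      refine ih (dim_quot hy hr hd) fun i => ?_
      rcases i with _ | i
      · have := h 0
        exact (SES.quotSMul y hr).pre0_inj.subsingleton
      · exact (SES.quotSMul y hr).sub_right i (h _) (h _)
    refine nakayama_sub y hy fun z => ?_
    obtain ⟨w, hw⟩ := ((SES.quotSMul y hr).ex z).mp (Subsingleton.elim _ _)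
    exact ⟨w, hw⟩

lemma dim_le_n (hω : Can R ω n) (X : Type) [AddCommGroup X] [Module R X] [Module.Finite R X] :
    Module.supportDim R X ≤ (n : WithBot ℕ∞) :=
  hω.dim ▸ Module.supportDim_le_ringKrullDim R X

lemma KK.of_proj (hω : Can R ω n) (P : Type) [AddCommGroup P] [Module R P] [Module.Finite R P]
    [Module.Projective R P] : KK R ω 0 n P where
  fin := inferInstance
  dim := dim_le_n hω P
  van i hi := by
    obtain ⟨j, rfl⟩ : ∃ j, i = j + 1 := ⟨i - 1, by omega⟩
    exact sub_of_projective j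

lemma KK.dual0 (hω : Can R ω n) {X : Type} [AddCommGroup X]
    [Module R X] (h : KK R ω 0 n X) : KK R ω 0 n (X →ₗ[R] ω) :=
  (h.dual hω (by omega)).of_equiv (ext0 X ω)

lemma KK.omega (hω : Can R ω n) : KK R ω 0 n ω :=
  ((KK.of_proj hω R).dual0 hω).of_equiv (LinearMap.ringLmapEquivSelf R R ω)

lemma end_cyc (hω : Can R ω n) : Cyc R (ω →ₗ[R] ω) := by
  have h1 := cyc hω (by omega) (c := 0) (d := n) (X := R)
    ⟨1, fun z => ⟨z, by simp⟩⟩ (KK.of_proj hω R)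
  let e : EX R 0 (EX R 0 R ω) ω ≃ₗ[R] (ω →ₗ[R] ω) :=
    preEquiv ω 0 (ext0 R ω ≪≫ₗ LinearMap.ringLmapEquivSelf R R ω).symm ≪≫ₗ ext0 ω ω
  exact h1.of_surj e.toLinearMap e.surjective

lemma omega_nontrivial (hω : Can R ω n) : ¬ Subsingleton ω := by
  intro h
  obtain ⟨e⟩ := hω.top
  have : Subsingleton (EX R n (R ⧸ maximalIdeal R) ω) := sub_EX_right n
  have : Subsingleton (R ⧸ maximalIdeal R) := e.symm.injective.subsingleton
  exact (Ideal.Quotient.subsingleton_iff.mp this ▸ (maximalIdeal.isMaximal R).ne_top) rfl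

lemma end_scalar (hω : Can R ω n) (f : ω →ₗ[R] ω) : ∃ r : R, r • LinearMap.id = f := by
  have := hω.fin
  obtain ⟨g, hg⟩ := end_cyc hω
  obtain ⟨r, hr⟩ := hg LinearMap.id
  have hu : IsUnit r := by
    by_contra hr'
    refine omega_nontrivial hω (nakayama_sub r ((mem_maximalIdeal r).mpr hr') fun z => ⟨g z, ?_⟩)
    exact LinearMap.congr_fun hr z
  obtain ⟨s, hs⟩ := hg f
  obtain ⟨u, rfl⟩ := hu
  refine ⟨s * (↑u⁻¹ : R), ?_⟩
  rw [← hr, smul_smul, mul_assoc, Units.inv_mul, mul_one, hs]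

lemma ann_zero (hω : Can R ω n) (r : R) (hr : ∀ x : ω, r • x = 0) : r = 0 := by
  have := hω.fin
  let g : R →ₗ[R] (ω →ₗ[R] ω) := LinearMap.toSpanSingleton R _ LinearMap.id
  have hg : Function.Surjective g := fun f => end_scalar hω f
  have hs := SES.ker g hg
  have hE := (KK.omega hω).dual0 hω
  have hR := KK.of_proj hω R
  have : Subsingleton (LinearMap.ker g) := by
    refine all_zero hω n (dim_le_n hω _) fun i => ?_
    rcases i with _ | i
    · refine subsingleton_of_forall_eq 0 fun z => ?_
      obtain ⟨w, rfl⟩ := hs.pre_surj 0 (hE.van 1 (by omega)) z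
      apply (ext0 _ _).injective
      rw [ext0_pre, map_zero]
      ext ⟨x, hx⟩
      have hx' : ∀ v : ω, x • v = 0 := fun v => LinearMap.congr_fun (LinearMap.mem_ker.mp hx) v
      simp only [LinearMap.comp_apply, Submodule.subtype_apply, LinearMap.zero_apply]
      rw [show x = x • (1 : R) by simp, map_smul, hx']
    · exact hs.sub_left _ (hR.van _ (by omega)) (hE.van _ (by omega))
  have hm : r ∈ LinearMap.ker g := by
    rw [LinearMap.mem_ker]
    ext x
    exact hr x
  exact congrArg Subtype.val (Subsingleton.elim (⟨r, hm⟩ : LinearMap.ker g) 0)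

/-- reflexivity of free modules -/
lemma ev_free (hω : Can R ω n) (m : ℕ) : Function.Bijective (ev (R := R) ω (Fin m → R)) := by
  constructor
  · rw [injective_iff_map_eq_zero]
    intro v hv
    ext i
    refine ann_zero hω _ fun x => ?_
    exact LinearMap.congr_fun hv ((LinearMap.toSpanSingleton R ω x) ∘ₗ LinearMap.proj i)
  · intro φ
    have h1 : ∀ i : Fin m, ∃ r : R, ∀ x : ω,
        r • x = φ ((LinearMap.toSpanSingleton R ω x) ∘ₗ LinearMap.proj i) := by
      intro i
      let f : ω →ₗ[R] ω :=
        { toFun := fun x => φ ((LinearMap.toSpanSingleton R ω x) ∘ₗ LinearMap.proj i)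
          map_add' := fun a b => by
            rw [← map_add]; congr 1; ext; simp
          map_smul' := fun a b => by
            rw [← map_smul]; congr 1; ext; simp; exact smul_comm _ _ _ }
      obtain ⟨r, hr⟩ := end_scalar hω f
      exact ⟨r, fun x => LinearMap.congr_fun hr x⟩
    choose v hv using h1
    refine ⟨v, ?_⟩
    ext ψ
    have hψ : ψ = ∑ i, (LinearMap.toSpanSingleton R ω (ψ (Pi.single i 1))) ∘ₗ
        LinearMap.proj (R := R) (φ := fun _ : Fin m => R) i := by
      ext j
      simp [Pi.single_apply]
    rw [hψ, map_sum, map_sum]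
    refine Finset.sum_congr rfl fun i _ => ?_
    rw [← hv]
    simp

lemma ev_nat {X X' : Type} [AddCommGroup X] [Module R X] [AddCommGroup X'] [Module R X']
    (f : X →ₗ[R] X') (x : X) : ev ω X' (f x) = dm ω (dm ω f) (ev ω X x) := by
  ext φ; simp

/-- free cover -/
lemma exists_cover (X : Type) [AddCommGroup X] [Module R X] [Module.Finite R X] :
    ∃ (m : ℕ) (g : (Fin m → R) →ₗ[R] X), Function.Surjective g := by
  obtain ⟨m, g, hg⟩ := Module.Finite.exists_fin' R X
  exact ⟨m, g, hg⟩

/-- reflexivity -/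
lemma ev_bij (hω : Can R ω n) {X : Type} [AddCommGroup X] [Module R X] (h : KK R ω 0 n X) :
    Function.Bijective (ev (R := R) ω X) := by
  have := h.fin
  have aux : ∀ {X : Type} [AddCommGroup X] [Module R X], KK R ω 0 n X →
      ∃ (m : ℕ) (g : (Fin m → R) →ₗ[R] X), Function.Surjective g ∧ KK R ω 0 n (LinearMap.ker g) := by
    intro X _ _ h
    have := h.fin
    obtain ⟨m, g, hg⟩ := exists_cover (R := R) X
    refine ⟨m, g, hg, KK.mk' hω (by omega) (dim_le_n hω _) fun i hi => ?_⟩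
    exact (SES.ker g hg).sub_left _ ((KK.of_proj hω _).van _ (by omega)) (h.van _ (by omega))
  have surj : ∀ {X : Type} [AddCommGroup X] [Module R X], KK R ω 0 n X →
      Function.Surjective (ev (R := R) ω X) := by
    intro X _ _ h φ
    obtain ⟨m, g, hg, hk⟩ := aux h
    have hd := (SES.ker g hg).dual (h.van 1 (by omega))
    obtain ⟨ψ, rfl⟩ := hd.extend ((hk.dual0 hω).van 1 (by omega)) φ
    obtain ⟨v, rfl⟩ := (ev_free hω m).2 ψ
    exact ⟨g v, by ext f; simp⟩
  refine ⟨?_, surj h⟩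
  rw [injective_iff_map_eq_zero]
  intro x hx
  obtain ⟨m, g, hg, hk⟩ := aux h
  obtain ⟨v, rfl⟩ := hg x
  have hd := (SES.ker g hg).dual (Y := ω) (h.van 1 (by omega))
  have hdd := hd.dual (Y := ω) ((hk.dual0 hω).van 1 (by omega))
  obtain ⟨b, hb⟩ := (hdd.ex (ev ω _ v)).mp (by rw [← ev_nat]; exact hx)
  obtain ⟨b, rfl⟩ := surj hk b
  rw [← ev_nat] at hb
  have := (ev_free hω m).1 hb
  rw [← this]
  exact b.2

end CMD
end

noncomputable section

namespace CMD

open IsLocalRing Pointwise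

set_option linter.unusedSectionVars false

section basics
variable {R : Type} [CommRing R]
variable {A B C : Type} [AddCommGroup A] [Module R A] [AddCommGroup B] [Module R B]
  [AddCommGroup C] [Module R C]

lemma equiv_of_surj (f : A →ₗ[R] B) (g : A →ₗ[R] C) (hf : Function.Surjective f)
    (hg : Function.Surjective g) (hk : ∀ a, f a = 0 ↔ g a = 0) : Nonempty (B ≃ₗ[R] C) := by
  have hker : LinearMap.ker f = LinearMap.ker g := by
    ext a
    exact hk a
  exact ⟨(f.quotKerEquivOfSurjective hf).symm ≪≫ₗ Submodule.quotEquivOfEq _ _ hker ≪≫ₗ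
    (g.quotKerEquivOfSurjective hg)⟩

lemma conn_equiv {f : A →ₗ[R] B} {g : B →ₗ[R] C} (h : SES f g) (Y : Type) [AddCommGroup Y]
    [Module R Y] (i : ℕ)
    (h1 : Subsingleton (EX R i B Y)) (h2 : Subsingleton (EX R (i + 1) B Y)) :
    Nonempty (EX R i A Y ≃ₗ[R] EX R (i + 1) C Y) :=
  ⟨LinearEquiv.ofBijective (h.conn Y i) ⟨h.conn_inj i h1, h.conn_surj i h2⟩⟩

lemma SES.dual_ex {f : A →ₗ[R] B} {g : B →ₗ[R] C} (h : SES f g) (Y : Type) [AddCommGroup Y]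
    [Module R Y] : Function.Exact (dm Y g) (dm Y f) := by
  intro z
  constructor
  · intro hz
    obtain ⟨w, hw⟩ := (h.exact2 (Y := Y) 0 ((ext0 B Y).symm z)).mp (by
      rw [pre0, show z ∘ₗ f = 0 from hz, map_zero])
    refine ⟨ext0 _ _ w, ?_⟩
    rw [dm_apply, ← ext0_pre, hw, LinearEquiv.apply_symm_apply]
  · rintro ⟨w, rfl⟩
    simp only [dm_apply]
    rw [LinearMap.comp_assoc, h.ex.linearMap_comp_eq_zero, LinearMap.comp_zero]

lemma dm_inj {g : B →ₗ[R] C} (hg : Function.Surjective g) (Y : Type) [AddCommGroup Y]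
    [Module R Y] : Function.Injective (dm Y g) := by
  intro a b hab
  ext x
  obtain ⟨x, rfl⟩ := hg x
  exact LinearMap.congr_fun hab x

/-- connecting map from the dual -/
def del {f : A →ₗ[R] B} {g : B →ₗ[R] C} (h : SES f g) (Y : Type) [AddCommGroup Y]
    [Module R Y] : (A →ₗ[R] Y) →ₗ[R] EX R 1 C Y := h.conn Y 0 ∘ₗ (ext0 A Y).symm.toLinearMap

lemma del_ex {f : A →ₗ[R] B} {g : B →ₗ[R] C} (h : SES f g) (Y : Type) [AddCommGroup Y]
    [Module R Y] : Function.Exact (dm Y f) (del h Y) := by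
  intro z
  constructor
  · intro hz
    obtain ⟨w, hw⟩ := (h.exact1 (Y := Y) 0 _).mp hz
    refine ⟨ext0 _ _ w, ?_⟩
    rw [dm_apply, ← ext0_pre, hw]
    exact LinearEquiv.apply_symm_apply _ _
  · rintro ⟨w, rfl⟩
    refine (h.exact1 (Y := Y) 0 _).mpr ⟨(ext0 _ _).symm w, ?_⟩
    rw [pre0]
    rfl

lemma del_surj {f : A →ₗ[R] B} {g : B →ₗ[R] C} (h : SES f g) (Y : Type) [AddCommGroup Y]
    [Module R Y] (h1 : Subsingleton (EX R 1 B Y)) : Function.Surjective (del h Y) := by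
  intro z
  obtain ⟨w, rfl⟩ := h.conn_surj 0 h1 z
  refine ⟨ext0 _ _ w, ?_⟩
  rw [del, LinearMap.comp_apply, LinearEquiv.coe_coe, LinearEquiv.symm_apply_apply]

end basics

variable {R : Type} [CommRing R] [IsNoetherianRing R] [IsLocalRing R]
variable {ω : Type} [AddCommGroup ω] [Module R ω] {n : ℕ}

structure TT (R : Type) [CommRing R] (ω : Type) [AddCommGroup ω] [Module R ω] (X N : Type)
    [AddCommGroup X] [Module R X] [AddCommGroup N] [Module R N] (m : ℕ) : Prop where
  ker : Nonempty (LinearMap.ker (ev (R := R) ω X) ≃ₗ[R] EX R m N ω)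
  coker : Nonempty ((((X →ₗ[R] ω) →ₗ[R] ω) ⧸ LinearMap.range (ev (R := R) ω X)) ≃ₗ[R]
    EX R (m + 1) N ω)
  ext : ∀ i, Nonempty (EX R (i + 1) (X →ₗ[R] ω) ω ≃ₗ[R] EX R (i + 1 + m + 1) N ω)

section step
variable {X' X B : Type} [AddCommGroup X] [Module R X] [AddCommGroup X'] [Module R X']
  [AddCommGroup B] [Module R B] {k : ℕ} {ι : X' →ₗ[R] (Fin k → R)} {g : (Fin k → R) →ₗ[R] X}
  {π : ((Fin k → R) →ₗ[R] ω) →ₗ[R] B}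

lemma step_ext (hω : Can R ω n) (s : SES (dm ω g) π) (i : ℕ) :
    Nonempty (EX R (i + 1) (X →ₗ[R] ω) ω ≃ₗ[R] EX R (i + 2) B ω) := by
  have hP := (KK.of_proj hω (Fin k → R)).dual0 hω
  exact conn_equiv s ω (i + 1) (hP.van _ (by omega)) (hP.van _ (by omega))

lemma step_coker (hω : Can R ω n) (h : SES ι g) (s : SES (dm ω g) π) :
    Nonempty ((((X →ₗ[R] ω) →ₗ[R] ω) ⧸ LinearMap.range (ev (R := R) ω X)) ≃ₗ[R]
    EX R 1 B ω) := by
  have hP := (KK.of_proj hω (Fin k → R)).dual0 hω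
  refine equiv_of_surj (Submodule.mkQ _) (del s ω) (Submodule.mkQ_surjective _)
    (del_surj s ω (hP.van _ (by omega))) fun a => ?_
  rw [del_ex s ω a, Submodule.mkQ_apply, Submodule.Quotient.mk_eq_zero]
  constructor
  · rintro ⟨x, rfl⟩
    obtain ⟨v, rfl⟩ := h.surj x
    exact ⟨ev ω _ v, (ev_nat g v).symm⟩
  · rintro ⟨w, rfl⟩
    obtain ⟨v, rfl⟩ := (ev_free hω k).2 w
    exact ⟨g v, ev_nat g v⟩

lemma step_ker (hω : Can R ω n) (h : SES ι g) (s : SES (dm ω g) π) {C : Type} [AddCommGroup C]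
    [Module R C] (θ : (B →ₗ[R] ω) →ₗ[R] C) (hθ : Function.Surjective θ)
    (hk : ∀ b, θ b = 0 ↔ ∃ x', dm ω (dm ω ι) (ev ω X' x') = dm ω π b) :
    Nonempty (LinearMap.ker (ev (R := R) ω X) ≃ₗ[R] C) := by
  let e := LinearEquiv.ofBijective _ (ev_free (R := R) hω k)
  have he : ∀ v, e v = ev ω _ v := fun v => rfl
  let κ0 : (B →ₗ[R] ω) →ₗ[R] X := g ∘ₗ e.symm.toLinearMap ∘ₗ dm ω π
  have hκ0 : ∀ b, κ0 b ∈ LinearMap.ker (ev (R := R) ω X) := by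
    intro b
    rw [LinearMap.mem_ker]
    change ev ω X (g (e.symm (dm ω π b))) = 0
    rw [ev_nat, ← he, LinearEquiv.apply_symm_apply]
    exact (s.dual_ex ω _).mpr ⟨b, rfl⟩
  let κ := LinearMap.codRestrict _ κ0 hκ0
  refine equiv_of_surj κ θ ?_ hθ ?_
  · rintro ⟨x, hx⟩
    obtain ⟨v, rfl⟩ := h.surj x
    rw [LinearMap.mem_ker, ev_nat] at hx
    obtain ⟨b, hb⟩ := (s.dual_ex ω _).mp hx
    refine ⟨b, Subtype.ext ?_⟩
    change g (e.symm (dm ω π b)) = g v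
    rw [hb, ← he, LinearEquiv.symm_apply_apply]
  · intro b
    rw [hk b]
    have : κ b = 0 ↔ g (e.symm (dm ω π b)) = 0 :=
      ⟨fun h => congrArg Subtype.val h, fun h => Subtype.ext h⟩
    rw [this, h.ex]
    refine exists_congr fun x' => ?_
    rw [← ev_nat, LinearEquiv.eq_symm_apply]
    exact Iff.rfl

end step

lemma TT_all (hω : Can R ω n) (m : ℕ) {X : Type} [AddCommGroup X] [Module R X] [Module.Finite R X]
    (h : ∀ i, i ≠ 0 → i ≠ m + 1 → Subsingleton (EX R i X ω)) :
    TT R ω X (EX R (m + 1) X ω) (m + 1) := by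
  have := hω.fin
  induction m generalizing X with
  | zero =>
    obtain ⟨k, g, hg⟩ := exists_cover (R := R) X
    have hs := SES.ker g hg
    have hP := KK.of_proj hω (Fin k → R)
    have hX' : KK R ω 0 n (LinearMap.ker g) := KK.mk' hω (by omega) (dim_le_n hω _) fun i hi =>
      hs.sub_left _ (hP.van _ (by omega)) (h _ (by omega) (by omega))
    have hD := hX'.dual0 hω
    let ι := (LinearMap.ker g).subtype
    let π := (dm ω ι).rangeRestrict
    have s1 : SES (dm ω g) π := by
      refine ⟨dm_inj hg ω, fun z => ?_, LinearMap.surjective_rangeRestrict _⟩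
      rw [← hs.dual_ex ω z]
      exact ⟨fun h => congrArg Subtype.val h, fun h => Subtype.ext h⟩
    have s2 : SES (LinearMap.range (dm ω ι)).subtype (del hs ω) := by
      refine ⟨Subtype.val_injective, fun z => ?_, del_surj hs ω (hP.van _ (by omega))⟩
      rw [del_ex hs ω z]
      simp [ι]
    have e2 : ∀ i, Nonempty (EX R (i + 1) (LinearMap.range (dm ω ι)) ω ≃ₗ[R]
        EX R (i + 2) (EX R 1 X ω) ω) := fun i =>
      conn_equiv s2 ω (i + 1) (hD.van _ (by omega)) (hD.van _ (by omega))
    refine ⟨?_, ?_, fun i => ?_⟩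
    · refine step_ker hω hs s1 (del s2 ω) (del_surj s2 ω (hD.van _ (by omega))) fun b => ?_
      rw [del_ex s2 ω b]
      constructor
      · rintro ⟨w, rfl⟩
        obtain ⟨x', rfl⟩ := (ev_bij hω hX').2 w
        exact ⟨x', rfl⟩
      · rintro ⟨x', hx'⟩
        exact ⟨ev ω _ x', dm_inj s1.surj ω hx'⟩
    · obtain ⟨e1⟩ := step_coker hω hs s1
      obtain ⟨e2⟩ := e2 0
      exact ⟨e1 ≪≫ₗ e2⟩
    · obtain ⟨e1⟩ := step_ext hω s1 i
      obtain ⟨e2⟩ := e2 (i + 1)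
      exact ⟨e1 ≪≫ₗ e2⟩
  | succ m ih =>
    obtain ⟨k, g, hg⟩ := exists_cover (R := R) X
    have hs := SES.ker g hg
    have hP := KK.of_proj hω (Fin k → R)
    have hT := ih (X := LinearMap.ker g) fun i hi hi' =>
      hs.sub_left _ (hP.van _ (by omega)) (h _ (by omega) (by omega))
    obtain ⟨e⟩ := conn_equiv hs ω (m + 1) (hP.van _ (by omega)) (hP.van _ (by omega))
    have s1 := hs.dual (Y := ω) (h _ (by omega) (by omega))
    refine ⟨?_, ?_, fun i => ?_⟩
    · obtain ⟨e1⟩ := step_ker hω hs s1 (Submodule.mkQ _) (Submodule.mkQ_surjective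
          (LinearMap.range (ev (R := R) ω (LinearMap.ker g)))) (fun b => by
        rw [Submodule.mkQ_apply, Submodule.Quotient.mk_eq_zero]
        refine exists_congr fun x' => ?_
        exact (dm_inj s1.surj ω).eq_iff.symm)
      obtain ⟨e2⟩ := hT.coker
      exact ⟨e1 ≪≫ₗ e2 ≪≫ₗ preEquiv ω _ e.symm⟩
    · obtain ⟨e1⟩ := step_coker hω hs s1
      obtain ⟨e2⟩ := hT.ext 0
      have e3 := e1 ≪≫ₗ e2 ≪≫ₗ preEquiv ω _ e.symm
      rw [show 0 + 1 + (m + 1) + 1 = m + 1 + 1 + 1 by omega] at e3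
      exact ⟨e3⟩
    · obtain ⟨e1⟩ := step_ext hω s1 i
      obtain ⟨e2⟩ := hT.ext (i + 1)
      have e3 := e1 ≪≫ₗ e2 ≪≫ₗ preEquiv ω _ e.symm
      rw [show i + 1 + 1 + (m + 1) + 1 = i + 1 + (m + 1 + 1) + 1 by omega] at e3
      exact ⟨e3⟩

/-- biduality, abstract form -/
lemma KK.bidual (hω : Can R ω n) {c d : ℕ} {X : Type} [AddCommGroup X]
    [Module R X] (hcd : c + d = n) (h : KK R ω c d X) :
    Nonempty (X ≃ₗ[R] EX R c (EX R c X ω) ω) := by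
  have := h.fin
  rcases c with _ | c
  · obtain rfl : d = n := by omega
    exact ⟨LinearEquiv.ofBijective _ (ev_bij hω h) ≪≫ₗ
      ((preEquiv ω 0 (ext0 X ω).symm) ≪≫ₗ ext0 _ ω).symm⟩
  · obtain ⟨e⟩ := (TT_all hω c (X := X) fun i _ hi => h.van _ hi).ker
    have h0 := h.van 0 (by omega)
    have hz : LinearMap.ker (ev (R := R) ω X) = ⊤ := by
      rw [eq_top_iff]
      intro x _
      rw [LinearMap.mem_ker]
      ext φ
      have : φ = 0 := (ext0 X ω).symm.injective (Subsingleton.elim _ _)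
      rw [this]; rfl
    exact ⟨(LinearEquiv.ofTop _ hz).symm ≪≫ₗ e⟩

end CMD
end

noncomputable section

namespace CMD

open IsLocalRing Pointwise

set_option linter.unusedSectionVars false

section basics
variable {R : Type} [CommRing R]
variable {A B C Z : Type} [AddCommGroup A] [Module R A] [AddCommGroup B] [Module R B]
  [AddCommGroup C] [Module R C] [AddCommGroup Z] [Module R Z]

lemma post_add (i : ℕ) (f g : A →ₗ[R] B) : post Z i (f + g) = post Z i f + post Z i g := by
  ext z
  rw [post_apply]
  change z.comp (Abelian.Ext.mk₀ (ModuleCat.ofHom f + ModuleCat.ofHom g)) _ = _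
  rw [Abelian.Ext.mk₀_add, Abelian.Ext.comp_add]; rfl

lemma post_sum {ι : Type} (s : Finset ι) (i : ℕ) (f : ι → (A →ₗ[R] B)) :
    post Z i (∑ j ∈ s, f j) = ∑ j ∈ s, post Z i (f j) := by
  classical
  induction s using Finset.induction_on with
  | empty =>
    rw [Finset.sum_empty, Finset.sum_empty, show (0 : A →ₗ[R] B) = (0 : R) • 0 by simp, post_smul,
      zero_smul]
  | insert a s ha ih => rw [Finset.sum_insert ha, Finset.sum_insert ha, post_add, ih]

/-- lifting of maps -/
lemma SES.lift {f : A →ₗ[R] B} {g : B →ₗ[R] C} (h : SES f g) (h1 : Subsingleton (EX R 1 Z A))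
    (φ : Z →ₗ[R] C) : ∃ ψ : Z →ₗ[R] B, g ∘ₗ ψ = φ := by
  obtain ⟨w, hw⟩ := h.exact3' 0 ((ext0 Z C).symm φ) (h1.elim _ _)
  obtain ⟨w, rfl⟩ := (ext0 Z B).symm.surjective w
  rw [post0] at hw
  exact ⟨w, (ext0 Z C).symm.injective hw⟩

lemma SES.sub_right' {f : A →ₗ[R] B} {g : B →ₗ[R] C} (h : SES f g) (i : ℕ)
    (h1 : Subsingleton (EX R i Z B)) (h2 : Subsingleton (EX R (i + 1) Z A)) :
    Subsingleton (EX R i Z C) := by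
  refine subsingleton_of_forall_eq 0 fun z => ?_
  obtain ⟨w, rfl⟩ := h.exact3' i z (h2.elim _ _)
  rw [h1.elim w 0, map_zero]

lemma sub_post_free {ω : Type} [AddCommGroup ω] [Module R ω] (i k : ℕ)
    (h : Subsingleton (EX R i Z ω)) : Subsingleton (EX R i Z ((Fin k → R) →ₗ[R] ω)) := by
  refine subsingleton_of_forall_eq 0 fun z => ?_
  let p : Fin k → (((Fin k → R) →ₗ[R] ω) →ₗ[R] ω) := fun j => ev ω _ (Pi.single j 1)
  let q : Fin k → (ω →ₗ[R] ((Fin k → R) →ₗ[R] ω)) := fun j =>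
    (dm ω (LinearMap.proj (R := R) (φ := fun _ : Fin k => R) j)) ∘ₗ
      (LinearMap.ringLmapEquivSelf R R ω).symm.toLinearMap
  have hid : (LinearMap.id : ((Fin k → R) →ₗ[R] ω) →ₗ[R] _) = ∑ j, (q j) ∘ₗ (p j) := by
    ext f j
    simp [p, q, Pi.single_apply]
  have h1 : post Z i (LinearMap.id : ((Fin k → R) →ₗ[R] ω) →ₗ[R] _) z = z := by
    rw [post_id]; rfl
  rw [← h1, hid, post_sum, LinearMap.sum_apply]
  refine Finset.sum_eq_zero fun j _ => ?_
  rw [post_comp, LinearMap.comp_apply, h.elim (post Z i (p j) z) 0, map_zero]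

end basics

variable {R : Type} [CommRing R] [IsNoetherianRing R] [IsLocalRing R]
variable {ω : Type} [AddCommGroup ω] [Module R ω] {n : ℕ}

/-- maps of duals into a reflexive module's dual come from maps -/
lemma of_dual (hω : Can R ω n) {N M : Type} [AddCommGroup M] [Module R M] [AddCommGroup N]
    [Module R N] (hM : KK R ω 0 n M) (χ : (M →ₗ[R] ω) →ₗ[R] (N →ₗ[R] ω)) :
    ∃ β : N →ₗ[R] M, ∀ f : M →ₗ[R] ω, f ∘ₗ β = χ f := by
  let e := LinearEquiv.ofBijective _ (ev_bij hω hM)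
  refine ⟨e.symm.toLinearMap ∘ₗ dm ω χ ∘ₗ ev ω N, fun f => ?_⟩
  ext x
  have : ev ω M (e.symm (dm ω χ (ev ω N x))) = dm ω χ (ev ω N x) := e.apply_symm_apply _
  exact LinearMap.congr_fun this f

def HZ (R : Type) [CommRing R] (ω : Type) [AddCommGroup ω] [Module R ω] (n : ℕ) (W : Type)
    [AddCommGroup W] [Module R W] : Prop :=
  ∀ (Z : Type) [AddCommGroup Z] [Module R Z], KK R ω 0 n Z → ∀ i, Subsingleton (EX R (i + 1) Z W)

lemma S_core (hω : Can R ω n) {M M' N N' : Type} [AddCommGroup M] [Module R M] [AddCommGroup N]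
    [Module R N] [AddCommGroup M'] [Module R M'] [AddCommGroup N'] [Module R N'] {k l : ℕ}
    {ιM : M' →ₗ[R] (Fin k → R)} {gM : (Fin k → R) →ₗ[R] M} (hM : SES ιM gM)
    {ιN : N' →ₗ[R] (Fin l → R)} {gN : (Fin l → R) →ₗ[R] N} (hN : SES ιN gN)
    (hz : HZ R ω n (N →ₗ[R] ω)) (c : ℕ) (φ : EX R (c + 1) M ω →ₗ[R] EX R (c + 1) N ω)
    (α' : N' →ₗ[R] M') (h1 : ∀ z, hN.conn ω c (pre ω c α' z) = φ (hM.conn ω c z))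
    (h2 : ∀ z, del hN ω (dm ω α' (dm ω ιM z)) = 0) : ∃ α : N →ₗ[R] M, pre ω (c + 1) α = φ := by
  have hF := KK.of_proj hω (Fin k → R)
  let π := (dm ω ιN).rangeRestrict
  have s1 : SES (dm ω gN) π := by
    refine ⟨dm_inj hN.surj ω, fun z => ?_, LinearMap.surjective_rangeRestrict _⟩
    rw [← hN.dual_ex ω z]
    exact ⟨fun h => congrArg Subtype.val h, fun h => Subtype.ext h⟩
  let γ : ((Fin k → R) →ₗ[R] ω) →ₗ[R] LinearMap.range (dm ω ιN) :=
    LinearMap.codRestrict _ (dm ω α' ∘ₗ dm ω ιM) fun z => (del_ex hN ω _).mp (h2 z)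
  obtain ⟨χ, hχ⟩ := s1.lift (hz _ (hF.dual0 hω) 0) γ
  obtain ⟨β, hβ⟩ := of_dual hω hF χ
  have hcomm : β ∘ₗ ιN = ιM ∘ₗ α' := by
    ext1 x
    apply (ev_bij hω hF).1
    ext1 f
    have h3 := LinearMap.congr_fun (hβ f) (ιN x)
    have h4 := LinearMap.congr_fun (congrArg Subtype.val (LinearMap.congr_fun hχ f)) x
    exact h3.trans h4
  obtain ⟨α, hα⟩ := (hN.dual_ex M (gM ∘ₗ β)).mp (by
    rw [dm_apply, LinearMap.comp_assoc, hcomm, ← LinearMap.comp_assoc,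
      hM.ex.linearMap_comp_eq_zero, LinearMap.zero_comp])
  refine ⟨α, ?_⟩
  ext1 z
  obtain ⟨z, rfl⟩ := hM.conn_surj c (hF.van _ (by omega)) z
  rw [← h1, SES.conn_natural hN hM α' β α hcomm hα]

lemma S_zero (hω : Can R ω n) {M N : Type} [AddCommGroup M] [Module R M] [AddCommGroup N]
    [Module R N] (hM : KK R ω 0 n M) (φ : EX R 0 M ω →ₗ[R] EX R 0 N ω) :
    ∃ α : N →ₗ[R] M, pre ω 0 α = φ := by
  obtain ⟨α, hα⟩ := of_dual hω hM ((ext0 N ω).toLinearMap ∘ₗ φ ∘ₗ (ext0 M ω).symm.toLinearMap)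
  refine ⟨α, ?_⟩
  ext1 z
  obtain ⟨f, rfl⟩ := (ext0 M ω).symm.surjective z
  rw [pre0, hα]
  simp

lemma S_all (hω : Can R ω n) (c : ℕ) {M N : Type} [AddCommGroup M] [Module R M]
    [AddCommGroup N] [Module R N] [Module.Finite R M] [Module.Finite R N]
    (hM : ∀ i, c + 1 < i → Subsingleton (EX R i M ω))
    (hN : ∀ i, i ≠ 0 → i ≠ c + 1 → Subsingleton (EX R i N ω))
    (hz : HZ R ω n (N →ₗ[R] ω)) (φ : EX R (c + 1) M ω →ₗ[R] EX R (c + 1) N ω) :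
    ∃ α : N →ₗ[R] M, pre ω (c + 1) α = φ := by
  have := hω.fin
  induction c generalizing M N with
  | zero =>
    obtain ⟨k, gM, hgM⟩ := exists_cover (R := R) M
    obtain ⟨l, gN, hgN⟩ := exists_cover (R := R) N
    have sM := SES.ker gM hgM
    have sN := SES.ker gN hgN
    have hF := KK.of_proj hω (Fin k → R)
    have hG := KK.of_proj hω (Fin l → R)
    have hM' : KK R ω 0 n (LinearMap.ker gM) := KK.mk' hω (by omega) (dim_le_n hω _) fun i hi =>
      sM.sub_left _ (hF.van _ (by omega)) (hM _ (by omega))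
    -- lifting
    let ιN := (LinearMap.ker gN).subtype
    let π := (dm ω ιN).rangeRestrict
    have s1 : SES (dm ω gN) π := by
      refine ⟨dm_inj hgN ω, fun z => ?_, LinearMap.surjective_rangeRestrict _⟩
      rw [← sN.dual_ex ω z]
      exact ⟨fun h => congrArg Subtype.val h, fun h => Subtype.ext h⟩
    have s2 : SES (LinearMap.range (dm ω ιN)).subtype (del sN ω) := by
      refine ⟨Subtype.val_injective, fun z => ?_, del_surj sN ω (hG.van _ (by omega))⟩
      rw [del_ex sN ω z]
      simp [ιN]
    have hD := hM'.dual0 hω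
    have hB : Subsingleton (EX R 1 (LinearMap.ker gM →ₗ[R] ω) (LinearMap.range (dm ω ιN))) :=
      s1.sub_right' 1 (sub_post_free 1 l (hD.van _ (by omega))) (hz _ hD 1)
    obtain ⟨ψ, hψ⟩ := s2.lift hB (φ ∘ₗ del sM ω)
    obtain ⟨α', hα'⟩ := of_dual hω hM' ψ
    refine S_core hω sM sN hz 0 φ α' ?_ ?_
    · intro z
      obtain ⟨f, rfl⟩ := (ext0 _ ω).symm.surjective z
      rw [pre0, hα']
      exact LinearMap.congr_fun hψ f
    · intro z
      rw [dm_apply α', hα']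
      refine (LinearMap.congr_fun hψ _).trans ?_
      rw [LinearMap.comp_apply, (del_ex sM ω _).mpr ⟨z, rfl⟩, map_zero]
  | succ c ih =>
    obtain ⟨k, gM, hgM⟩ := exists_cover (R := R) M
    obtain ⟨l, gN, hgN⟩ := exists_cover (R := R) N
    have sM := SES.ker gM hgM
    have sN := SES.ker gN hgN
    have hF := KK.of_proj hω (Fin k → R)
    have hG := KK.of_proj hω (Fin l → R)
    have h1 := hN 1 (by omega) (by omega)
    let e := LinearEquiv.ofBijective (sN.conn ω (c + 1))
      ⟨sN.conn_inj _ (hG.van _ (by omega)), sN.conn_surj _ (hG.van _ (by omega))⟩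
    obtain ⟨α', hα'⟩ := ih (M := LinearMap.ker gM) (N := LinearMap.ker gN)
      (fun i hi => sM.sub_left _ (hF.van _ (by omega)) (hM _ (by omega)))
      (fun i hi hi' => sN.sub_left _ (hG.van _ (by omega)) (hN _ (by omega) (by omega)))
      (fun Z _ _ hZ i => (sN.dual h1).sub_right' _ (sub_post_free _ l (hZ.van _ (by omega)))
        (hz _ hZ _)) (e.symm.toLinearMap ∘ₗ φ ∘ₗ sM.conn ω (c + 1))
    refine S_core hω sM sN hz (c + 1) φ α' ?_ ?_
    · intro z
      rw [hα']
      exact e.apply_symm_apply _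
    · intro z
      exact h1.elim _ _

end CMD
end

noncomputable section

namespace CMD

open IsLocalRing Pointwise

set_option linter.unusedSectionVars false

variable {R : Type} [CommRing R] [IsNoetherianRing R] [IsLocalRing R]
variable {ω : Type} [AddCommGroup ω] [Module R ω] {n : ℕ}

lemma F_all (hω : Can R ω n) {c d : ℕ} (hcd : c + d = n) {K N : Type} [AddCommGroup K] [Module R K]
    [Module.Finite R K] [AddCommGroup N] [Module R N] (hN : KK R ω c d N)
    (hK : Module.supportDim R K ≤ (d : WithBot ℕ∞)) (f : K →ₗ[R] N) (hf : pre ω c f = 0) :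
    f = 0 := by
  have := hω.fin
  induction d generalizing c K N with
  | zero =>
    have := hN.fin
    obtain rfl : c = n := by omega
    have h1 := pre_inj_of_surj hω f.rangeRestrict (LinearMap.surjective_rangeRestrict _) hK
    have h2 := pre_surj_of_inj hω (LinearMap.range f).subtype Subtype.val_injective
    have h3 : Subsingleton (EX R c (LinearMap.range f) ω) := by
      refine subsingleton_of_forall_eq 0 fun z => ?_
      obtain ⟨w, rfl⟩ := h2 z
      apply h1
      rw [← LinearMap.comp_apply, ← pre_comp, map_zero]
      exact LinearMap.congr_fun hf w
    obtain ⟨y, hy, hr⟩ := exists_reg_of_van hω h3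
    have h4 := dim_zero_not hy hr ((Module.supportDim_le_of_injective _
      (LinearMap.range f).injective_subtype).trans hN.dim)
    ext x
    exact congrArg Subtype.val (h4.elim (f.rangeRestrict x) 0)
  | succ d ih =>
    have := hN.fin
    obtain ⟨y, hy, hr⟩ := hN.exists_reg hω hcd
    let I := LinearMap.range f
    have hI : pre ω c I.subtype = 0 := by
      have h1 : Function.Injective (pre ω c f.rangeRestrict) := by
        have hs := SES.ker f.rangeRestrict (LinearMap.surjective_rangeRestrict _)
        rcases c with _ | c
        · exact hs.pre0_inj
        · exact hs.pre_inj c (van_lt hω ((Module.supportDim_le_of_injective _ hs.inj).trans hK) c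
            (by omega))
      ext1 z
      apply h1
      rw [← LinearMap.comp_apply, ← pre_comp, LinearMap.zero_apply, map_zero]
      exact LinearMap.congr_fun hf z
    have hle : ∀ k, I ≤ (maximalIdeal R) ^ k • (⊤ : Submodule R N) := by
      intro k
      have hyk : y ^ (k + 1) ∈ maximalIdeal R := Ideal.pow_mem_of_mem _ hy _ (by omega)
      have hrk : IsSMulRegular N (y ^ (k + 1)) := hr.pow _
      have hrI : IsSMulRegular I (y ^ (k + 1)) := fun a b hab => Subtype.ext (hrk (congrArg Subtype.val hab))
      have hsub : (y ^ (k + 1)) • (⊤ : Submodule R I) ≤ ((y ^ (k + 1)) • (⊤ : Submodule R N)).comap I.subtype := by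
        intro x hx
        obtain ⟨w, _, rfl⟩ := (Submodule.mem_smul_pointwise_iff_exists _ _ _).mp hx
        exact (Submodule.mem_smul_pointwise_iff_exists _ _ _).mpr ⟨w.1, trivial, rfl⟩
      let fk : QuotSMulTop (y ^ (k + 1)) I →ₗ[R] QuotSMulTop (y ^ (k + 1)) N :=
        Submodule.mapQ _ _ I.subtype hsub
      have hfk : fk = 0 := by
        refine ih (by omega) (hN.quot hω hcd hyk hrk) (dim_quot hyk hrI
          ((Module.supportDim_le_of_injective _ I.injective_subtype).trans hN.dim)) fk ?_
        ext1 z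
        obtain ⟨z, rfl⟩ := (hN.ses hω hcd hyk hrk).surj z
        rw [← SES.conn_natural (SES.quotSMul _ hrI) (SES.quotSMul _ hrk) I.subtype I.subtype fk
          (by ext x; rfl) (by ext x; rfl), hI]
        simp
      intro x hx
      have h5 : fk (Submodule.Quotient.mk ⟨x, hx⟩) = 0 := by rw [hfk]; rfl
      have h6 : x ∈ (y ^ (k + 1)) • (⊤ : Submodule R N) := (Submodule.Quotient.mk_eq_zero _).mp h5
      obtain ⟨w, _, rfl⟩ := (Submodule.mem_smul_pointwise_iff_exists _ _ _).mp h6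
      refine Submodule.smul_mem_smul ?_ trivial
      exact Ideal.pow_le_pow_right (Nat.le_succ k) (Ideal.pow_mem_pow hy _)
    have hbot : I ≤ ⊥ := by
      rw [← Ideal.iInf_pow_smul_eq_bot_of_isLocalRing (M := N) (maximalIdeal R) (maximalIdeal.isMaximal R).ne_top]
      exact le_iInf hle
    ext x
    exact (Submodule.mem_bot R).mp (hbot ⟨x, rfl⟩)

/-- the main construction -/
lemma main (hω : Can R ω n) {c d : ℕ} (hcd : c + d = n) {M : Type} [AddCommGroup M] [Module R M]
    [Module.Finite R M] (hM : ∀ i, c < i → Subsingleton (EX R i M ω))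
    (hE : KK R ω c d (EX R c M ω)) {N : Type} [AddCommGroup N] [Module R N]
    (e : N ≃ₗ[R] EX R c (EX R c M ω) ω) :
    ∃ α : N →ₗ[R] M, Function.Injective α ∧ Function.Bijective (pre ω c α) := by
  have hN : KK R ω c d N := (hE.dual hω hcd).of_equiv e.symm
  have := hN.fin
  obtain ⟨e1⟩ := hE.bidual hω hcd
  let φ : EX R c M ω ≃ₗ[R] EX R c N ω := e1 ≪≫ₗ preEquiv ω c e
  obtain ⟨α, hα⟩ : ∃ α : N →ₗ[R] M, pre ω c α = φ.toLinearMap := by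
    rcases c with _ | c
    · obtain rfl : d = n := by omega
      exact S_zero hω (KK.mk' hω (by omega) (dim_le_n hω _) hM) _
    · refine S_all hω c hM (fun i _ hi => hN.van _ hi) ?_ _
      have h0 := hN.van 0 (by omega)
      have : Subsingleton (N →ₗ[R] ω) := (ext0 N ω).symm.injective.subsingleton
      intro Z _ _ _ i
      exact sub_EX_right _
  have hb : Function.Bijective (pre ω c α) := by rw [hα]; exact φ.bijective
  refine ⟨α, ?_, hb⟩
  have h1 := F_all hω hcd hN ((Module.supportDim_le_of_injective _
    (LinearMap.ker α).injective_subtype).trans hN.dim) (LinearMap.ker α).subtype (by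
      ext1 z
      obtain ⟨w, rfl⟩ := hb.2 z
      rw [← LinearMap.comp_apply, ← pre_comp, show α ∘ₗ (LinearMap.ker α).subtype = 0 by ext x; exact x.2,
        pre_zero]
      rfl)
  rw [injective_iff_map_eq_zero]
  intro x hx
  exact LinearMap.congr_fun h1 ⟨x, hx⟩

end CMD
end

namespace CMD

open IsLocalRing in
lemma depth_van {R : Type} [CommRing R] [IsLocalRing R] {X : Type} [AddCommGroup X] [Module R X]
    {t : ℕ} (h : (t : ℕ∞) ≤ mDepth R (maximalIdeal R) X) (j : ℕ) (hj : j < t) :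
    Subsingleton (EX R j (R ⧸ maximalIdeal R) X) := by
  by_contra hc
  rw [not_subsingleton_iff_nontrivial] at hc
  let e := cmp j (ModuleCat.of R (R ⧸ maximalIdeal R)) (ModuleCat.of R X)
  have h1 : mDepth R (maximalIdeal R) X ≤ (j : ℕ∞) :=
    sInf_le ⟨j, rfl, e.toEquiv.nontrivial⟩
  have h2 := h.trans h1
  rw [Nat.cast_le] at h2
  omega

end CMD

open IsLocalRing in
/-- Let `R` be an `n`-dimensional Cohen-Macaulay Noetherian local ring with
canonical module `ω`, and `M` a finitely generated module with `t = depth M`.  If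
`Ext_R^{n-t}(M, ω)` is Cohen-Macaulay of dimension `t`, then there is a (natural)
monomorphism `α : Ext_R^{n-t}(Ext_R^{n-t}(M, ω), ω) ⟶ M` such that the induced map
`Ext^{n-t}(α) : Ext_R^{n-t}(M, ω) ⟶ Ext_R^{n-t}(Ext_R^{n-t}(Ext_R^{n-t}(M, ω), ω), ω)`
is an isomorphism. -/
theorem stmt11 (R : Type) [CommRing R] [IsNoetherianRing R] [IsLocalRing R]
    (hCMring : IsCMLocalRing R) (n : ℕ) (hn : ringKrullDim R = (n : WithBot ℕ∞))
    (ω : Type) [AddCommGroup ω] [Module R ω] (hω : IsCanonicalModule R ω)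
    (M : Type) [AddCommGroup M] [Module R M] [Module.Finite R M]
    (t : ℕ) (ht : mDepth R (maximalIdeal R) M = (t : ℕ∞))
    (hext : IsCM R (maximalIdeal R) (extC R (n - t) M ω) ∧
      mDim R (extC R (n - t) M ω) = (t : WithBot ℕ∞)) :
    ∃ α : extObj R (n - t) (extObj R (n - t) (ModuleCat.of R M) (ModuleCat.of R ω))
        (ModuleCat.of R ω) ⟶ ModuleCat.of R M,
      CategoryTheory.Mono α ∧
      CategoryTheory.IsIso
        (((Ext R (ModuleCat R) (n - t)).map α.op).app (ModuleCat.of R ω)) := by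
  have hfin := hω.1
  have hcan : CMD.Can R ω n := by
    refine ⟨hfin, ?_, ?_, hn⟩
    · obtain ⟨e⟩ := (hω.2 n).1 hn.symm
      exact ⟨(CMD.cmp n (ModuleCat.of R (R ⧸ maximalIdeal R)) (ModuleCat.of R ω)).symm ≪≫ₗ e⟩
    · intro i hi
      have h := (hω.2 i).2 (by rw [hn]; exact_mod_cast hi)
      exact (CMD.cmp i (ModuleCat.of R (R ⧸ maximalIdeal R)) (ModuleCat.of R ω)).symm.injective.subsingleton
  have htn : t ≤ n := by
    have h1 := Module.supportDim_le_ringKrullDim R (extC R (n - t) M ω)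
    have h2 : Module.supportDim R (extC R (n - t) M ω) = (t : WithBot ℕ∞) := hext.2
    rw [h2, hn] at h1
    exact_mod_cast h1
  have hcd : (n - t) + t = n := by omega
  let eM : extC R (n - t) M ω ≃ₗ[R] CMD.EX R (n - t) M ω :=
    CMD.cmp (n - t) (ModuleCat.of R M) (ModuleCat.of R ω)
  have hM : ∀ i, n - t < i → Subsingleton (CMD.EX R i M ω) := fun i hi =>
    CMD.van_depth hcan t (CMD.depth_van ht.ge) i (by omega)
  have hE0 : CMD.KK R ω (n - t) t (extC R (n - t) M ω) := by
    have : Module.Finite R (extC R (n - t) M ω) := Module.Finite.equiv eM.symm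
    refine CMD.KK.mk' hcan hcd (le_of_eq hext.2) fun i hi => ?_
    refine CMD.van_depth hcan t (CMD.depth_van ?_) i (by omega)
    have h3 := hext.1.2
    rw [hext.2] at h3
    exact le_of_eq (WithBot.coe_injective h3).symm
  let eN : extObj R (n - t) (extObj R (n - t) (ModuleCat.of R M) (ModuleCat.of R ω))
        (ModuleCat.of R ω) ≃ₗ[R] CMD.EX R (n - t) (CMD.EX R (n - t) M ω) ω :=
    (CMD.cmp (n - t) (extObj R (n - t) (ModuleCat.of R M) (ModuleCat.of R ω)) (ModuleCat.of R ω)) ≪≫ₗ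
      CMD.preEquiv ω (n - t) eM.symm
  obtain ⟨α, hinj, hbij⟩ := CMD.main hcan hcd hM (hE0.of_equiv eM) eN
  refine ⟨ModuleCat.ofHom α, (ModuleCat.mono_iff_injective _).mpr hinj, ?_⟩
  rw [ConcreteCategory.isIso_iff_bijective]
  let g : extObj R (n - t) (extObj R (n - t) (ModuleCat.of R M) (ModuleCat.of R ω))
        (ModuleCat.of R ω) ⟶ ModuleCat.of R M := ModuleCat.ofHom α
  have key := CMD.cmp_nat (n - t) (ModuleCat.of R ω) g
  let e1 := CMD.cmp (n - t) (extObj R (n - t) (extObj R (n - t) (ModuleCat.of R M) (ModuleCat.of R ω))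
        (ModuleCat.of R ω)) (ModuleCat.of R ω)
  have hb : Function.Bijective (e1 ∘ ((((Ext R (ModuleCat R) (n - t)).map g.op).app (ModuleCat.of R ω)).hom)) := by
    have : e1 ∘ ((((Ext R (ModuleCat R) (n - t)).map g.op).app (ModuleCat.of R ω)).hom) =
      (CMD.pre ω (n - t) α) ∘ eM := funext key
    rw [this]
    exact hbij.comp eM.bijective
  exact (Function.Bijective.of_comp_iff' e1.bijective _).mp hb
end
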